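/- Let G be a connected (possibly infinite) graph and let s, t ∈ V(G) be distinct. Then the set 𝔠(s,t) of Erdős–Menger st-cuts, ordered by ≼, is a complete lattice, although in general it is not a sublattice of the lattice of all ⊆-minimal st-cuts. -/

import Mathlib

/-!
Common definitions: multigraphs (parallel edges allowed, no loops), walks,
paths, cuts, waves and related notions used in the statements below.
-/

universe u v

/-- A multigraph with vertex type `V` and edge type `E`: every edge is assigned
an unordered pair of *distinct* end-vertices (parallel edges allowed, no loops). -/
structure Multigraph (V : Type u) (E : Type v) : Type (max u v) where
  inc : E → Sym2 V
  not_isDiag : ∀ e, ¬ (inc e).IsDiag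

namespace Multigraph

variable {V : Type u} {E : Type v}

/-- Walks in a multigraph, recorded together with the edges they traverse. -/
inductive Walk (G : Multigraph V E) : V → V → Type (max u v)
  | nil (v : V) : Walk G v v
  | cons {u v w : V} (e : E) (he : G.inc e = s(u, v)) (p : Walk G v w) : Walk G u w

namespace Walk

variable {G : Multigraph V E}

/-- The list of vertices visited by a walk. -/
def support : ∀ {u w : V}, G.Walk u w → List V
  | _, _, .nil v => [v]
  | u, _, .cons _ _ p => u :: p.support

/-- The list of edges traversed by a walk. -/
def edges : ∀ {u w : V}, G.Walk u w → List E
  | _, _, .nil _ => []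
  | _, _, .cons e _ p => e :: p.edges

end Walk

/-- `δ_G(v)`: the set of edges incident with the vertex `v`. -/
def inci (G : Multigraph V E) (v : V) : Set E := {e | v ∈ G.inc e}

/-- `δ_G(X)`: the set of edges with exactly one end-vertex in `X`. -/
def cut (G : Multigraph V E) (X : Set V) : Set E :=
  {e | ∃ x y, G.inc e = s(x, y) ∧ x ∈ X ∧ y ∉ X}

/-- Connectedness of a multigraph. -/
def Connected (G : Multigraph V E) : Prop := ∀ u v : V, Nonempty (G.Walk u v)

/-- A `T`-path: a path connecting two distinct vertices of `T`
with no internal vertex in `T`. -/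
structure TPath (G : Multigraph V E) (T : Set V) : Type (max u v) where
  first : V
  last : V
  walk : G.Walk first last
  first_mem : first ∈ T
  last_mem : last ∈ T
  ne : first ≠ last
  support_nodup : walk.support.Nodup
  internal : ∀ x ∈ walk.support, x ∈ T → x = first ∨ x = last

/-- A system of pairwise edge-disjoint `T`-paths. -/
def TPathDisjoint (G : Multigraph V E) {T : Set V} (P : Set (G.TPath T)) : Prop :=
  ∀ p ∈ P, ∀ q ∈ P, p ≠ q → ∀ e, e ∈ p.walk.edges → e ∉ q.walk.edges

/-- An `st`-path: a path from `s` to `t` (no internal vertex is `s` or `t`,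
which is automatic as the vertices of a path are distinct). -/
structure STPath (G : Multigraph V E) (s t : V) : Type (max u v) where
  walk : G.Walk s t
  support_nodup : walk.support.Nodup

/-- A system of pairwise edge-disjoint `st`-paths. -/
def STPathDisjoint (G : Multigraph V E) {s t : V} (P : Set (G.STPath s t)) : Prop :=
  ∀ p ∈ P, ∀ q ∈ P, p ≠ q → ∀ e, e ∈ p.walk.edges → e ∉ q.walk.edges

/-- A nontrivial path starting at `s`. -/
structure SPath (G : Multigraph V E) (s : V) : Type (max u v) where
  last : V
  walk : G.Walk s last
  support_nodup : walk.support.Nodup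
  edges_ne_nil : walk.edges ≠ []

/-- A system of pairwise edge-disjoint paths starting at `s`. -/
def SPathDisjoint (G : Multigraph V E) {s : V} (W : Set (G.SPath s)) : Prop :=
  ∀ p ∈ W, ∀ q ∈ W, p ≠ q → ∀ e, e ∈ p.walk.edges → e ∉ q.walk.edges

/-- The set of last edges of a system of paths starting at `s`. -/
def lastEdges (G : Multigraph V E) {s : V} (W : Set (G.SPath s)) : Set E :=
  {e | ∃ p ∈ W, p.walk.edges.getLast? = some e}

/-- `C` is a cut separating `A` from `B`. -/
def SepCut (G : Multigraph V E) (A B : Set V) (C : Set E) : Prop :=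
  ∃ X : Set V, A ⊆ X ∧ (∀ b ∈ B, b ∉ X) ∧ C = G.cut X

/-- `C` is a `⊆`-minimal cut separating `A` from `B`. -/
def IsMinSepCut (G : Multigraph V E) (A B : Set V) (C : Set E) : Prop :=
  G.SepCut A B C ∧ ∀ D : Set E, G.SepCut A B D → D ⊆ C → D = C

/-- An `s`-`B`-wave: a system of pairwise edge-disjoint paths starting at `s`
whose set of last edges is a `⊆`-minimal cut separating `s` from `B`. -/
def IsWave (G : Multigraph V E) (s : V) (B : Set V) (W : Set (G.SPath s)) : Prop :=
  G.SPathDisjoint W ∧ G.IsMinSepCut {s} B (G.lastEdges W)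

/-- An Erdős–Menger `st`-cut: an `st`-cut which is orthogonal to some system of
pairwise edge-disjoint `st`-paths, i.e. it consists of exactly one edge chosen
from each path of the system. -/
def IsEMCut (G : Multigraph V E) (s t : V) (C : Set E) : Prop :=
  (∃ X : Set V, s ∈ X ∧ t ∉ X ∧ C = G.cut X) ∧
  ∃ P : Set (G.STPath s t), G.STPathDisjoint P ∧
    (∀ p ∈ P, ∃! e, e ∈ C ∧ e ∈ p.walk.edges) ∧
    (∀ e ∈ C, ∃ p ∈ P, e ∈ p.walk.edges)

/-- The order `≼` on `st`-cuts: the `s`-side of `C` is contained in the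
`s`-side of `D` (in a connected graph the `s`-side is unique). -/
def CutLE (G : Multigraph V E) (s t : V) (C D : Set E) : Prop :=
  ∃ X Y : Set V, s ∈ X ∧ t ∉ X ∧ C = G.cut X ∧ s ∈ Y ∧ t ∉ Y ∧ D = G.cut Y ∧ X ⊆ Y

/-- A cut of the form `C_W` for some `st`-wave `W`. -/
def IsWaveCut (G : Multigraph V E) (s t : V) (C : Set E) : Prop :=
  ∃ W : Set (G.SPath s), G.IsWave s {t} W ∧ G.lastEdges W = C

/-- Deletion of a set of edges. -/
def deleteEdges (G : Multigraph V E) (F : Set E) : Multigraph V {e : E // e ∉ F} where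
  inc e := G.inc e.1
  not_isDiag e := G.not_isDiag e.1

open Classical in
/-- Contraction of the vertex set `X` to the vertex `s` (edges inside `X` are
deleted, edges leaving `X` are redirected to `s`). -/
noncomputable def contract (G : Multigraph V E) (X : Set V) (s : V) :
    Multigraph V {e : E // ¬ (Sym2.map (fun v => if v ∈ X then s else v) (G.inc e)).IsDiag} where
  inc e := Sym2.map (fun v => if v ∈ X then s else v) (G.inc e.1)
  not_isDiag e := e.2

/-- Reachability inside a set `S` of vertices. -/
def ReachableIn (G : Multigraph V E) (S : Set V) (x y : V) : Prop :=
  ∃ p : G.Walk x y, ∀ z ∈ p.support, z ∈ S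

/-- `Y` is (the vertex set of) a connected component of the subgraph of `G`
induced by `S`. -/
def IsComponentOf (G : Multigraph V E) (Y S : Set V) : Prop :=
  Y.Nonempty ∧ Y ⊆ S ∧ ∀ x ∈ Y, ∀ y ∈ S, (G.ReachableIn S x y ↔ y ∈ Y)

/-- A cycle in a multigraph (a closed walk with distinct edges whose
vertices are distinct except that the first one equals the last one). -/
structure Cycle (G : Multigraph V E) : Type (max u v) where
  base : V
  walk : G.Walk base base
  edges_ne_nil : walk.edges ≠ []
  edges_nodup : walk.edges.Nodup
  support_tail_nodup : walk.support.tail.Nodup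

/-- A graph is Eulerian if its edge set can be partitioned into
edge sets of cycles. -/
def IsEulerian (G : Multigraph V E) : Prop :=
  ∃ C : Set G.Cycle,
    (∀ c ∈ C, ∀ d ∈ C, c ≠ d → ∀ e, e ∈ c.walk.edges → e ∉ d.walk.edges) ∧
    ∀ e : E, ∃ c ∈ C, e ∈ c.walk.edges

/-- A `T`-partition: a family `{A t : t ∈ T}` of pairwise disjoint vertex sets
with `A t ∩ T = {t}`. -/
def IsTPartition (T : Set V) (A : V → Set V) : Prop :=
  (∀ t ∈ T, A t ∩ T = {t}) ∧
  ∀ t₁ ∈ T, ∀ t₂ ∈ T, t₁ ≠ t₂ → Disjoint (A t₁) (A t₂)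

end Multigraph

namespace EM
open Set Relation

universe w
variable {V : Type u} {E : Type v} (G : Multigraph V E)

/-- Connectedness by edges from `F`. -/
def Conn (F : Set E) : V → V → Prop :=
  ReflTransGen (fun a b => ∃ e ∈ F, G.inc e = s(a, b))

/-- Edges touching `W`. -/
def Tch (W : Set V) : Set E := {e | ∃ x ∈ G.inc e, x ∈ W}

/-- Edges inside `W`. -/
def Ins (W : Set V) : Set E := {e | ∀ x ∈ G.inc e, x ∈ W}

open Classical in
/-- The outer end of an edge leaving `W`. -/
noncomputable def out (W : Set V) (e : E) : V :=
  if h : ∃ y, y ∈ G.inc e ∧ y ∉ W then h.choose else (Quot.out (G.inc e)).1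

open Classical in
/-- The inner end of an edge leaving `W`. -/
noncomputable def inn (W : Set V) (e : E) : V :=
  if h : ∃ y, y ∈ G.inc e ∧ y ∈ W then h.choose else (Quot.out (G.inc e)).1

variable {G}

lemma mem_cut_iff {W : Set V} {e : E} :
    e ∈ G.cut W ↔ ∃ x y, G.inc e = s(x, y) ∧ x ∈ W ∧ y ∉ W := Iff.rfl

lemma inc_eq {W : Set V} {e : E} (h : e ∈ G.cut W) :
    G.inc e = s(inn G W e, out G W e) ∧ inn G W e ∈ W ∧ out G W e ∉ W := by
  obtain ⟨x, y, hxy, hx, hy⟩ := h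
  have h1 : ∃ y, y ∈ G.inc e ∧ y ∉ W := ⟨y, by rw [hxy]; simp, hy⟩
  have h2 : ∃ y, y ∈ G.inc e ∧ y ∈ W := ⟨x, by rw [hxy]; simp, hx⟩
  have e1 : out G W e = h1.choose := by simp only [out]; rw [dif_pos h1]
  have e2 : inn G W e = h2.choose := by simp only [inn]; rw [dif_pos h2]
  have s1 := h1.choose_spec
  have s2 := h2.choose_spec
  rw [← e1] at s1
  rw [← e2] at s2
  rw [hxy] at s1 s2 ⊢
  simp only [Sym2.mem_iff] at s1 s2
  obtain ⟨s1 | s1, s1'⟩ := s1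
  · rw [s1] at s1'; exact absurd hx s1'
  obtain ⟨s2 | s2, s2'⟩ := s2
  · rw [s1, s2]; exact ⟨rfl, hx, hy⟩
  · rw [s2] at s2'; exact absurd s2' hy

lemma inn_eq {W : Set V} {e : E} {x y : V} (h : G.inc e = s(x, y)) (hx : x ∈ W) (hy : y ∉ W) :
    inn G W e = x ∧ out G W e = y := by
  obtain ⟨h1, h2, h3⟩ := inc_eq (G := G) (W := W) (e := e) ⟨x, y, h, hx, hy⟩
  rw [h] at h1
  rcases Sym2.eq_iff.1 h1 with ⟨a, b⟩ | ⟨a, b⟩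
  · exact ⟨a.symm, b.symm⟩
  · rw [a] at hx; exact absurd hx h3

lemma tch_iff {W : Set V} {e : E} {x y : V} (h : G.inc e = s(x, y)) :
    e ∈ Tch G W ↔ x ∈ W ∨ y ∈ W := by
  simp [Tch, h]

lemma ins_iff {W : Set V} {e : E} {x y : V} (h : G.inc e = s(x, y)) :
    e ∈ Ins G W ↔ x ∈ W ∧ y ∈ W := by
  simp [Ins, h]

lemma cut_iff {W : Set V} {e : E} {x y : V} (h : G.inc e = s(x, y)) :
    e ∈ G.cut W ↔ (x ∈ W ∧ y ∉ W) ∨ (y ∈ W ∧ x ∉ W) := by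
  rw [mem_cut_iff]
  constructor
  · rintro ⟨a, b, h', ha, hb⟩
    rw [h] at h'
    rcases Sym2.eq_iff.1 h' with ⟨rfl, rfl⟩ | ⟨rfl, rfl⟩
    · exact Or.inl ⟨ha, hb⟩
    · exact Or.inr ⟨ha, hb⟩
  · rintro (⟨a, b⟩ | ⟨a, b⟩)
    · exact ⟨x, y, h, a, b⟩
    · exact ⟨y, x, by rw [h, Sym2.eq_swap], a, b⟩

lemma exists_ends (e : E) : ∃ x y, G.inc e = s(x, y) := by
  induction h : G.inc e with
  | _ x y => exact ⟨x, y, rfl⟩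

lemma Conn.refl {F : Set E} (a : V) : Conn G F a a := ReflTransGen.refl

lemma Conn.trans {F : Set E} {a b c : V} (h : Conn G F a b) (h' : Conn G F b c) :
    Conn G F a c := ReflTransGen.trans h h'

lemma Conn.mono {F F' : Set E} {a b : V} (h : Conn G F a b) (hF : F ⊆ F') : Conn G F' a b :=
  ReflTransGen.mono (fun _ _ ⟨e, he, hh⟩ => ⟨e, hF he, hh⟩) _ _ h

lemma Conn.symm {F : Set E} {a b : V} (h : Conn G F a b) : Conn G F b a := by
  induction h with
  | refl => exact Conn.refl _
  | tail _ h2 ih =>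
    obtain ⟨e, he, hh⟩ := h2
    exact Conn.trans (ReflTransGen.single ⟨e, he, by rw [hh, Sym2.eq_swap]⟩) ih

lemma Conn.single {F : Set E} {a b : V} {e : E} (he : e ∈ F) (h : G.inc e = s(a, b)) :
    Conn G F a b := ReflTransGen.single ⟨e, he, h⟩

lemma lastexit {F : Set E} {W : Set V} {a x : V} (h : Conn G F a x) (hx : x ∉ W) :
    (a ∉ W ∧ Conn G (F \ Tch G W) a x) ∨
      ∃ c ∈ F ∩ G.cut W, Conn G (F \ Tch G W) (out G W c) x := by
  induction h with
  | refl => exact Or.inl ⟨hx, Conn.refl _⟩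
  | @tail b x h1 h2 ih =>
    obtain ⟨e, he, hh⟩ := h2
    by_cases hb : b ∈ W
    · refine Or.inr ⟨e, ⟨he, b, x, hh, hb, hx⟩, ?_⟩
      rw [(inn_eq hh hb hx).2]
      exact Conn.refl _
    · have hn : e ∈ F \ Tch G W := ⟨he, by rw [tch_iff hh]; tauto⟩
      rcases ih hb with ⟨ha, h3⟩ | ⟨c, hc, h3⟩
      · exact Or.inl ⟨ha, h3.trans (Conn.single hn hh)⟩
      · exact Or.inr ⟨c, hc, h3.trans (Conn.single hn hh)⟩

lemma exit_or {F : Set E} {W : Set V} {a b : V} (h : Conn G F a b) (ha : a ∈ W) :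
    (b ∈ W ∧ Conn G (F ∩ Ins G W) a b) ∨
      ∃ c ∈ F ∩ G.cut W, Conn G (F ∩ Ins G W) a (inn G W c) := by
  induction h with
  | refl => exact Or.inl ⟨ha, Conn.refl _⟩
  | @tail b x h1 h2 ih =>
    obtain ⟨e, he, hh⟩ := h2
    rcases ih with ⟨hb, h3⟩ | h3
    · by_cases hx : x ∈ W
      · exact Or.inl ⟨hx, h3.trans (Conn.single ⟨he, by rw [ins_iff hh]; tauto⟩ hh)⟩
      · refine Or.inr ⟨e, ⟨he, b, x, hh, hb, hx⟩, ?_⟩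
        rwa [(inn_eq hh hb hx).1]
    · exact Or.inr h3

lemma firstexit {F : Set E} {W : Set V} {a b : V} (h : Conn G F a b) (ha : a ∈ W) (hb : b ∉ W) :
    ∃ c ∈ F ∩ G.cut W, Conn G (F ∩ Ins G W) a (inn G W c) := by
  rcases exit_or h ha with h | h
  · exact absurd h.1 hb
  · exact h

lemma stay {F : Set E} {W : Set V} {a b : V} (h : Conn G F a b) (hb : b ∈ W)
    (hF : ∀ c ∈ F, c ∉ G.cut W) : a ∈ W ∧ Conn G (F ∩ Ins G W) a b := by
  rcases exit_or h.symm hb with h | ⟨c, hc, _⟩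
  · exact ⟨h.1, h.2.symm⟩
  · exact absurd hc.2 (hF c hc.1)

lemma stay_ins {F : Set E} {W : Set V} {a b : V} (h : Conn G F a b) (hb : b ∈ W)
    (hF : F ⊆ Ins G W) : a ∈ W := by
  refine (stay h hb ?_).1
  intro c hc hc'
  obtain ⟨x, y, h, hx, hy⟩ := hc'
  exact hy (((ins_iff h).1 (hF hc)).2)

/-- `(u, P)` links all edges of `A` leaving `X` to distinct units, inside `X`. -/
structure Lk {ι : Type w} (G : Multigraph V E) (σ : ι → V) (A : Set E) (I : Set ι) (X : Set V)
    (u : E → ι) (P : E → Set E) : Prop where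
  mem : ∀ e ∈ A ∩ G.cut X, u e ∈ I
  fin : ∀ e ∈ A ∩ G.cut X, (P e).Finite
  sub : ∀ e ∈ A ∩ G.cut X, P e ⊆ A
  ins : ∀ e ∈ A ∩ G.cut X, P e ⊆ Ins G X
  conn : ∀ e ∈ A ∩ G.cut X, Conn G (P e) (σ (u e)) (inn G X e)
  inj : ∀ e ∈ A ∩ G.cut X, ∀ f ∈ A ∩ G.cut X, u e = u f → e = f
  disj : ∀ e ∈ A ∩ G.cut X, ∀ f ∈ A ∩ G.cut X, ∀ g, g ∈ P e → g ∈ P f → e = f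

variable {ι : Type w} {σ : ι → V} {A : Set E} {I : Set ι} {T : Set V}

lemma Lk.start {X : Set V} {u : E → ι} {P : E → Set E} (h : Lk G σ A I X u P)
    {e : E} (he : e ∈ A ∩ G.cut X) : σ (u e) ∈ X :=
  stay_ins (h.conn e he) (inc_eq he.2).2.1 (h.ins e he)

lemma Lk.mono_units {X : Set V} {u : E → ι} {P : E → Set E} (h : Lk G σ A I X u P) {I' : Set ι}
    (h' : ∀ e ∈ A ∩ G.cut X, u e ∈ I') : Lk G σ A I' X u P :=
  { h with mem := h' }

variable (G σ A I T)

/-- `X` is a wave. -/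
def Wave (X : Set V) : Prop := Disjoint X T ∧ ∃ u P, Lk G σ A I X u P

/-- `X` is a hindrance with slack unit `i`. -/
def HindAt (X : Set V) : Prop := ∃ u P i, Lk G σ A I X u P ∧ i ∈ I ∧ σ i ∈ X ∧
  ∀ e ∈ A ∩ G.cut X, u e ≠ i

/-- the web is hindered. -/
def Hind : Prop := ∃ X, Disjoint X T ∧ HindAt G σ A I X

/-- only the empty wave. -/
def WaveFree : Prop := ∀ X, Wave G σ A I T X → X = ∅

/-- positions of units in the quotient. -/
noncomputable def Qs (W : Set V) : ι ⊕ E → V := Sum.elim σ (out G W)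

/-- units of the quotient. -/
def QI (W : Set V) : Set (ι ⊕ E) := {j | (∃ i ∈ I, σ i ∉ W ∧ j = Sum.inl i) ∨
  (∃ c ∈ A ∩ G.cut W, j = Sum.inr c)}

variable {G σ A I T}

lemma WaveFree.unhind (h : WaveFree G σ A I T) : ¬ Hind G σ A I T := by
  rintro ⟨X, hX, u, P, i, hL, hi, hiX, hs⟩
  have := h X ⟨hX, u, P, hL⟩
  rw [this] at hiX
  exact hiX

@[simp] lemma inl_mem_QI {W : Set V} {i : ι} : (Sum.inl i : ι ⊕ E) ∈ QI G σ A I W ↔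
    i ∈ I ∧ σ i ∉ W := by
  simp [QI]

@[simp] lemma inr_mem_QI {W : Set V} {c : E} : (Sum.inr c : ι ⊕ E) ∈ QI G σ A I W ↔
    c ∈ A ∧ c ∈ G.cut W := by
  simp [QI]

@[simp] lemma Qs_inl {W : Set V} {i : ι} : Qs G σ W (Sum.inl i) = σ i := rfl
@[simp] lemma Qs_inr {W : Set V} {c : E} : Qs G σ W (Sum.inr c : ι ⊕ E) = out G W c := rfl

lemma ins_not_cut {W : Set V} {e : E} (h : e ∈ Ins G W) : e ∉ G.cut W := by
  rintro ⟨x, y, h', hx, hy⟩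
  exact hy ((ins_iff h').1 h).2

lemma cut_tch {W : Set V} {e : E} (h : e ∈ G.cut W) : e ∈ Tch G W := by
  obtain ⟨x, y, h', hx, hy⟩ := h
  exact (tch_iff h').2 (Or.inl hx)

lemma ins_tch {W : Set V} {e : E} (h : e ∈ Ins G W) : e ∈ Tch G W := by
  obtain ⟨x, y, h'⟩ := exists_ends (G := G) e
  exact (tch_iff h').2 (Or.inl ((ins_iff h').1 h).1)

lemma tch_ins_or_cut {W : Set V} {e : E} (h : e ∈ Tch G W) : e ∈ Ins G W ∨ e ∈ G.cut W := by
  obtain ⟨x, y, h'⟩ := exists_ends (G := G) e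
  rw [tch_iff h'] at h
  rw [ins_iff h', cut_iff h']
  tauto

lemma ins_mono {W W' : Set V} (h : W ⊆ W') : Ins G W ⊆ Ins G W' := fun _ he x hx => h (he x hx)
lemma tch_mono {W W' : Set V} (h : W ⊆ W') : Tch G W ⊆ Tch G W' := fun _ ⟨x, hx, hx'⟩ => ⟨x, hx, h hx'⟩

end EM



namespace EM
open Set Relation

universe w
variable {V : Type u} {E : Type v} {G : Multigraph V E}
variable {ι : Type w} {σ : ι → V} {A : Set E} {I : Set ι} {T : Set V}

/-- unit of the composed linking -/
def q1u (u : E → ι) : ι ⊕ E → ι := Sum.elim id u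

/-- path of the composed linking -/
def q1P (P : E → Set E) (S : Set E) : ι ⊕ E → Set E := Sum.elim (fun _ => S) (fun c => P c ∪ {c} ∪ S)

lemma cut_union_cases {W Y : Set V} {e : E} (h : e ∈ G.cut (W ∪ Y)) :
    (e ∈ Tch G W ∧ e ∈ G.cut W ∧ inn G (W ∪ Y) e = inn G W e) ∨
    (e ∉ Tch G W ∧ e ∈ G.cut Y ∧ inn G (W ∪ Y) e = inn G Y e) := by
  obtain ⟨x, y, hxy, hx, hy⟩ := h
  have hy1 : y ∉ W := fun h => hy (Or.inl h)
  have hy2 : y ∉ Y := fun h => hy (Or.inr h)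
  by_cases hW : x ∈ W
  · left
    refine ⟨(tch_iff hxy).2 (Or.inl hW), ⟨x, y, hxy, hW, hy1⟩, ?_⟩
    rw [(inn_eq hxy hx hy).1, (inn_eq hxy hW hy1).1]
  · right
    have hY : x ∈ Y := hx.resolve_left hW
    refine ⟨by rw [tch_iff hxy]; tauto, ⟨x, y, hxy, hY, hy2⟩, ?_⟩
    rw [(inn_eq hxy hx hy).1, (inn_eq hxy hY hy2).1]

/-- Composition of a linking of `W` and a linking of `Y` in the quotient by `W`. -/
lemma Q1 {W Y : Set V} {u : E → ι} {P : E → Set E} {u' : E → ι ⊕ E} {P' : E → Set E}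
    (h : Lk G σ A I W u P) (h' : Lk G (Qs G σ W) (A \ Tch G W) (QI G σ A I W) Y u' P')
    (hd : Disjoint Y W) :
    ∃ u'' P'', Lk G σ A I (W ∪ Y) u'' P'' ∧
      (∀ e ∈ Tch G W, u'' e = u e ∧ P'' e = P e) ∧
      (∀ e ∉ Tch G W, u'' e = q1u u (u' e) ∧ P'' e = q1P P (P' e) (u' e)) := by
  classical
  have hdisj : ∀ x, x ∈ Y → x ∉ W := fun x hx hx' => Set.disjoint_left.1 hd hx hx'
  set u'' : E → ι := fun e => if e ∈ Tch G W then u e else q1u u (u' e) with hu''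
  set P'' : E → Set E := fun e => if e ∈ Tch G W then P e else q1P P (P' e) (u' e) with hP''
  have hu1 : ∀ e ∈ Tch G W, u'' e = u e := fun e he => by simp [hu'', he]
  have hu2 : ∀ e ∉ Tch G W, u'' e = q1u u (u' e) := fun e he => by simp [hu'', he]
  have hP1 : ∀ e ∈ Tch G W, P'' e = P e := fun e he => by simp [hP'', he]
  have hP2 : ∀ e ∉ Tch G W, P'' e = q1P P (P' e) (u' e) := fun e he => by simp [hP'', he]
  have key : ∀ e ∈ A ∩ G.cut (W ∪ Y),
      (e ∈ Tch G W ∧ e ∈ A ∩ G.cut W ∧ inn G (W ∪ Y) e = inn G W e) ∨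
      (e ∉ Tch G W ∧ e ∈ (A \ Tch G W) ∩ G.cut Y ∧ inn G (W ∪ Y) e = inn G Y e ∧
        ((∃ i, u' e = Sum.inl i ∧ i ∈ I ∧ σ i ∉ W) ∨
          (∃ c, u' e = Sum.inr c ∧ c ∈ A ∩ G.cut W ∧ c ∉ G.cut (W ∪ Y)
            ∧ c ∈ Ins G (W ∪ Y)))) := by
    intro e he
    rcases cut_union_cases he.2 with ⟨h1, h2, h3⟩ | ⟨h1, h2, h3⟩
    · exact Or.inl ⟨h1, ⟨he.1, h2⟩, h3⟩
    · have hm : e ∈ (A \ Tch G W) ∩ G.cut Y := ⟨⟨he.1, h1⟩, h2⟩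
      refine Or.inr ⟨h1, hm, h3, ?_⟩
      have hq := h'.mem e hm
      have hs := h'.start hm
      rcases hue : u' e with i | c
      · rw [hue] at hq; exact Or.inl ⟨i, rfl, inl_mem_QI.1 hq⟩
      · rw [hue] at hq hs
        have hc := inr_mem_QI.1 hq
        simp only [Qs_inr] at hs
        obtain ⟨g1, g2, g3⟩ := inc_eq hc.2
        have : c ∈ Ins G (W ∪ Y) := (ins_iff g1).2 ⟨Or.inl g2, Or.inr hs⟩
        exact Or.inr ⟨c, rfl, hc, ins_not_cut this, this⟩
  refine ⟨u'', P'', ⟨?_, ?_, ?_, ?_, ?_, ?_, ?_⟩, fun e he => ⟨hu1 e he, hP1 e he⟩,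
    fun e he => ⟨hu2 e he, hP2 e he⟩⟩
  · intro e he
    rcases key e he with ⟨h1, h2, h3⟩ | ⟨h1, h2, h3, ⟨i, h4, h5, h6⟩ | ⟨c, h4, h5, h6⟩⟩
    · rw [hu1 e h1]; exact h.mem e h2
    · rw [hu2 e h1, h4]; exact h5
    · rw [hu2 e h1, h4]; exact h.mem c h5
  · intro e he
    rcases key e he with ⟨h1, h2, h3⟩ | ⟨h1, h2, h3, ⟨i, h4, h5, h6⟩ | ⟨c, h4, h5, h6⟩⟩
    · rw [hP1 e h1]; exact h.fin e h2
    · rw [hP2 e h1, h4]; exact h'.fin e h2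
    · rw [hP2 e h1, h4]
      exact ((h.fin c h5).union (Set.finite_singleton _)).union (h'.fin e h2)
  · intro e he
    rcases key e he with ⟨h1, h2, h3⟩ | ⟨h1, h2, h3, ⟨i, h4, h5, h6⟩ | ⟨c, h4, h5, h6⟩⟩
    · rw [hP1 e h1]; exact h.sub e h2
    · rw [hP2 e h1, h4]; exact (h'.sub e h2).trans sdiff_subset
    · rw [hP2 e h1, h4]
      refine union_subset (union_subset (h.sub c h5) ?_) ((h'.sub e h2).trans sdiff_subset)
      simpa using h5.1
  · intro e he
    rcases key e he with ⟨h1, h2, h3⟩ | ⟨h1, h2, h3, ⟨i, h4, h5, h6⟩ | ⟨c, h4, h5, h6, h7⟩⟩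
    · rw [hP1 e h1]; exact (h.ins e h2).trans (ins_mono subset_union_left)
    · rw [hP2 e h1, h4]; exact (h'.ins e h2).trans (ins_mono subset_union_right)
    · rw [hP2 e h1, h4]
      refine union_subset (union_subset ((h.ins c h5).trans (ins_mono subset_union_left)) ?_)
        ((h'.ins e h2).trans (ins_mono subset_union_right))
      simpa using h7
  · intro e he
    rcases key e he with ⟨h1, h2, h3⟩ | ⟨h1, h2, h3, ⟨i, h4, h5, h6⟩ | ⟨c, h4, h5, h6, h7⟩⟩
    · rw [hP1 e h1, hu1 e h1, h3]; exact h.conn e h2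
    · rw [hP2 e h1, hu2 e h1, h3, h4]
      have := h'.conn e h2
      rw [h4] at this
      exact this
    · rw [hP2 e h1, hu2 e h1, h3, h4]
      have := h'.conn e h2
      rw [h4] at this
      have h8 := h.conn c h5
      refine Conn.trans (h8.mono ?_) (Conn.trans (Conn.single (e := c) ?_ (inc_eq h5.2).1)
        (this.mono ?_))
      · intro g hg; exact Or.inl (Or.inl hg)
      · exact Or.inl (Or.inr rfl)
      · intro g hg; exact Or.inr hg
  · intro e he f hf hef
    rcases key e he with ⟨h1, h2, h3⟩ | ⟨h1, h2, h3, ⟨i, h4, h5, h6⟩ | ⟨c, h4, h5, h6, h7⟩⟩ <;>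
    rcases key f hf with ⟨k1, k2, k3⟩ | ⟨k1, k2, k3, ⟨j, k4, k5, k6⟩ | ⟨d, k4, k5, k6, k7⟩⟩
    · rw [hu1 e h1, hu1 f k1] at hef; exact h.inj e h2 f k2 hef
    · rw [hu1 e h1, hu2 f k1, k4] at hef
      have := h.start h2
      rw [hef] at this
      exact absurd this k6
    · rw [hu1 e h1, hu2 f k1, k4] at hef
      have := h.inj e h2 d k5 hef
      rw [← this] at k6
      exact absurd he.2 k6
    · rw [hu2 e h1, hu1 f k1, h4] at hef
      have := h.start k2
      rw [← hef] at this
      exact absurd this h6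
    · rw [hu2 e h1, hu2 f k1, h4, k4] at hef
      refine h'.inj e h2 f k2 ?_
      rw [h4, k4]
      exact congrArg _ hef
    · rw [hu2 e h1, hu2 f k1, h4, k4] at hef
      have := h.start k5
      change i = u d at hef
      rw [← hef] at this
      exact absurd this h6
    · rw [hu2 e h1, hu1 f k1, h4] at hef
      have := h.inj c h5 f k2 hef
      rw [this] at h6
      exact absurd hf.2 h6
    · rw [hu2 e h1, hu2 f k1, h4, k4] at hef
      have := h.start h5
      change u c = j at hef
      rw [hef] at this
      exact absurd this k6
    · rw [hu2 e h1, hu2 f k1, h4, k4] at hef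
      have := h.inj c h5 d k5 hef
      refine h'.inj e h2 f k2 ?_
      rw [h4, k4, this]
  · intro e he f hf g hge hgf
    have nn : ∀ {c}, c ∈ A ∩ G.cut W → ∀ {e}, e ∈ (A \ Tch G W) ∩ G.cut Y → ∀ g,
        g ∈ P c ∪ {c} → g ∉ P' e := by
      rintro c hc e he g (hg | hg) hg'
      · exact (h'.sub e he hg').2 (ins_tch (h.ins c hc hg))
      · rw [hg] at hg'
        exact (h'.sub e he hg').2 (cut_tch hc.2)
    have mm : ∀ {c}, c ∈ A ∩ G.cut W → ∀ {d}, d ∈ A ∩ G.cut W → ∀ g,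
        g ∈ P c ∪ {c} → g ∈ P d ∪ {d} → c = d := by
      rintro c hc d hd g (hg | hg) (hg' | hg')
      · exact h.disj c hc d hd g hg hg'
      · rw [hg'] at hg
        exact absurd hd.2 (ins_not_cut (h.ins c hc hg))
      · rw [hg] at hg'
        exact absurd hc.2 (ins_not_cut (h.ins d hd hg'))
      · rw [← hg, ← hg']
    rcases key e he with ⟨h1, h2, h3⟩ | ⟨h1, h2, h3, ⟨i, h4, h5, h6⟩ | ⟨c, h4, h5, h6, h7⟩⟩ <;>
    rcases key f hf with ⟨k1, k2, k3⟩ | ⟨k1, k2, k3, ⟨j, k4, k5, k6⟩ | ⟨d, k4, k5, k6, k7⟩⟩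
    · rw [hP1 e h1] at hge; rw [hP1 f k1] at hgf
      exact h.disj e h2 f k2 g hge hgf
    · rw [hP1 e h1] at hge; rw [hP2 f k1, k4] at hgf
      exact absurd hgf (nn h2 k2 g (Or.inl hge))
    · rw [hP1 e h1] at hge; rw [hP2 f k1, k4] at hgf
      rcases hgf with hgf | hgf
      · have := mm h2 k5 g (Or.inl hge) hgf
        rw [← this] at k6
        exact absurd he.2 k6
      · exact absurd hgf (nn h2 k2 g (Or.inl hge))
    · rw [hP2 e h1, h4] at hge; rw [hP1 f k1] at hgf
      exact absurd hge (nn k2 h2 g (Or.inl hgf))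
    · rw [hP2 e h1, h4] at hge; rw [hP2 f k1, k4] at hgf
      exact h'.disj e h2 f k2 g hge hgf
    · rw [hP2 e h1, h4] at hge; rw [hP2 f k1, k4] at hgf
      rcases hgf with hgf | hgf
      · exact absurd hge (nn k5 h2 g hgf)
      · exact h'.disj e h2 f k2 g hge hgf
    · rw [hP2 e h1, h4] at hge; rw [hP1 f k1] at hgf
      rcases hge with hge | hge
      · have := mm h5 k2 g hge (Or.inl hgf)
        rw [this] at h6
        exact absurd hf.2 h6
      · exact absurd hge (nn k2 h2 g (Or.inl hgf))
    · rw [hP2 e h1, h4] at hge; rw [hP2 f k1, k4] at hgf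
      rcases hge with hge | hge
      · exact absurd hgf (nn h5 k2 g hge)
      · exact h'.disj e h2 f k2 g hge hgf
    · rw [hP2 e h1, h4] at hge; rw [hP2 f k1, k4] at hgf
      rcases hge with hge | hge
      · rcases hgf with hgf | hgf
        · have := mm h5 k5 g hge hgf
          refine h'.inj e h2 f k2 ?_
          rw [h4, k4, this]
        · exact absurd hgf (nn h5 k2 g hge)
      · rcases hgf with hgf | hgf
        · exact absurd hge (nn k5 h2 g hgf)
        · exact h'.disj e h2 f k2 g hge hgf

lemma cut_diff {W X : Set V} {e : E} (h1 : e ∉ Tch G W) (h2 : e ∈ G.cut (X \ W)) :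
    e ∈ G.cut X ∧ inn G X e = inn G (X \ W) e ∧ inn G (X \ W) e ∉ W := by
  obtain ⟨x, y, hxy, hx, hy⟩ := h2
  rw [tch_iff hxy] at h1
  push Not at h1
  have hy' : y ∉ X := fun h => hy ⟨h, h1.2⟩
  refine ⟨⟨x, y, hxy, hx.1, hy'⟩, ?_, ?_⟩
  · rw [(inn_eq hxy hx.1 hy').1, (inn_eq hxy hx hy).1]
  · rw [(inn_eq hxy hx hy).1]; exact h1.1

/-- Restricting a linking to the quotient. -/
lemma Q2 {X : Set V} {u : E → ι} {P : E → Set E} (h : Lk G σ A I X u P) (W : Set V) :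
    ∃ u' : E → ι ⊕ E, Lk G (Qs G σ W) (A \ Tch G W) (QI G σ A I W) (X \ W) u'
        (fun e => P e \ Tch G W) ∧
      ∀ e ∈ (A \ Tch G W) ∩ G.cut (X \ W), e ∈ A ∩ G.cut X ∧
        ((u' e = Sum.inl (u e) ∧ σ (u e) ∉ W) ∨ ∃ c ∈ P e ∩ G.cut W, u' e = Sum.inr c) := by
  classical
  have hm : ∀ e ∈ (A \ Tch G W) ∩ G.cut (X \ W), e ∈ A ∩ G.cut X ∧
      inn G X e = inn G (X \ W) e ∧ inn G (X \ W) e ∉ W := by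
    intro e he
    have := cut_diff he.1.2 he.2
    exact ⟨⟨he.1.1, this.1⟩, this.2⟩
  have ex : ∀ e, ∃ j : ι ⊕ E, e ∈ (A \ Tch G W) ∩ G.cut (X \ W) →
      Conn G (P e \ Tch G W) (Qs G σ W j) (inn G (X \ W) e) ∧
      ((j = Sum.inl (u e) ∧ σ (u e) ∉ W) ∨ ∃ c ∈ P e ∩ G.cut W, j = Sum.inr c) := by
    intro e
    by_cases he : e ∈ (A \ Tch G W) ∩ G.cut (X \ W)
    · obtain ⟨h1, h2, h3⟩ := hm e he
      have hc := h.conn e h1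
      rw [h2] at hc
      rcases lastexit hc h3 with ⟨ha, hb⟩ | ⟨c, hc1, hc2⟩
      · exact ⟨Sum.inl (u e), fun _ => ⟨hb, Or.inl ⟨rfl, ha⟩⟩⟩
      · exact ⟨Sum.inr c, fun _ => ⟨hc2, Or.inr ⟨c, hc1, rfl⟩⟩⟩
    · exact ⟨Sum.inl (u e), fun h => absurd h he⟩
  choose u' hu' using ex
  refine ⟨u', ⟨?_, ?_, ?_, ?_, ?_, ?_, ?_⟩, fun e he => ⟨(hm e he).1, (hu' e he).2⟩⟩
  · intro e he
    rcases (hu' e he).2 with ⟨h1, h2⟩ | ⟨c, h1, h2⟩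
    · rw [h1]; exact inl_mem_QI.2 ⟨h.mem e (hm e he).1, h2⟩
    · rw [h2]; exact inr_mem_QI.2 ⟨h.sub e (hm e he).1 h1.1, h1.2⟩
  · intro e he
    exact (h.fin e (hm e he).1).subset sdiff_subset
  · intro e he g hg
    exact ⟨h.sub e (hm e he).1 hg.1, hg.2⟩
  · intro e he g hg x hx
    exact ⟨h.ins e (hm e he).1 hg.1 x hx, fun hW => hg.2 ⟨x, hx, hW⟩⟩
  · intro e he
    exact (hu' e he).1
  · intro e he f hf hef
    have he' := (hm e he).1
    have hf' := (hm f hf).1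
    rcases (hu' e he).2 with ⟨h1, h2⟩ | ⟨c, h1, h2⟩ <;>
    rcases (hu' f hf).2 with ⟨k1, k2⟩ | ⟨d, k1, k2⟩
    · rw [h1, k1] at hef
      exact h.inj e he' f hf' (Sum.inl.inj hef)
    · rw [h1, k2] at hef; cases hef
    · rw [h2, k1] at hef; cases hef
    · rw [h2, k2] at hef
      have := Sum.inr.inj hef
      subst this
      exact h.disj e he' f hf' c h1.1 k1.1
  · intro e he f hf g hg hg'
    exact h.disj e (hm e he).1 f (hm f hf).1 g hg.1 hg'.1

lemma Lk.union {W X : Set V} {u u' : E → ι} {P P' : E → Set E}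
    (h : Lk G σ A I W u P) (h' : Lk G σ A I X u' P') :
    ∃ u'' P'', Lk G σ A I (W ∪ X) u'' P'' ∧ (∀ e ∈ Tch G W, u'' e = u e ∧ P'' e = P e) ∧
      ∀ i, σ i ∈ W → (∀ e ∈ A ∩ G.cut W, u e ≠ i) → ∀ e ∈ A ∩ G.cut (W ∪ X), u'' e ≠ i := by
  obtain ⟨v, hv, hspec⟩ := Q2 h' W
  obtain ⟨u'', P'', hL, h1, h2⟩ := Q1 h hv disjoint_sdiff_left
  rw [union_sdiff_self] at hL
  refine ⟨u'', P'', hL, h1, ?_⟩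
  intro i hi hui e he
  rw [← union_sdiff_self] at he
  rcases cut_union_cases he.2 with ⟨k1, k2, k3⟩ | ⟨k1, k2, k3⟩
  · rw [(h1 e k1).1]; exact hui e ⟨he.1, k2⟩
  · rw [(h2 e k1).1]
    have hm : e ∈ (A \ Tch G W) ∩ G.cut (X \ W) := ⟨⟨he.1, k1⟩, k2⟩
    have hq := hv.mem e hm
    rcases hve : v e with j | c
    · rw [hve] at hq
      have := (inl_mem_QI.1 hq).2
      intro hji
      change j = i at hji
      rw [hji] at this
      exact this hi
    · rw [hve] at hq
      exact hui c (inr_mem_QI.1 hq)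

lemma Wave.union {W X : Set V} (h : Wave G σ A I T W) (h' : Wave G σ A I T X) :
    Wave G σ A I T (W ∪ X) := by
  obtain ⟨h1, u, P, h2⟩ := h
  obtain ⟨k1, v, Q, k2⟩ := h'
  obtain ⟨u'', P'', hL, _⟩ := h2.union k2
  exact ⟨disjoint_union_left.2 ⟨h1, k1⟩, u'', P'', hL⟩

lemma HindAt.union {W X : Set V} (h : HindAt G σ A I W) {u' : E → ι} {P' : E → Set E}
    (h' : Lk G σ A I X u' P') : HindAt G σ A I (W ∪ X) := by
  obtain ⟨u, P, i, hL, hi, hiW, hs⟩ := h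
  obtain ⟨u'', P'', hL'', _, h3⟩ := hL.union h'
  exact ⟨u'', P'', i, hL'', hi, Or.inl hiW, h3 i hiW hs⟩

/-- A hindrance of the quotient by a wave gives a hindrance. -/
lemma hind_of_quot {W : Set V} {u : E → ι} {P : E → Set E} (h : Lk G σ A I W u P)
    {Y : Set V} (hY : Disjoint Y W)
    (h' : HindAt G (Qs G σ W) (A \ Tch G W) (QI G σ A I W) Y) : HindAt G σ A I (W ∪ Y) := by
  obtain ⟨v, Q, j, hv, hj, hjY, hs⟩ := h'
  obtain ⟨u'', P'', hL, h1, h2⟩ := Q1 h hv hY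
  have hqI : q1u u j ∈ I := by
    rcases j with i | c
    · exact (inl_mem_QI.1 hj).1
    · exact h.mem c (inr_mem_QI.1 hj)
  refine ⟨u'', P'', q1u u j, hL, hqI, ?_, ?_⟩
  · rcases j with i | c
    · exact Or.inr hjY
    · exact Or.inl (h.start (inr_mem_QI.1 hj))
  · intro e he
    rcases cut_union_cases he.2 with ⟨k1, k2, k3⟩ | ⟨k1, k2, k3⟩
    · rw [(h1 e k1).1]
      rcases j with i | c
      · intro heq
        change u e = i at heq
        have := h.start ⟨he.1, k2⟩
        rw [heq] at this
        exact (inl_mem_QI.1 hj).2 this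
      · intro heq
        change u e = u c at heq
        have hc := (inr_mem_QI.1 hj)
        have := h.inj e ⟨he.1, k2⟩ c hc heq
        subst this
        obtain ⟨g1, g2, g3⟩ := inc_eq k2
        exact ins_not_cut ((ins_iff g1).2 ⟨Or.inl g2, Or.inr hjY⟩) he.2
    · rw [(h2 e k1).1]
      have hm : e ∈ (A \ Tch G W) ∩ G.cut Y := ⟨⟨he.1, k1⟩, k2⟩
      have hne := hs e hm
      have hq := hv.mem e hm
      rcases hve : v e with i | c <;> rw [hve] at hne hq <;> rcases j with j | d
      · intro heq; exact hne (congrArg _ heq)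
      · intro heq
        change i = u d at heq
        have := h.start (inr_mem_QI.1 hj)
        rw [← heq] at this
        exact (inl_mem_QI.1 hq).2 this
      · intro heq
        change u c = j at heq
        have := h.start (inr_mem_QI.1 hq)
        rw [heq] at this
        exact (inl_mem_QI.1 hj).2 this
      · intro heq
        exact hne (congrArg _ (h.inj c (inr_mem_QI.1 hq) d (inr_mem_QI.1 hj) heq))

/-- If the quotient by `W` is unhindered, a hindrance can be cut down to `W`. -/
lemma Q2h {X W : Set V} (h : HindAt G σ A I X)
    (hq : ¬ HindAt G (Qs G σ W) (A \ Tch G W) (QI G σ A I W) (X \ W)) :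
    HindAt G σ A I (X ∩ W) := by
  classical
  obtain ⟨u, P, i, hL, hi, hiX, hs⟩ := h
  obtain ⟨u', hL', hspec⟩ := Q2 hL W
  have used : ∀ j ∈ QI G σ A I W, Qs G σ W j ∈ X \ W →
      ∃ e ∈ (A \ Tch G W) ∩ G.cut (X \ W), u' e = j := by
    intro j hj hjX
    by_contra hcon
    push Not at hcon
    exact hq ⟨u', _, j, hL', hj, hjX, hcon⟩
  -- unused unit lies in W
  have hiW : σ i ∈ W := by
    by_contra hiW
    obtain ⟨e, he, hue⟩ := used (Sum.inl i) (inl_mem_QI.2 ⟨hi, hiW⟩) ⟨hiX, hiW⟩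
    obtain ⟨he', ⟨h1, h2⟩ | ⟨c, h1, h2⟩⟩ := hspec e he
    · rw [h1] at hue
      exact hs e he' (Sum.inl.inj hue)
    · rw [h2] at hue; cases hue
  -- crossings
  have cross : ∀ h ∈ A ∩ G.cut X, ∀ c ∈ P h, c ∈ G.cut W →
      h ∈ (A \ Tch G W) ∩ G.cut (X \ W) ∧ u' h = Sum.inr c := by
    intro h hh c hc hcW
    obtain ⟨g1, g2, g3⟩ := inc_eq hcW
    have hin := (ins_iff g1).1 (hL.ins h hh hc)
    obtain ⟨e, he, hue⟩ := used (Sum.inr c) (inr_mem_QI.2 ⟨hL.sub h hh hc, hcW⟩) ⟨hin.2, g3⟩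
    obtain ⟨he', ⟨h1, h2⟩ | ⟨d, h1, h2⟩⟩ := hspec e he
    · rw [h1] at hue; cases hue
    · rw [h2] at hue
      have : d = c := Sum.inr.inj hue
      subst this
      have := hL.disj e he' h hh d h1.1 hc
      subst this
      exact ⟨he, h2⟩
  -- the linking
  have ex : ∀ e, ∃ g, e ∈ A ∩ G.cut (X ∩ W) → g ∈ A ∩ G.cut X ∧
      Conn G (P g ∩ Ins G W) (σ (u g)) (inn G (X ∩ W) e) ∧
      (g = e ∧ e ∈ Tch G W ∨ g ∉ Tch G W ∧ u' g = Sum.inr e) := by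
    intro e
    by_cases he : e ∈ A ∩ G.cut (X ∩ W)
    swap
    · exact ⟨e, fun h => absurd h he⟩
    obtain ⟨heA, x, y, hxy, hx, hy⟩ := he
    rw [(inn_eq hxy hx hy).1]
    by_cases hyX : y ∈ X
    · have hyW : y ∉ W := fun h => hy ⟨hyX, h⟩
      have heW : e ∈ G.cut W := ⟨x, y, hxy, hx.2, hyW⟩
      obtain ⟨g, hg, hug⟩ := used (Sum.inr e) (inr_mem_QI.2 ⟨heA, heW⟩)
        (by simp only [Qs_inr]; rw [(inn_eq hxy hx.2 hyW).2]; exact ⟨hyX, hyW⟩)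
      have hgX := (hspec g hg).1
      refine ⟨g, fun _ => ⟨hgX, ?_, Or.inr ⟨hg.1.2, hug⟩⟩⟩
      have hgs : σ (u g) ∈ W := by
        by_contra hgs
        obtain ⟨g', hg', hug'⟩ := used (Sum.inl (u g)) (inl_mem_QI.2 ⟨hL.mem g hgX, hgs⟩)
          ⟨hL.start hgX, hgs⟩
        obtain ⟨he', ⟨h1, h2⟩ | ⟨d, h1, h2⟩⟩ := hspec g' hg'
        · rw [h1] at hug'
          have := hL.inj _ he' _ hgX (Sum.inl.inj hug')
          subst this
          rw [h1] at hug; cases hug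
        · rw [h2] at hug'; cases hug'
      have hgo := cut_diff hg.1.2 hg.2
      have hc := hL.conn g hgX
      rw [hgo.2.1] at hc
      obtain ⟨c, hc1, hc2⟩ := firstexit hc hgs hgo.2.2
      have := (cross g hgX c hc1.1 hc1.2).2
      rw [this] at hug
      have : c = e := Sum.inr.inj hug
      subst this
      rwa [(inn_eq hxy hx.2 hyW).1] at hc2
    · have heX : e ∈ A ∩ G.cut X := ⟨heA, x, y, hxy, hx.1, hyX⟩
      have het : e ∈ Tch G W := (tch_iff hxy).2 (Or.inl hx.2)
      refine ⟨e, fun _ => ⟨heX, ?_, Or.inl ⟨rfl, het⟩⟩⟩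
      have hc := hL.conn e heX
      rw [(inn_eq hxy hx.1 hyX).1] at hc
      exact (stay hc hx.2 (fun c hc1 hc2 => (cross e heX c hc1 hc2).1.1.2 het)).2
  choose g hg using ex
  have ginj : ∀ e ∈ A ∩ G.cut (X ∩ W), ∀ f ∈ A ∩ G.cut (X ∩ W), g e = g f → e = f := by
    intro e he f hf hgg
    rcases (hg e he).2.2 with ⟨h1, h2⟩ | ⟨h1, h2⟩ <;>
    rcases (hg f hf).2.2 with ⟨k1, k2⟩ | ⟨k1, k2⟩
    · rw [← h1, ← k1, hgg]
    · rw [← hgg, h1] at k1; exact absurd h2 k1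
    · rw [hgg, k1] at h1; exact absurd k2 h1
    · rw [hgg, k2] at h2; exact (Sum.inr.inj h2).symm
  refine ⟨fun e => u (g e), fun e => P (g e) ∩ Ins G W, i, ⟨?_, ?_, ?_, ?_, ?_, ?_, ?_⟩, hi,
    ⟨hiX, hiW⟩, ?_⟩
  · intro e he; exact hL.mem _ (hg e he).1
  · intro e he; exact (hL.fin _ (hg e he).1).subset inter_subset_left
  · intro e he; exact inter_subset_left.trans (hL.sub _ (hg e he).1)
  · intro e he c hc x hx
    exact ⟨hL.ins _ (hg e he).1 hc.1 x hx, hc.2 x hx⟩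
  · intro e he; exact (hg e he).2.1
  · intro e he f hf hef
    exact ginj e he f hf (hL.inj _ (hg e he).1 _ (hg f hf).1 hef)
  · intro e he f hf c hc hc'
    exact ginj e he f hf (hL.disj _ (hg e he).1 _ (hg f hf).1 c hc.1 hc'.1)
  · intro e he; exact hs _ (hg e he).1

lemma Hind.of_quot {W : Set V} (hW : Wave G σ A I T W)
    (h : Hind G (Qs G σ W) (A \ Tch G W) (QI G σ A I W) (T ∪ W)) : Hind G σ A I T := by
  obtain ⟨hT, u, P, hL⟩ := hW
  obtain ⟨Y, hY, h'⟩ := h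
  rw [disjoint_union_right] at hY
  exact ⟨W ∪ Y, disjoint_union_left.2 ⟨hT, hY.1⟩, hind_of_quot hL hY.2 h'⟩

lemma Hind.restrict {X W : Set V} (hX : Disjoint X T) (h : HindAt G σ A I X)
    (hq : ¬ Hind G (Qs G σ W) (A \ Tch G W) (QI G σ A I W) (T ∪ W)) :
    HindAt G σ A I (X ∩ W) := by
  refine Q2h h (fun h' => hq ⟨X \ W, ?_, h'⟩)
  exact disjoint_union_right.2 ⟨hX.mono_left sdiff_subset, disjoint_sdiff_left⟩

lemma Lk.empty [Nonempty ι] : ∃ u P, Lk G σ A I (∅ : Set V) u P := by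
  have h : ∀ e, e ∉ A ∩ G.cut (∅ : Set V) := by
    rintro e ⟨_, x, y, _, hx, _⟩
    exact hx
  exact ⟨fun _ => Classical.arbitrary ι, fun _ => ∅, fun e he => absurd he (h e),
    fun e he => absurd he (h e), fun e he => absurd he (h e), fun e he => absurd he (h e),
    fun e he => absurd he (h e), fun e he => absurd he (h e), fun e he => absurd he (h e)⟩

end EM



namespace EM
open Set Relation

universe w
variable {V : Type u} {E : Type v} {G : Multigraph V E}
variable {ι : Type w} {σ : ι → V} {A : Set E} {I : Set ι} {T : Set V}

instance {α : Type*} {β : Type*} [Nonempty α] : Nonempty (α ⊕ β) := ⟨Sum.inl (Classical.arbitrary α)⟩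

/-- a bundled linking -/
structure BL (G : Multigraph V E) (σ : ι → V) (A : Set E) (I : Set ι) (T : Set V) where
  X : Set V
  u : E → ι
  P : E → Set E
  dis : Disjoint X T
  lk : Lk G σ A I X u P

/-- extension order on linkings -/
def BL.le (a b : BL G σ A I T) : Prop :=
  a.X ⊆ b.X ∧ ∀ e ∈ A ∩ G.cut a.X, e ∈ G.cut b.X → a.u e = b.u e ∧ a.P e = b.P e

lemma cut_sandwich {X Y Z : Set V} (h : X ⊆ Y) (h' : Y ⊆ Z) {e : E} (h1 : e ∈ G.cut X)
    (h2 : e ∈ G.cut Z) : e ∈ G.cut Y := by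
  obtain ⟨x, y, hxy, hx, hy⟩ := h1
  rw [cut_iff hxy] at h2 ⊢
  have := @h x hx
  have h3 := @h' y
  have h4 := h' this
  tauto

lemma BL.le_trans {a b c : BL G σ A I T} (h : a.le b) (h' : b.le c) : a.le c := by
  refine ⟨h.1.trans h'.1, fun e he hc => ?_⟩
  have hb := cut_sandwich h.1 h'.1 he.2 hc
  have h1 := h.2 e he hb
  have h2 := h'.2 e ⟨he.1, hb⟩ hc
  exact ⟨h1.1.trans h2.1, h1.2.trans h2.2⟩

lemma cut_sub_inn {X Y : Set V} (h : X ⊆ Y) {e : E} (he : e ∈ G.cut Y) (hx : inn G Y e ∈ X) :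
    e ∈ G.cut X ∧ inn G X e = inn G Y e := by
  obtain ⟨h1, h2, h3⟩ := inc_eq he
  have h4 : out G Y e ∉ X := fun h5 => h3 (h h5)
  exact ⟨⟨_, _, h1, hx, h4⟩, (inn_eq h1 hx h4).1⟩

lemma BL.chain_ub [Nonempty ι] (c : Set (BL G σ A I T)) (hc : IsChain BL.le c) :
    ∃ ub : BL G σ A I T, ub.X = (⋃ a ∈ c, a.X) ∧ ∀ a ∈ c, a.le ub := by
  classical
  set X : Set V := ⋃ a ∈ c, a.X with hX
  have hsub : ∀ a ∈ c, a.X ⊆ X := fun a ha => subset_biUnion_of_mem (u := fun a : BL G σ A I T => a.X) ha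
  have ex : ∀ e, ∃ p : ι × Set E, e ∈ A ∩ G.cut X → ∃ a ∈ c, inn G X e ∈ a.X ∧ p = (a.u e, a.P e) := by
    intro e
    by_cases he : e ∈ A ∩ G.cut X
    · have := (inc_eq he.2).2.1
      rw [hX] at this
      simp only [mem_iUnion] at this
      obtain ⟨a, ha, hm⟩ := this
      exact ⟨(a.u e, a.P e), fun _ => ⟨a, ha, hm, rfl⟩⟩
    · exact ⟨(Classical.arbitrary ι, ∅), fun h => absurd h he⟩
  choose p hp using ex
  have key : ∀ e ∈ A ∩ G.cut X, ∃ a ∈ c, e ∈ G.cut a.X ∧ inn G a.X e = inn G X e ∧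
      ∀ b ∈ c, (a.X ⊆ b.X) → (e ∈ G.cut b.X ∧ inn G b.X e = inn G X e ∧ p e = (b.u e, b.P e)) := by
    intro e he
    obtain ⟨a, ha, hm, hpe⟩ := hp e he
    have h1 := cut_sub_inn (hsub a ha) he.2 hm
    refine ⟨a, ha, h1.1, h1.2, ?_⟩
    intro b hb hab
    have h2 := cut_sub_inn (hsub b hb) he.2 (hab hm)
    refine ⟨h2.1, h2.2, ?_⟩
    rw [hpe]
    by_cases heq : a = b
    · subst heq; rfl
    rcases hc ha hb heq with h | h
    · have := h.2 e ⟨he.1, h1.1⟩ h2.1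
      rw [this.1, this.2]
    · have := h.2 e ⟨he.1, h2.1⟩ h1.1
      rw [this.1, this.2]
  have key1 : ∀ e ∈ A ∩ G.cut X, ∃ b ∈ c,
      (e ∈ A ∩ G.cut b.X ∧ inn G b.X e = inn G X e ∧ p e = (b.u e, b.P e)) := by
    intro e he
    obtain ⟨a, ha, _, _, h⟩ := key e he
    obtain ⟨h1, h2, h3⟩ := h a ha subset_rfl
    exact ⟨a, ha, ⟨he.1, h1⟩, h2, h3⟩
  have key2 : ∀ e ∈ A ∩ G.cut X, ∀ f ∈ A ∩ G.cut X, ∃ b ∈ c,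
      (e ∈ A ∩ G.cut b.X ∧ p e = (b.u e, b.P e)) ∧
      (f ∈ A ∩ G.cut b.X ∧ p f = (b.u f, b.P f)) := by
    intro e he f hf
    obtain ⟨a, ha, _, _, h⟩ := key e he
    obtain ⟨b, hb, _, _, h'⟩ := key f hf
    have : a.X ⊆ b.X ∨ b.X ⊆ a.X := by
      by_cases heq : a = b
      · subst heq; exact Or.inl subset_rfl
      rcases hc ha hb heq with h | h
      · exact Or.inl h.1
      · exact Or.inr h.1
    rcases this with hs | hs
    · obtain ⟨h1, h2, h3⟩ := h b hb hs
      obtain ⟨k1, k2, k3⟩ := h' b hb subset_rfl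
      exact ⟨b, hb, ⟨⟨he.1, h1⟩, h3⟩, ⟨⟨hf.1, k1⟩, k3⟩⟩
    · obtain ⟨h1, h2, h3⟩ := h a ha subset_rfl
      obtain ⟨k1, k2, k3⟩ := h' a ha hs
      exact ⟨a, ha, ⟨⟨he.1, h1⟩, h3⟩, ⟨⟨hf.1, k1⟩, k3⟩⟩
  refine ⟨⟨X, fun e => (p e).1, fun e => (p e).2, ?_, ⟨?_, ?_, ?_, ?_, ?_, ?_, ?_⟩⟩, rfl, ?_⟩
  · rw [hX]
    simp only [disjoint_iUnion_left]
    exact fun a _ => a.dis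
  · intro e he
    obtain ⟨b, hb, h1, h2, h3⟩ := key1 e he
    simp only [h3]; exact b.lk.mem e h1
  · intro e he
    obtain ⟨b, hb, h1, h2, h3⟩ := key1 e he
    simp only [h3]; exact b.lk.fin e h1
  · intro e he
    obtain ⟨b, hb, h1, h2, h3⟩ := key1 e he
    simp only [h3]; exact b.lk.sub e h1
  · intro e he
    obtain ⟨b, hb, h1, h2, h3⟩ := key1 e he
    simp only [h3]; exact (b.lk.ins e h1).trans (ins_mono (hsub b hb))
  · intro e he
    obtain ⟨b, hb, h1, h2, h3⟩ := key1 e he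
    simp only [h3]; rw [← h2]; exact b.lk.conn e h1
  · intro e he f hf
    obtain ⟨b, hb, ⟨h1, h2⟩, h3, h4⟩ := key2 e he f hf
    simp only [h2, h4]; exact b.lk.inj e h1 f h3
  · intro e he f hf
    obtain ⟨b, hb, ⟨h1, h2⟩, h3, h4⟩ := key2 e he f hf
    simp only [h2, h4]; exact b.lk.disj e h1 f h3
  · intro a ha
    refine ⟨hsub a ha, ?_⟩
    intro e he heX
    change e ∈ G.cut X at heX
    obtain ⟨b, hb, h1, h2, h3⟩ := key1 e ⟨he.1, heX⟩
    simp only [h3]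
    by_cases heq : a = b
    · subst heq; exact ⟨rfl, rfl⟩
    rcases hc ha hb heq with h | h
    · exact h.2 e he h1.2
    · have := h.2 e h1 he.2
      exact ⟨this.1.symm, this.2.symm⟩

/-- `W` is the greatest wave. -/
def Greatest (G : Multigraph V E) (σ : ι → V) (A : Set E) (I : Set ι) (T : Set V) (W : Set V) :
    Prop := Wave G σ A I T W ∧ ∀ X, Wave G σ A I T X → X ⊆ W

lemma exists_greatest [Nonempty ι] (G : Multigraph V E) (σ : ι → V) (A : Set E) (I : Set ι)
    (T : Set V) : ∃ W, Greatest G σ A I T W := by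
  obtain ⟨m, hm⟩ := exists_maximal_of_chains_bounded (r := BL.le (G := G) (σ := σ) (A := A) (I := I) (T := T))
    (fun c hc => (BL.chain_ub c hc).imp fun _ h => h.2) (fun h h' => BL.le_trans h h')
  refine ⟨m.X, ⟨m.dis, m.u, m.P, m.lk⟩, ?_⟩
  rintro X ⟨hX, u, P, hL⟩
  obtain ⟨u'', P'', hL', h1, _⟩ := m.lk.union hL
  have := hm ⟨m.X ∪ X, u'', P'', disjoint_union_left.2 ⟨m.dis, hX⟩, hL'⟩
    ⟨subset_union_left, fun e he _ => ⟨(h1 e (cut_tch he.2)).1.symm, (h1 e (cut_tch he.2)).2.symm⟩⟩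
  exact subset_union_right.trans this.1

lemma Wave.iUnion [Nonempty ι] {α : Type*} {X : α → Set V} (h : ∀ a, Wave G σ A I T (X a)) :
    Wave G σ A I T (⋃ a, X a) := by
  obtain ⟨W, ⟨h1, u, P, hL⟩, h2⟩ := exists_greatest G σ A I (⋃ a, X a)ᶜ
  have hW : W ⊆ ⋃ a, X a := by
    rwa [disjoint_compl_right_iff_subset] at h1
  have : W = ⋃ a, X a := by
    refine hW.antisymm (iUnion_subset fun a => h2 _ ⟨?_, (h a).2⟩)
    rw [disjoint_compl_right_iff_subset]
    exact subset_iUnion X a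
  rw [← this]
  refine ⟨?_, u, P, hL⟩
  rw [this, disjoint_iUnion_left]
  exact fun a => (h a).1

lemma Greatest.quot {W : Set V} (h : Greatest G σ A I T W) :
    WaveFree G (Qs G σ W) (A \ Tch G W) (QI G σ A I W) (T ∪ W) := by
  rintro Y ⟨hY, v, Q, hL⟩
  rw [disjoint_union_right] at hY
  obtain ⟨⟨hT, u, P, hu⟩, hg⟩ := h
  obtain ⟨u'', P'', hL', _⟩ := Q1 hu hL hY.2
  have := hg (W ∪ Y) ⟨disjoint_union_left.2 ⟨hT, hY.1⟩, u'', P'', hL'⟩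
  have h2 : Y ⊆ W := subset_union_right.trans this
  exact disjoint_self.1 (hY.2.mono_right h2)

end EM



namespace EM
open Set Relation

universe w
variable {V : Type u} {E : Type v} {G : Multigraph V E}
variable {ι : Type w} {σ : ι → V} {A : Set E} {I : Set ι} {T : Set V}

/-- dart walks -/
def DW (G : Multigraph V E) : V → List (E × V × V) → V → Prop
  | a, [], b => a = b
  | a, d :: l, b => G.inc d.1 = s(d.2.1, d.2.2) ∧ d.2.1 = a ∧ DW G d.2.2 l b

lemma DW_append {a b : V} {l l' : List (E × V × V)} :
    DW G a (l ++ l') b ↔ ∃ c, DW G a l c ∧ DW G c l' b := by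
  induction l generalizing a with
  | nil => simp [DW]
  | cons d l ih =>
    simp only [List.cons_append, DW, ih]
    constructor
    · rintro ⟨h1, h2, c, h3, h4⟩; exact ⟨c, ⟨h1, h2, h3⟩, h4⟩
    · rintro ⟨c, ⟨h1, h2, h3⟩, h4⟩; exact ⟨h1, h2, c, h3, h4⟩

lemma DW_split {a b : V} {l l' : List (E × V × V)} {d : E × V × V} (h : DW G a (l ++ d :: l') b) :
    DW G a l d.2.1 ∧ DW G d.2.2 l' b ∧ G.inc d.1 = s(d.2.1, d.2.2) := by
  obtain ⟨c, h1, h2, h3, h4⟩ := DW_append.1 h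
  subst h3
  exact ⟨h1, h4, h2⟩

lemma DW_inc {a b : V} {l : List (E × V × V)} (h : DW G a l b) {d : E × V × V} (hd : d ∈ l) :
    G.inc d.1 = s(d.2.1, d.2.2) := by
  obtain ⟨l1, l2, rfl⟩ := List.append_of_mem hd
  exact (DW_split h).2.2

/-- the edges of a dart list -/
def eds (l : List (E × V × V)) : Set E := {e | ∃ d ∈ l, d.1 = e}

lemma eds_finite (l : List (E × V × V)) : (eds l).Finite := by
  have : eds l = Prod.fst '' {d | d ∈ l} := by
    ext e; simp [eds]
  rw [this]
  exact (List.finite_toSet l).image _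

lemma DW.conn {a b : V} {l : List (E × V × V)} (h : DW G a l b) : Conn G (eds l) a b := by
  induction l generalizing a with
  | nil => simp only [DW] at h; subst h; exact Conn.refl _
  | cons d l ih =>
    obtain ⟨h1, rfl, h3⟩ := h
    refine (Conn.single (F := eds (d :: l)) (e := d.1) ⟨d, by simp, rfl⟩ h1).trans ((ih h3).mono ?_)
    rintro e ⟨d', hd', rfl⟩
    exact ⟨d', by simp [hd'], rfl⟩

lemma exists_DW {S : Set (E × V × V)} {a b : V}
    (h : ReflTransGen (fun a b => ∃ e, (e, a, b) ∈ S ∧ G.inc e = s(a, b)) a b) :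
    ∃ l, DW G a l b ∧ (∀ d ∈ l, d ∈ S) ∧ (l.map Prod.fst).Nodup := by
  classical
  induction h using ReflTransGen.head_induction_on with
  | refl => exact ⟨[], rfl, by simp, by simp⟩
  | @head a c h1 h2 ih =>
    obtain ⟨e, he, hinc⟩ := h1
    obtain ⟨l, hl, hS, hn⟩ := ih
    by_cases hs : ∃ l1 l2, l = l1 ++ l2 ∧ DW G a l2 b
    · obtain ⟨l1, l2, rfl, h3⟩ := hs
      refine ⟨l2, h3, fun d hd => hS d (by simp [hd]), ?_⟩
      rw [List.map_append] at hn
      exact hn.of_append_right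
    · refine ⟨(e, a, c) :: l, ⟨hinc, rfl, hl⟩, ?_, ?_⟩
      · intro d hd
        rcases List.mem_cons.1 hd with rfl | hd
        · exact he
        · exact hS d hd
      · rw [List.map_cons, List.nodup_cons]
        refine ⟨?_, hn⟩
        intro hm
        obtain ⟨d, hd, hde⟩ := List.mem_map.1 hm
        obtain ⟨l1, l2, rfl⟩ := List.append_of_mem hd
        have h4 := DW_split hl
        have h5 := h4.2.2
        rw [hde] at h5
        change G.inc e = _ at h5
        rw [hinc] at h5
        apply hs
        have : a = d.2.1 ∨ a = d.2.2 := by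
          rcases Sym2.eq_iff.1 h5 with h | h
          · exact Or.inl h.1
          · exact Or.inr h.1
        rcases this with h6 | h6
        · exact ⟨l1, d :: l2, rfl, h4.2.2, h6.symm, h4.2.1⟩
        · exact ⟨l1 ++ [d], l2, by simp, by rw [h6]; exact h4.2.1⟩

lemma Conn.exists_DW {F : Set E} {a b : V} (h : Conn G F a b) :
    ∃ l, DW G a l b ∧ (∀ d ∈ l, d.1 ∈ F) ∧ (l.map Prod.fst).Nodup := by
  have : ReflTransGen (fun a b => ∃ e, (e, a, b) ∈ {d : E × V × V | d.1 ∈ F} ∧ G.inc e = s(a, b)) a b :=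
    h
  exact EM.exists_DW this

/-- linking by dart walks -/
structure DLk {ι : Type w} (G : Multigraph V E) (σ : ι → V) (A : Set E) (I : Set ι) (X : Set V)
    (u : E → ι) (p : E → List (E × V × V)) : Prop where
  mem : ∀ e ∈ A ∩ G.cut X, u e ∈ I
  sub : ∀ e ∈ A ∩ G.cut X, ∀ d ∈ p e, d.1 ∈ A ∧ d.1 ∈ Ins G X
  dw : ∀ e ∈ A ∩ G.cut X, DW G (σ (u e)) (p e) (inn G X e)
  nd : ∀ e ∈ A ∩ G.cut X, ((p e).map Prod.fst).Nodup
  inj : ∀ e ∈ A ∩ G.cut X, ∀ f ∈ A ∩ G.cut X, u e = u f → e = f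
  disj : ∀ e ∈ A ∩ G.cut X, ∀ f ∈ A ∩ G.cut X, ∀ d ∈ p e, ∀ d' ∈ p f, d.1 = d'.1 → e = f

lemma DLk.toLk {X : Set V} {u : E → ι} {p : E → List (E × V × V)} (h : DLk G σ A I X u p) :
    Lk G σ A I X u (fun e => eds (p e)) where
  mem := h.mem
  fin e _ := eds_finite _
  sub e he := by rintro _ ⟨d, hd, rfl⟩; exact (h.sub e he d hd).1
  ins e he := by rintro _ ⟨d, hd, rfl⟩; exact (h.sub e he d hd).2
  conn e he := (h.dw e he).conn
  inj := h.inj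
  disj e he f hf := by
    rintro _ ⟨d, hd, rfl⟩ ⟨d', hd', h'⟩
    exact h.disj e he f hf d hd d' hd' h'.symm

lemma Lk.toDLk {X : Set V} {u : E → ι} {P : E → Set E} (h : Lk G σ A I X u P) :
    ∃ p, DLk G σ A I X u p ∧ ∀ e ∈ A ∩ G.cut X, ∀ d ∈ p e, d.1 ∈ P e := by
  classical
  have ex : ∀ e, ∃ l, e ∈ A ∩ G.cut X → DW G (σ (u e)) l (inn G X e) ∧ (∀ d ∈ l, d.1 ∈ P e) ∧
      (l.map Prod.fst).Nodup := by
    intro e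
    by_cases he : e ∈ A ∩ G.cut X
    · obtain ⟨l, hl⟩ := (h.conn e he).exists_DW
      exact ⟨l, fun _ => hl⟩
    · exact ⟨[], fun h => absurd h he⟩
  choose p hp using ex
  refine ⟨p, ⟨h.mem, ?_, fun e he => (hp e he).1, fun e he => (hp e he).2.2, h.inj, ?_⟩,
    fun e he => (hp e he).2.1⟩
  · intro e he d hd
    have := (hp e he).2.1 d hd
    exact ⟨h.sub e he this, h.ins e he this⟩
  · intro e he f hf d hd d' hd' hdd
    refine h.disj e he f hf d.1 ((hp e he).2.1 d hd) ?_
    rw [hdd]; exact (hp f hf).2.1 d' hd'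

def Res (G : Multigraph V E) (A : Set E) (X : Set V) (p : E → List (E × V × V)) : Set (E × V × V) :=
  {d | d.1 ∈ A ∧ d.1 ∈ Ins G X ∧ ∀ f ∈ A ∩ G.cut X, d ∉ p f}

/-- residual reachability -/
def ResR (G : Multigraph V E) (A : Set E) (X : Set V) (p : E → List (E × V × V)) : V → V → Prop :=
  ReflTransGen (fun a b => ∃ e, (e, a, b) ∈ Res G A X p ∧ G.inc e = s(a, b))

variable (G σ A I) in
/-- `X` is linked together with an extra path to `v`. -/
def SWat (X : Set V) (v : V) : Prop := ∃ u P j Q, Lk G σ A I X u P ∧ j ∈ I ∧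
  (∀ e ∈ A ∩ G.cut X, u e ≠ j) ∧ Q.Finite ∧ Q ⊆ A ∧ Q ⊆ Ins G X ∧
  (∀ e ∈ A ∩ G.cut X, ∀ g, g ∈ P e → g ∉ Q) ∧ Conn G Q (σ j) v

/-- augmentation along a residual walk -/
lemma augment {X : Set V} {v : V} (l : List (E × V × V)) :
    ∀ (u : E → ι) (p : E → List (E × V × V)) (j : ι) (Q : List (E × V × V)) (q : V),
    DLk G σ A I X u p → j ∈ I → (∀ e ∈ A ∩ G.cut X, u e ≠ j) →
    DW G (σ j) Q q → (Q.map Prod.fst).Nodup → (∀ d ∈ Q, d.1 ∈ A ∧ d.1 ∈ Ins G X) →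
    (∀ e ∈ A ∩ G.cut X, ∀ d ∈ p e, ∀ d' ∈ Q, d.1 ≠ d'.1) →
    DW G q l v → (l.map Prod.fst).Nodup → (∀ d ∈ l, d ∈ Res G A X p) → (∀ d ∈ l, d ∉ Q) →
    SWat G σ A I X v := by
  classical
  induction l with
  | nil =>
    intro u p j Q q h hj hju hQ hQn hQs hQd hl _ _ _
    simp only [DW] at hl
    subst hl
    refine ⟨u, _, j, eds Q, h.toLk, hj, hju, eds_finite _, ?_, ?_, ?_, hQ.conn⟩
    · rintro _ ⟨d, hd, rfl⟩; exact (hQs d hd).1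
    · rintro _ ⟨d, hd, rfl⟩; exact (hQs d hd).2
    · rintro e he _ ⟨d, hd, rfl⟩ ⟨d', hd', h'⟩
      exact hQd e he d hd d' hd' h'.symm
  | cons d l ih =>
    intro u p j Q q h hj hju hQ hQn hQs hQd hl hln hlr hlQ
    obtain ⟨hinc, hdq, hl⟩ := hl
    have hdr := hlr d (by simp)
    have hdQ := hlQ d (by simp)
    rw [List.map_cons, List.nodup_cons] at hln
    have swap : ∀ d' : E × V × V, d'.1 = d.1 → G.inc d'.1 = s(d'.2.1, d'.2.2) → d' ≠ d →
        d'.2.1 = d.2.2 ∧ d'.2.2 = d.2.1 := by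
      rintro ⟨e', x', y'⟩ h1 h2 h3
      obtain ⟨e, x, y⟩ := d
      simp only at h1 h2 hinc ⊢
      subst h1
      rw [h2] at hinc
      rcases Sym2.eq_iff.1 hinc with ⟨rfl, rfl⟩ | h
      · exact absurd rfl h3
      · exact h
    by_cases hA : ∃ d' ∈ Q, d'.1 = d.1
    · obtain ⟨d', hd', hde⟩ := hA
      have hs := swap d' hde (DW_inc hQ hd') (fun h => hdQ (h ▸ hd'))
      obtain ⟨Q1, Q2, rfl⟩ := List.append_of_mem hd'
      have h1 := (DW_split hQ).1
      rw [hs.1] at h1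
      refine ih u p j Q1 d.2.2 h hj hju h1 ?_ (fun x hx => hQs x (by simp [hx])) ?_ hl hln.2
        (fun x hx => hlr x (by simp [hx])) (fun x hx hx' => hlQ x (by simp [hx]) (by simp [hx']))
      · rw [List.map_append] at hQn; exact hQn.of_append_left
      · exact fun e he x hx x' hx' => hQd e he x hx x' (by simp [hx'])
    by_cases hB : ∃ f ∈ A ∩ G.cut X, ∃ d' ∈ p f, d'.1 = d.1
    · obtain ⟨f, hf, d', hd', hde⟩ := hB
      have hs := swap d' hde (DW_inc (h.dw f hf) hd') (fun h => hdr.2.2 f hf (h ▸ hd'))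
      obtain ⟨l1, l2, hl12⟩ := List.append_of_mem hd'
      have hdw := h.dw f hf
      rw [hl12] at hdw
      have h1 := DW_split hdw
      rw [hs.1, hs.2, hdq] at h1
      have hnd := h.nd f hf
      rw [hl12, List.map_append, List.map_cons] at hnd
      have hl1 : ∀ x ∈ l1, x ∈ p f := fun x hx => by rw [hl12]; simp [hx]
      have hl2 : ∀ x ∈ l2, x ∈ p f := fun x hx => by rw [hl12]; simp [hx]
      have hupd : ∀ e, e ≠ f → Function.update u f j e = u e ∧
          Function.update p f (Q ++ l2) e = p e := fun e he => by simp [he]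
      have hl12d : ∀ x ∈ l1, ∀ x' ∈ l2, x.1 ≠ x'.1 := by
        intro x hx x' hx' hxx
        have := (List.nodup_append.1 hnd).2.2 x.1 (List.mem_map_of_mem hx) x'.1
          (List.mem_cons_of_mem _ (List.mem_map_of_mem hx'))
        exact this hxx
      refine ih (Function.update u f j) (Function.update p f (Q ++ l2)) (u f) l1 d.2.2
        ⟨?_, ?_, ?_, ?_, ?_, ?_⟩ (h.mem f hf) ?_ h1.1 ?_ ?_ ?_ hl hln.2 ?_ ?_
      · intro e he
        by_cases hef : e = f
        · subst hef; simpa using hj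
        · rw [(hupd e hef).1]; exact h.mem e he
      · intro e he
        by_cases hef : e = f
        · subst hef
          simp only [Function.update_self, List.mem_append]
          rintro x (hx | hx)
          · exact hQs x hx
          · exact h.sub e he x (hl2 x hx)
        · rw [(hupd e hef).2]; exact h.sub e he
      · intro e he
        by_cases hef : e = f
        · subst hef
          simp only [Function.update_self]
          exact DW_append.2 ⟨q, hQ, h1.2.1⟩
        · rw [(hupd e hef).2, (hupd e hef).1]; exact h.dw e he
      · intro e he
        by_cases hef : e = f
        · subst hef
          simp only [Function.update_self, List.map_append]
          rw [List.nodup_append]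
          refine ⟨hQn, (List.nodup_cons.1 hnd.of_append_right).2, ?_⟩
          intro a ha b hb
          obtain ⟨x, hx, rfl⟩ := List.mem_map.1 ha
          obtain ⟨y, hy, rfl⟩ := List.mem_map.1 hb
          exact (hQd e he y (hl2 y hy) x hx).symm
        · rw [(hupd e hef).2]; exact h.nd e he
      · intro e he e' he' hee
        by_cases hef : e = f <;> by_cases hef' : e' = f
        · rw [hef, hef']
        · rw [(hupd e' hef').1, hef, Function.update_self] at hee
          exact absurd hee.symm (hju e' he')
        · rw [(hupd e hef).1, hef', Function.update_self] at hee
          exact absurd hee (hju e he)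
        · rw [(hupd e hef).1, (hupd e' hef').1] at hee
          exact h.inj e he e' he' hee
      · intro e he e' he' x hx x' hx' hxx
        by_cases hef : e = f <;> by_cases hef' : e' = f
        · rw [hef, hef']
        · rw [(hupd e' hef').2] at hx'
          rw [hef, Function.update_self] at hx
          rcases List.mem_append.1 hx with hx | hx
          · exact absurd hxx.symm (hQd e' he' x' hx' x hx)
          · rw [hef]; exact h.disj f hf e' he' x (hl2 x hx) x' hx' hxx
        · rw [(hupd e hef).2] at hx
          rw [hef', Function.update_self] at hx'
          rcases List.mem_append.1 hx' with hx' | hx'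
          · exact absurd hxx (hQd e he x hx x' hx')
          · rw [hef']; exact h.disj e he f hf x hx x' (hl2 x' hx') hxx
        · rw [(hupd e hef).2] at hx
          rw [(hupd e' hef').2] at hx'
          exact h.disj e he e' he' x hx x' hx' hxx
      · intro e he
        by_cases hef : e = f
        · rw [hef, Function.update_self]; exact (hju f hf).symm
        · rw [(hupd e hef).1]
          exact fun hh => hef (h.inj e he f hf hh)
      · exact hnd.of_append_left
      · exact fun x hx => h.sub f hf x (hl1 x hx)
      · intro e he x hx x' hx' hxx
        by_cases hef : e = f
        · rw [hef, Function.update_self] at hx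
          rcases List.mem_append.1 hx with hx | hx
          · exact hQd f hf x' (hl1 x' hx') x hx hxx.symm
          · exact hl12d x' hx' x hx hxx.symm
        · rw [(hupd e hef).2] at hx
          exact hef (h.disj e he f hf x hx x' (hl1 x' hx') hxx)
      · intro x hx
        have := hlr x (by simp [hx])
        refine ⟨this.1, this.2.1, ?_⟩
        intro e he hxe
        by_cases hef : e = f
        · rw [hef, Function.update_self] at hxe
          rcases List.mem_append.1 hxe with hxe | hxe
          · exact hlQ x (by simp [hx]) hxe
          · exact this.2.2 f hf (hl2 x hxe)
        · rw [(hupd e hef).2] at hxe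
          exact this.2.2 e he hxe
      · intro x hx hx'
        exact (hlr x (by simp [hx])).2.2 f hf (hl1 x hx')
    · push Not at hA hB
      refine ih u p j (Q ++ [d]) d.2.2 h hj hju ?_ ?_ ?_ ?_ hl hln.2
        (fun x hx => hlr x (by simp [hx])) ?_
      · exact DW_append.2 ⟨q, hQ, hinc, hdq, rfl⟩
      · rw [List.map_append, List.nodup_append]
        refine ⟨hQn, by simp, ?_⟩
        intro a ha b hb
        obtain ⟨x, hx, rfl⟩ := List.mem_map.1 ha
        simp only [List.map_cons, List.map_nil, List.mem_singleton] at hb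
        rw [hb]; exact hA x hx
      · intro x hx
        rcases List.mem_append.1 hx with hx | hx
        · exact hQs x hx
        · rw [List.mem_singleton] at hx; rw [hx]; exact ⟨hdr.1, hdr.2.1⟩
      · intro e he x hx x' hx'
        rcases List.mem_append.1 hx' with hx' | hx'
        · exact hQd e he x hx x' hx'
        · rw [List.mem_singleton] at hx'; rw [hx']; exact hB e he x hx
      · intro x hx hx'
        rcases List.mem_append.1 hx' with hx' | hx'
        · exact hlQ x (by simp [hx]) hx'
        · rw [List.mem_singleton] at hx'
          subst hx'
          exact hln.1 (List.mem_map_of_mem hx)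

end EM



namespace EM
open Set Relation

universe w
variable {V : Type u} {E : Type v} {G : Multigraph V E}
variable {ι : Type w} {σ : ι → V} {A : Set E} {I : Set ι} {T : Set V}

lemma DW_back {R : Set V} {a b : V} {l : List (E × V × V)} (h : DW G a l b) (hb : b ∈ R)
    (hl : ∀ d ∈ l, d.2.2 ∈ R → d.2.1 ∈ R) :
    a ∈ R ∧ ∀ d ∈ l, d.2.1 ∈ R ∧ d.2.2 ∈ R := by
  induction l generalizing a with
  | nil => simp only [DW] at h; subst h; exact ⟨hb, by simp⟩
  | cons d l ih =>
    obtain ⟨h1, h2, h3⟩ := h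
    have := ih h3 (fun x hx => hl x (by simp [hx]))
    have hd := hl d (by simp) this.1
    refine ⟨h2 ▸ hd, ?_⟩
    intro x hx
    rcases List.mem_cons.1 hx with rfl | hx
    · exact ⟨hd, this.1⟩
    · exact this.2 x hx

lemma first_bad {α : Type*} (q : α → Prop) {l l1 l2 l1' l2' : List α} {d d' : α}
    (h : l = l1 ++ d :: l2) (h' : l = l1' ++ d' :: l2') (h1 : ∀ x ∈ l1, q x) (h1' : ∀ x ∈ l1', q x)
    (hd : ¬ q d) (hd' : ¬ q d') : d = d' := by
  classical
  subst h
  induction l1 generalizing l1' with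
  | nil =>
    cases l1' with
    | nil => simp at h'; exact h'.1
    | cons a l1' =>
      simp at h'
      exact absurd (h1' a (by simp)) (h'.1 ▸ hd)
  | cons a l1 ih =>
    cases l1' with
    | nil => simp at h'; exact absurd (h1 a (by simp)) (h'.1 ▸ hd')
    | cons b l1' =>
      simp at h'
      exact ih (fun x hx => h1 x (by simp [hx])) (fun x hx => h1' x (by simp [hx])) h'.2

lemma restrictR {X : Set V} {u : E → ι} {p : E → List (E × V × V)} (h : DLk G σ A I X u p)
    (N : Set ι) (hN : ∀ i ∈ N, σ i ∈ X) :
    ∃ R ⊆ X, (∀ i ∈ N, σ i ∈ R) ∧ ∃ u' p', DLk G σ A (u '' (A ∩ G.cut X)) R u' p' ∧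
      ∀ v ∈ R, ∃ i ∈ N, ResR G A R p' (σ i) v := by
  classical
  set R : Set V := {v | ∃ i ∈ N, ResR G A X p (σ i) v} with hR
  have hRX : R ⊆ X := by
    rintro v ⟨i, hi, hr⟩
    induction hr with
    | refl => exact hN i hi
    | tail _ h2 ih =>
      obtain ⟨e, he, hinc⟩ := h2
      exact ((ins_iff hinc).1 he.2.1).2
  have hstep : ∀ e a b, a ∈ R → (e, a, b) ∈ Res G A X p → G.inc e = s(a, b) → b ∈ R := by
    rintro e a b ⟨i, hi, hr⟩ h1 h2
    exact ⟨i, hi, hr.tail ⟨e, h1, h2⟩⟩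
  -- no inward darts
  have hback : ∀ f ∈ A ∩ G.cut X, ∀ d ∈ p f, d.2.2 ∈ R → d.2.1 ∈ R := by
    rintro f hf ⟨e, x, y⟩ hd hy
    simp only at hy ⊢
    have hinc := DW_inc (h.dw f hf) hd
    simp only at hinc
    by_cases hxy : x = y
    · rwa [hxy]
    refine hstep e y x hy ⟨(h.sub f hf _ hd).1, (h.sub f hf _ hd).2, ?_⟩ (by rw [hinc, Sym2.eq_swap])
    intro f' hf' hd'
    have := h.disj f hf f' hf' _ hd _ hd' rfl
    subst this
    have := List.inj_on_of_nodup_map (h.nd f hf) hd hd' rfl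
    simp only [Prod.mk.injEq, true_and] at this
    exact hxy this.1
  have ex : ∀ g, ∃ (f : E) (l : List (E × V × V)), g ∈ A ∩ G.cut R → f ∈ A ∩ G.cut X ∧
      DW G (σ (u f)) l (inn G R g) ∧ (∀ d ∈ l, d ∈ p f ∧ d.1 ∈ Ins G R ∧ d.2.2 ∈ R) ∧
      (l.map Prod.fst).Nodup ∧
      ((g = f ∧ ∀ d ∈ p f, d.2.2 ∈ R) ∨ ∃ w l2, w ∉ R ∧ p f = l ++ (g, inn G R g, w) :: l2) := by
    intro g
    by_cases hg : g ∈ A ∩ G.cut R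
    swap
    · exact ⟨g, [], fun h => absurd h hg⟩
    obtain ⟨hgA, v, w, hinc, hv, hw⟩ := hg
    rw [(inn_eq hinc hv hw).1]
    by_cases hwX : w ∈ X
    · have hgI : g ∈ Ins G X := (ins_iff hinc).2 ⟨hRX hv, hwX⟩
      have : ∃ f ∈ A ∩ G.cut X, (g, v, w) ∈ p f := by
        by_contra hcon
        push Not at hcon
        exact hw (hstep g v w hv ⟨hgA, hgI, hcon⟩ hinc)
      obtain ⟨f, hf, hd⟩ := this
      obtain ⟨l1, l2, hl⟩ := List.append_of_mem hd
      have hl1 : ∀ x ∈ l1, x ∈ p f := fun x hx => by rw [hl]; simp [hx]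
      have hdw := h.dw f hf
      rw [hl] at hdw
      have h1 := (DW_split hdw).1
      simp only at h1
      have h2 := DW_back h1 hv (fun d hd => hback f hf d (hl1 d hd))
      refine ⟨f, l1, fun _ => ⟨hf, h1, ?_, ?_, Or.inr ⟨w, l2, hw, hl⟩⟩⟩
      · intro d hd
        exact ⟨hl1 d hd, (ins_iff (DW_inc h1 hd)).2 (h2.2 d hd), (h2.2 d hd).2⟩
      · have := h.nd f hf
        rw [hl, List.map_append] at this
        exact this.of_append_left
    · have hgX : g ∈ A ∩ G.cut X := ⟨hgA, v, w, hinc, hRX hv, hwX⟩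
      have h1 := h.dw g hgX
      rw [(inn_eq hinc (hRX hv) hwX).1] at h1
      have h2 := DW_back h1 hv (fun d hd => hback g hgX d hd)
      refine ⟨g, p g, fun _ => ⟨hgX, h1, ?_, h.nd g hgX, Or.inl ⟨rfl, fun d hd => (h2.2 d hd).2⟩⟩⟩
      intro d hd
      exact ⟨hd, (ins_iff (DW_inc h1 hd)).2 (h2.2 d hd), (h2.2 d hd).2⟩
  choose f l hfl using ex
  have finj : ∀ g ∈ A ∩ G.cut R, ∀ g' ∈ A ∩ G.cut R, f g = f g' → g = g' := by
    intro g hg g' hg' hff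
    obtain ⟨h1, h2, h3, h4, h5⟩ := hfl g hg
    obtain ⟨k1, k2, k3, k4, k5⟩ := hfl g' hg'
    rcases h5 with ⟨h5, h6⟩ | ⟨w, l2, h5, h6⟩ <;> rcases k5 with ⟨k5, k6⟩ | ⟨w', l2', k5, k6⟩
    · rw [h5, k5, hff]
    · rw [hff] at h6
      exact absurd (h6 (g', inn G R g', w') (by rw [k6]; simp)) k5
    · rw [← hff] at k6
      exact absurd (k6 (g, inn G R g, w) (by rw [h6]; simp)) h5
    · rw [hff] at h6
      have := first_bad (fun d : E × V × V => d.2.2 ∈ R) h6 k6 (fun x hx => (h3 x hx).2.2)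
        (fun x hx => (k3 x hx).2.2) h5 k5
      exact (Prod.mk.inj this).1
  have hDL : DLk G σ A (u '' (A ∩ G.cut X)) R (fun g => u (f g)) l := by
    refine ⟨?_, ?_, ?_, ?_, ?_, ?_⟩
    · intro g hg; exact ⟨f g, (hfl g hg).1, rfl⟩
    · intro g hg d hd
      have := (hfl g hg).2.2.1 d hd
      exact ⟨(h.sub _ (hfl g hg).1 d this.1).1, this.2.1⟩
    · intro g hg; exact (hfl g hg).2.1
    · intro g hg; exact (hfl g hg).2.2.2.1
    · intro g hg g' hg' hu
      exact finj g hg g' hg' (h.inj _ (hfl g hg).1 _ (hfl g' hg').1 hu)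
    · intro g hg g' hg' d hd d' hd' hdd
      exact finj g hg g' hg' (h.disj _ (hfl g hg).1 _ (hfl g' hg').1 d ((hfl g hg).2.2.1 d hd).1 d'
        ((hfl g' hg').2.2.1 d' hd').1 hdd)
  refine ⟨R, hRX, fun i hi => ⟨i, hi, ReflTransGen.refl⟩, _, l, hDL, ?_⟩
  rintro v ⟨i, hi, hr⟩
  refine ⟨i, hi, ?_⟩
  have : ∀ v, ResR G A X p (σ i) v → ResR G A R l (σ i) v ∧ v ∈ R := by
    intro v hr
    induction hr with
    | refl => exact ⟨ReflTransGen.refl, i, hi, ReflTransGen.refl⟩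
    | @tail a b h1 h2 ih =>
      obtain ⟨e, he, hinc⟩ := h2
      have hb := hstep e a b ih.2 he hinc
      refine ⟨ih.1.tail ⟨e, ⟨he.1, (ins_iff hinc).2 ⟨ih.2, hb⟩, ?_⟩, hinc⟩, hb⟩
      intro g hg hd
      exact he.2.2 (f g) (hfl g hg).1 ((hfl g hg).2.2.1 _ hd).1
  exact (this v hr).1

/-- The reach lemma. -/
lemma reach {X : Set V} {u : E → ι} {P : E → Set E} (h : Lk G σ A I X u P)
    (N : Set ι) (hN : ∀ i ∈ N, σ i ∈ X) (hNu : ∀ i ∈ N, ∀ e ∈ A ∩ G.cut X, u e ≠ i) :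
    ∃ R ⊆ X, (∀ i ∈ N, σ i ∈ R) ∧ (∃ u' P', Lk G σ A (u '' (A ∩ G.cut X)) R u' P') ∧
      ∀ v ∈ R, ∃ i ∈ N, SWat G σ A (insert i (u '' (A ∩ G.cut X))) R v := by
  obtain ⟨p, hp, _⟩ := h.toDLk
  obtain ⟨R, hRX, hNR, u', p', hD, hreach⟩ := restrictR hp N hN
  refine ⟨R, hRX, hNR, ⟨u', _, hD.toLk⟩, ?_⟩
  intro v hv
  obtain ⟨i, hi, hr⟩ := hreach v hv
  refine ⟨i, hi, ?_⟩
  obtain ⟨l, hl1, hl2, hl3⟩ := exists_DW hr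
  have hD' : DLk G σ A (insert i (u '' (A ∩ G.cut X))) R u' p' :=
    { hD with mem := fun e he => Or.inr (hD.mem e he) }
  refine augment l u' p' i [] (σ i) hD' (mem_insert _ _) ?_ rfl (by simp) (by simp) (by simp) hl1 hl3
    hl2 (by simp)
  intro e he hue
  obtain ⟨f, hf, hfu⟩ := hD.mem e he
  exact hNu i hi f hf (hfu.trans hue)

lemma SWat.mono_units {X : Set V} {v : V} {I' : Set ι} (h : SWat G σ A I X v) (hI : I ⊆ I') :
    SWat G σ A I' X v := by
  obtain ⟨u, P, j, Q, h1, h2, h3⟩ := h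
  exact ⟨u, P, j, Q, { h1 with mem := fun e he => hI (h1.mem e he) }, hI h2, h3⟩

/-- adding an edge not leaving X -/
lemma Lk.add_not_cut {X : Set V} {u : E → ι} {P : E → Set E} {A' : Set E} (h : Lk G σ A I X u P)
    (hA : A ⊆ A') (hA' : ∀ c ∈ A', c ∈ G.cut X → c ∈ A) : Lk G σ A' I X u P := by
  have hm : ∀ e ∈ A' ∩ G.cut X, e ∈ A ∩ G.cut X := fun e he => ⟨hA' e he.1 he.2, he.2⟩
  exact ⟨fun e he => h.mem e (hm e he), fun e he => h.fin e (hm e he),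
    fun e he => (h.sub e (hm e he)).trans hA, fun e he => h.ins e (hm e he),
    fun e he => h.conn e (hm e he), fun e he f hf => h.inj e (hm e he) f (hm f hf),
    fun e he f hf => h.disj e (hm e he) f (hm f hf)⟩

/-- adding a leaving edge with its own path -/
lemma Lk.add_cut {X : Set V} {u : E → ι} {P : E → Set E} {A' : Set E} {c : E} {j : ι} {Q : Set E}
    (h : Lk G σ A I X u P)
    (hA : A ⊆ A') (hA' : ∀ e ∈ A', e ∈ G.cut X → e = c ∨ e ∈ A) (hcX : c ∈ G.cut X)
    (hj : j ∈ I) (hju : ∀ e ∈ A ∩ G.cut X, u e ≠ j) (hQf : Q.Finite) (hQA : Q ⊆ A')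
    (hQX : Q ⊆ Ins G X) (hQd : ∀ e ∈ A ∩ G.cut X, ∀ g, g ∈ P e → g ∉ Q)
    (hQ : Conn G Q (σ j) (inn G X c)) :
    ∃ u' P', Lk G σ A' I X u' P' ∧ u' c = j ∧ P' c = Q ∧ ∀ e, e ≠ c → u' e = u e ∧ P' e = P e := by
  classical
  refine ⟨Function.update u c j, Function.update P c Q, ?_, by simp, by simp,
    fun e he => by simp [he]⟩
  have hm : ∀ e ∈ A' ∩ G.cut X, e = c ∨ (e ≠ c ∧ e ∈ A ∩ G.cut X) := by
    intro e he
    by_cases h : e = c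
    · exact Or.inl h
    · exact Or.inr ⟨h, (hA' e he.1 he.2).resolve_left h, he.2⟩
  refine ⟨?_, ?_, ?_, ?_, ?_, ?_, ?_⟩
  · intro e he
    rcases hm e he with rfl | ⟨h1, h2⟩
    · simpa using hj
    · simpa [h1] using h.mem e h2
  · intro e he
    rcases hm e he with rfl | ⟨h1, h2⟩
    · simpa using hQf
    · simpa [h1] using h.fin e h2
  · intro e he
    rcases hm e he with rfl | ⟨h1, h2⟩
    · simpa using hQA
    · simpa [h1] using (h.sub e h2).trans hA
  · intro e he
    rcases hm e he with rfl | ⟨h1, h2⟩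
    · simpa using hQX
    · simpa [h1] using h.ins e h2
  · intro e he
    rcases hm e he with rfl | ⟨h1, h2⟩
    · simpa using hQ
    · simpa [h1] using h.conn e h2
  · intro e he f hf hef
    rcases hm e he with rfl | ⟨h1, h2⟩ <;> rcases hm f hf with rfl | ⟨k1, k2⟩
    · rfl
    · simp [k1] at hef; exact absurd hef.symm (hju f k2)
    · simp [h1] at hef; exact absurd hef (hju e h2)
    · simp [h1, k1] at hef; exact h.inj e h2 f k2 hef
  · intro e he f hf g hg hg'
    rcases hm e he with rfl | ⟨h1, h2⟩ <;> rcases hm f hf with rfl | ⟨k1, k2⟩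
    · rfl
    · simp [k1] at hg hg'; exact absurd hg (hQd f k2 g hg')
    · simp [h1] at hg hg'; exact absurd hg' (hQd e h2 g hg)
    · simp [h1, k1] at hg hg'; exact h.disj e h2 f k2 g hg hg'

lemma SWat.add_cut {X : Set V} {c : E} {A' : Set E} (hcX : c ∈ G.cut X)
    (h : SWat G σ A I X (inn G X c)) (hA : A ⊆ A') (hA' : ∀ e ∈ A', e ∈ G.cut X → e = c ∨ e ∈ A) :
    ∃ u P, Lk G σ A' I X u P := by
  obtain ⟨u, P, j, Q, h1, h2, h3, h4, h5, h6, h7, h8⟩ := h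
  obtain ⟨u', P', hL, _⟩ := h1.add_cut hA hA' hcX h2 h3 h4 (h5.trans hA) h6 h7 h8
  exact ⟨u', P', hL⟩

lemma HD (C : Finset E) : ∀ (X : Set V) (u : E → ι) (P : E → Set E) (J : Finset ι),
    Lk G σ (A \ C) I X u P → (∀ j ∈ J, j ∈ I ∧ σ j ∈ X ∧ ∀ e ∈ (A \ C) ∩ G.cut X, u e ≠ j) →
    C.card < J.card → ∃ X' ⊆ X, HindAt G σ A I X' := by
  classical
  induction C using Finset.induction_on with
  | empty =>
    intro X u P J h hJ hc
    obtain ⟨j, hj⟩ := Finset.card_pos.1 (by simpa using hc)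
    simp only [Finset.coe_empty, sdiff_empty] at h hJ
    exact ⟨X, subset_rfl, u, P, j, h, hJ j hj⟩
  | insert c C hc ih =>
    intro X u P J h hJ hcard
    rw [Finset.card_insert_of_notMem hc] at hcard
    have hsub : A \ (insert c C : Finset E) ⊆ A \ (C : Set E) := by
      intro e he
      refine ⟨he.1, fun h => he.2 ?_⟩
      simp at h ⊢; exact Or.inr h
    have hsub' : ∀ e ∈ A \ (C : Set E), e = c ∨ e ∈ A \ (insert c C : Finset E) := by
      intro e he
      by_cases hec : e = c
      · exact Or.inl hec
      · refine Or.inr ⟨he.1, fun h => ?_⟩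
        simp at h
        rcases h with h | h
        · exact hec h
        · exact he.2 h
    obtain ⟨R, hRX, hNR, ⟨u', P', hL⟩, hSW⟩ := reach h J (fun i hi => (hJ i hi).2.1)
      (fun i hi => (hJ i hi).2.2)
    have himg : u '' ((A \ (insert c C : Finset E)) ∩ G.cut X) ⊆ I := by
      rintro _ ⟨e, he, rfl⟩; exact h.mem e he
    have hnot : ∀ j ∈ J, j ∉ u '' ((A \ (insert c C : Finset E)) ∩ G.cut X) := by
      rintro j hj ⟨e, he, rfl⟩
      exact (hJ _ hj).2.2 e he rfl
    by_cases hcR : c ∈ G.cut R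
    · obtain ⟨i, hi, hs⟩ := hSW _ (inc_eq hcR).2.1
      obtain ⟨u2, P2, hL2⟩ := hs.add_cut hcR hsub (fun e he _ => hsub' e he)
      obtain ⟨X', hX', hH⟩ := ih R u2 P2 (J.erase i) (hL2.mono_units (fun e he => by
          rcases hL2.mem e he with h | h
          · rw [h]; exact (hJ i hi).1
          · exact himg h)) (by
          intro j hj
          have hjJ := Finset.mem_of_mem_erase hj
          refine ⟨(hJ j hjJ).1, hNR j hjJ, ?_⟩
          intro e he hue
          rcases hL2.mem e he with h | h
          · rw [hue] at h; exact Finset.ne_of_mem_erase hj h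
          · rw [hue] at h; exact hnot j hjJ h) (by
          rw [Finset.card_erase_of_mem hi]; omega)
      exact ⟨X', hX'.trans hRX, hH⟩
    · have hL2 : Lk G σ (A \ (C : Set E)) _ R u' P' := hL.add_not_cut hsub (by
        intro e he heR
        rcases hsub' e he with h | h
        · rw [h] at heR; exact absurd heR hcR
        · exact h)
      obtain ⟨X', hX', hH⟩ := ih R u' P' J (hL2.mono_units (fun e he => himg (hL2.mem e he))) (by
          intro j hj
          refine ⟨(hJ j hj).1, hNR j hj, ?_⟩
          intro e he hue
          have h := hL2.mem e he
          rw [hue] at h; exact hnot j hj h) (by omega)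
      exact ⟨X', hX'.trans hRX, hH⟩

/-- restricting the edge set, the units still being linked -/
lemma Lk.restrict {X : Set V} {u : E → ι} {P : E → Set E} {A' : Set E} {I' : Set ι}
    (h : Lk G σ A I X u P) (hA : ∀ e ∈ A' ∩ G.cut X, e ∈ A ∧ P e ⊆ A' ∧ u e ∈ I') :
    Lk G σ A' I' X u P := by
  have hm : ∀ e ∈ A' ∩ G.cut X, e ∈ A ∩ G.cut X := fun e he => ⟨(hA e he).1, he.2⟩
  exact ⟨fun e he => (hA e he).2.2, fun e he => h.fin e (hm e he),
    fun e he => (hA e he).2.1, fun e he => h.ins e (hm e he),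
    fun e he => h.conn e (hm e he), fun e he f hf => h.inj e (hm e he) f (hm f hf),
    fun e he f hf => h.disj e (hm e he) f (hm f hf)⟩

/-- B5 -/
lemma unhind_add_finite {F : Set E} (hF : F.Finite) (h : ¬ Hind G σ (A \ F) I T) :
    ¬ Hind G σ A I T := by
  classical
  rintro ⟨X, hX, u, P, i, hL, hi, hiX, hs⟩
  apply h
  set C : Set E := {e | e ∈ A \ F ∧ e ∈ G.cut X ∧ (P e ∩ F).Nonempty} with hC
  have hCf : C.Finite := by
    have : ∀ e ∈ C, ∃ f ∈ F, f ∈ P e := fun e he => by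
      obtain ⟨f, h1, h2⟩ := he.2.2; exact ⟨f, h2, h1⟩
    choose! φ hφ using this
    refine Set.Finite.of_finite_image (f := φ) (hF.subset ?_) ?_
    · rintro _ ⟨e, he, rfl⟩; exact (hφ e he).1
    · intro e he f hf hef
      exact hL.disj e ⟨he.1.1, he.2.1⟩ f ⟨hf.1.1, hf.2.1⟩ (φ e) (hφ e he).2 (hef ▸ (hφ f hf).2)
  have hL2 : Lk G σ ((A \ F) \ (hCf.toFinset : Set E)) I X u P := by
    refine hL.restrict ?_
    rintro e ⟨⟨he1, he2⟩, heX⟩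
    have he2' : e ∉ C := by simpa using he2
    refine ⟨he1.1, ?_, hL.mem e ⟨he1.1, heX⟩⟩
    intro g hg
    have hgA := hL.sub e ⟨he1.1, heX⟩ hg
    refine ⟨⟨hgA, fun hgF => he2' ⟨he1, heX, g, hg, hgF⟩⟩, ?_⟩
    intro hgC
    have hgC' : g ∈ C := by simpa using hgC
    exact ins_not_cut (hL.ins e ⟨he1.1, heX⟩ hg) hgC'.2.1
  have hni : i ∉ hCf.toFinset.image u := by
    intro hm
    obtain ⟨e, he, hue⟩ := Finset.mem_image.1 hm
    have he' : e ∈ C := by simpa using he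
    exact hs e ⟨he'.1.1, he'.2.1⟩ hue
  obtain ⟨X', hX', hH⟩ := HD hCf.toFinset X u P (insert i (hCf.toFinset.image u)) hL2 (by
    intro j hj
    rcases Finset.mem_insert.1 hj with rfl | hj
    · exact ⟨hi, hiX, fun e he => hs e ⟨he.1.1.1, he.2⟩⟩
    · obtain ⟨e, he, rfl⟩ := Finset.mem_image.1 hj
      have he' : e ∈ C := by simpa using he
      have heA : e ∈ A ∩ G.cut X := ⟨he'.1.1, he'.2.1⟩
      refine ⟨hL.mem e heA, hL.start heA, ?_⟩
      intro f hf hfe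
      have := hL.inj f ⟨hf.1.1.1, hf.2⟩ e heA hfe
      subst this
      exact hf.1.2 he) (by
    rw [Finset.card_insert_of_notMem hni, Finset.card_image_of_injOn]
    · omega
    · intro e he f hf hef
      have he' : e ∈ C := by simpa using he
      have hf' : f ∈ C := by simpa using hf
      exact hL.inj e ⟨he'.1.1, he'.2.1⟩ f ⟨hf'.1.1, hf'.2.1⟩ hef)
  exact ⟨X', hX.mono_left hX', hH⟩

lemma WaveFree.del (h : WaveFree G σ A I T) (f : E) : ¬ Hind G σ (A \ {f}) I T := by
  rintro ⟨X, hX, u, P, i, hL, hi, hiX, hs⟩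
  obtain ⟨R, hRX, hNR, ⟨u', P', hL'⟩, hSW⟩ := reach hL {i} (by simpa using hiX) (by simpa using hs)
  have hne : R ≠ ∅ := by
    intro hR
    have := hNR i rfl
    rw [hR] at this
    exact this
  have himg : u '' ((A \ {f}) ∩ G.cut X) ⊆ I := by
    rintro _ ⟨e, he, rfl⟩; exact hL.mem e he
  have hW : ∃ u P, Lk G σ A I R u P := by
    by_cases hf : f ∈ G.cut R
    · obtain ⟨j, hj, hsw⟩ := hSW _ (inc_eq hf).2.1
      rw [mem_singleton_iff] at hj
      subst hj
      refine (hsw.mono_units (insert_subset hi himg)).add_cut hf sdiff_subset ?_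
      intro e he _
      by_cases hef : e = f
      · exact Or.inl hef
      · exact Or.inr ⟨he, hef⟩
    · refine ⟨u', P', (hL'.mono_units (fun e he => himg (hL'.mem e he))).add_not_cut sdiff_subset ?_⟩
      intro c hc hcR
      refine ⟨hc, ?_⟩
      rintro rfl
      exact hf hcR
  exact hne (h R ⟨hX.mono_left hRX, hW⟩)

/-- B3 -/
lemma WaveFree.add (h : WaveFree G σ A I T) (j : ι) : ¬ Hind G σ A (insert j I) T := by
  rintro ⟨X, hX, u, P, i, hL, hi, hiX, hs⟩
  by_cases hj : ∃ e ∈ A ∩ G.cut X, u e = j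
  · obtain ⟨e, he, hue⟩ := hj
    refine h.del e ⟨X, hX, u, P, i, hL.restrict ?_, ?_, hiX, fun f hf => hs f ⟨hf.1.1, hf.2⟩⟩
    · rintro f ⟨⟨hf1, hf2⟩, hfX⟩
      have hf : f ∈ A ∩ G.cut X := ⟨hf1, hfX⟩
      refine ⟨hf1, ?_, ?_⟩
      · intro g hg
        refine ⟨hL.sub f hf hg, ?_⟩
        rintro rfl
        exact ins_not_cut (hL.ins f hf hg) he.2
      · rcases hL.mem f hf with h1 | h1
        · exact absurd (hL.inj f hf e he (h1.trans hue.symm)) hf2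
        · exact h1
    · rcases hi with rfl | hi
      · exact absurd hue (hs e he)
      · exact hi
  · push Not at hj
    have : X = ∅ := h X ⟨hX, u, P, hL.mono_units (fun e he =>
      (hL.mem e he).resolve_left (hj e he))⟩
    rw [this] at hiX
    exact hiX

/-- Removing units keeps wave-freeness. -/
lemma WaveFree.sub {I' : Set ι} (h : WaveFree G σ A I T) (hI : I' ⊆ I) : WaveFree G σ A I' T := by
  rintro X ⟨hX, u, P, hL⟩
  exact h X ⟨hX, u, P, hL.mono_units (fun e he => hI (hL.mem e he))⟩

lemma Hind.mono {I' : Set ι} {T' : Set V} (h : Hind G σ A I T) (hI : I ⊆ I') (hT : T' ⊆ T) :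
    Hind G σ A I' T' := by
  obtain ⟨X, hX, u, P, i, hL, hi, hiX, hs⟩ := h
  exact ⟨X, hX.mono_right hT, u, P, i, hL.mono_units (fun e he => hI (hL.mem e he)), hI hi, hiX, hs⟩

/-- TL -/
lemma tight {Y : Set V} {u : E → ι} {P : E → Set E} (hun : ¬ Hind G σ A I T)
    (hL : Lk G σ A I Y u P) (hYT : Disjoint Y T)
    (hq : WaveFree G (Qs G σ Y) (A \ Tch G Y) (QI G σ A I Y) (T ∪ Y)) {e : E}
    (he : e ∈ A ∩ G.cut Y) : ¬ Hind G σ (A \ (P e ∪ {e})) (I \ {u e}) T := by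
  classical
  rintro ⟨X, hX, hH⟩
  have hPt : P e ∪ {e} ⊆ Tch G Y := by
    rintro g (hg | hg)
    · exact ins_tch (hL.ins e he hg)
    · rw [hg]; exact cut_tch he.2
  have h1 : (A \ (P e ∪ {e})) \ Tch G Y = A \ Tch G Y := by
    ext g
    constructor
    · rintro ⟨⟨h1, h2⟩, h3⟩; exact ⟨h1, h3⟩
    · rintro ⟨h1, h3⟩; exact ⟨⟨h1, fun h => h3 (hPt h)⟩, h3⟩
  have h2 : QI G σ (A \ (P e ∪ {e})) (I \ {u e}) Y ⊆ QI G σ A I Y := by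
    rintro (i | c) hj
    · rw [inl_mem_QI] at hj ⊢; exact ⟨hj.1.1, hj.2⟩
    · rw [inr_mem_QI] at hj ⊢; exact ⟨hj.1.1, hj.2⟩
  have h3 := Hind.restrict (W := Y) hX hH (by rw [h1]; exact (hq.sub h2).unhind)
  have hL2 : Lk G σ (A \ (P e ∪ {e})) (I \ {u e}) Y u P := by
    refine hL.restrict ?_
    rintro f ⟨⟨hf1, hf2⟩, hfY⟩
    have hf : f ∈ A ∩ G.cut Y := ⟨hf1, hfY⟩
    have hfe : f ≠ e := fun h => hf2 (Or.inr h)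
    refine ⟨hf1, ?_, hL.mem f hf, fun h => hfe (hL.inj f hf e he h)⟩
    intro g hg
    refine ⟨hL.sub f hf hg, ?_⟩
    rintro (hg' | hg')
    · exact hfe (hL.disj f hf e he g hg hg')
    · rw [hg'] at hg
      exact ins_not_cut (hL.ins f hf hg) he.2
  have h4 := h3.union hL2
  rw [union_eq_self_of_subset_left inter_subset_right] at h4
  obtain ⟨u2, P2, i, k1, k2, k3, k4⟩ := h4
  obtain ⟨u3, P3, m1, m2, m3, m4⟩ := (k1.mono_units (I' := I) (fun f hf => (k1.mem f hf).1)).add_cut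
    (A' := A) (c := e) (j := u e) (Q := P e) sdiff_subset
    (by
      intro f hf hfY
      by_cases hfe : f = e
      · exact Or.inl hfe
      · refine Or.inr ⟨hf, ?_⟩
        rintro (h | h)
        · exact ins_not_cut (hL.ins e he h) hfY
        · exact hfe h) he.2 (hL.mem e he) (fun f hf => (k1.mem f hf).2) (hL.fin e he) (hL.sub e he)
    (hL.ins e he) (fun f hf g hg hg' => (k1.sub f hf hg).2 (Or.inl hg')) (hL.conn e he)
  refine hun ⟨Y, hYT, u3, P3, i, m1, k2.1, k3, ?_⟩
  intro f hf
  by_cases hfe : f = e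
  · rw [hfe, m2]; exact fun h => k2.2 h.symm
  · rw [(m4 f hfe).1]
    refine k4 f ⟨⟨hf.1, ?_⟩, hf.2⟩
    rintro (h | h)
    · exact ins_not_cut (hL.ins e he h) hf.2
    · exact hfe h

end EM



namespace EM
open Set Relation

universe w
variable {V : Type u} {E : Type v} {G : Multigraph V E}
variable {ι : Type w} {σ : ι → V} {A : Set E} {I : Set ι} {T : Set V}

lemma QI_insert_sub {W : Set V} {j : ι} :
    QI G σ A (insert j I) W ⊆ insert (Sum.inl j) (QI G σ A I W) := by
  rintro (i | c) h
  · rw [inl_mem_QI] at h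
    rcases h.1 with rfl | h1
    · exact Or.inl rfl
    · exact Or.inr (inl_mem_QI.2 ⟨h1, h.2⟩)
  · rw [inr_mem_QI] at h
    exact Or.inr (inr_mem_QI.2 h)

lemma Greatest.quot_add {W : Set V} (h : Greatest G σ A I T W) (j : ι) :
    ¬ Hind G (Qs G σ W) (A \ Tch G W) (QI G σ A (insert j I) W) (T ∪ W) :=
  fun hh => h.quot.add (Sum.inl j) (hh.mono QI_insert_sub subset_rfl)

lemma Greatest.unhind_add {W : Set V} (h : Greatest G σ A I T W) (hun : ¬ Hind G σ A I T) {j : ι}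
    (hj : σ j ∉ W) : ¬ Hind G σ A (insert j I) T := by
  rintro ⟨X, hX, hH⟩
  obtain ⟨u, P, i, hL, hi, hiX, hs⟩ := Hind.restrict hX hH (h.quot_add j)
  refine hun ⟨X ∩ W, hX.mono_left inter_subset_left, u, P, i, hL.mono_units ?_, ?_, hiX, hs⟩
  · intro e he
    rcases hL.mem e he with h1 | h1
    · have := (hL.start he).2
      rw [h1] at this
      exact absurd this hj
    · exact h1
  · rcases hi with rfl | hi
    · exact absurd hiX.2 hj
    · exact hi

/-- Peeling off what happens outside of `W`. -/
lemma peel {W : Set V} {A' : Set E} {I' : Set ι}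
    (hq : ¬ Hind G (Qs G σ W) (A \ Tch G W) (QI G σ A I W) (T ∪ W))
    (hA : A ∩ Tch G W = A' ∩ Tch G W) (hI : ∀ i ∈ I, σ i ∈ W → i ∈ I')
    (hun : ¬ Hind G σ A' I' T) : ¬ Hind G σ A I T := by
  rintro ⟨X, hX, hH⟩
  obtain ⟨u, P, i, hL, hi, hiX, hs⟩ := Hind.restrict hX hH hq
  have hcut : ∀ e ∈ G.cut (X ∩ W), e ∈ Tch G W := fun e he => tch_mono inter_subset_right (cut_tch he)
  have hAA : ∀ e ∈ Tch G W, e ∈ A ↔ e ∈ A' := by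
    intro e he
    constructor
    · intro h
      have : e ∈ A ∩ Tch G W := ⟨h, he⟩
      rw [hA] at this; exact this.1
    · intro h
      have : e ∈ A' ∩ Tch G W := ⟨h, he⟩
      rw [← hA] at this; exact this.1
  refine hun ⟨X ∩ W, hX.mono_left inter_subset_left, u, P, i, hL.restrict ?_, hI i hi hiX.2, hiX, ?_⟩
  · rintro e ⟨he, heX⟩
    have he' : e ∈ A ∩ G.cut (X ∩ W) := ⟨(hAA e (hcut e heX)).2 he, heX⟩
    refine ⟨he'.1, ?_, hI _ (hL.mem e he') (hL.start he').2⟩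
    intro g hg
    refine (hAA g ?_).1 (hL.sub e he' hg)
    exact tch_mono inter_subset_right (ins_tch (hL.ins e he' hg))
  · rintro e ⟨he, heX⟩
    exact hs e ⟨(hAA e (hcut e heX)).2 he, heX⟩

variable (G σ A I T) in
/-- `F` is a safe access to `z` -/
def Acc (y : V) (W : Set V) (z : V) (F : Set E) : Prop :=
  F.Finite ∧ F ⊆ A ∧ Conn G F y z ∧ ¬ Hind G σ (A \ F) I T ∧ F ⊆ Tch G W

lemma Acc.mono {y z : V} {W W' : Set V} {F : Set E} (h : Acc G σ A I T y W z F) (hW : W ⊆ W') :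
    Acc G σ A I T y W' z F := ⟨h.1, h.2.1, h.2.2.1, h.2.2.2.1, h.2.2.2.2.trans (tch_mono hW)⟩

/-- state of the path finding procedure -/
structure St (G : Multigraph V E) (σ : ι → V) (A : Set E) (I : Set ι) (T : Set V) (y : V) where
  U : Finset ι
  W : Set V
  u : E → ι
  P : E → Set E
  hU : ∀ j ∈ U, j ∉ I
  unh : ¬ Hind G σ A (I ∪ U) T
  gr : Greatest G σ A (I ∪ U) T W
  lk : Lk G σ A (I ∪ U) W u P
  acc1 : ∀ j ∈ U, σ j ∉ W → ∃ F, Acc G σ A I T y W (σ j) F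
  acc2 : ∀ e ∈ A ∩ G.cut W, u e ∈ U → ∃ F, e ∈ F ∧ Acc G σ A I T y W (out G W e) F

/-- extension of states -/
def St.le {y : V} (S S' : St G σ A I T y) : Prop :=
  S.U ⊆ S'.U ∧ S.W ⊆ S'.W ∧
    ∀ e ∈ A ∩ G.cut S.W, e ∈ G.cut S'.W → S.u e = S'.u e ∧ S.P e = S'.P e

lemma St.le_refl {y : V} (S : St G σ A I T y) : S.le S := ⟨subset_rfl, subset_rfl, fun _ _ _ => ⟨rfl, rfl⟩⟩

lemma St.le_trans {y : V} {a b c : St G σ A I T y} (h : a.le b) (h' : b.le c) : a.le c := by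
  refine ⟨h.1.trans h'.1, h.2.1.trans h'.2.1, fun e he hc => ?_⟩
  have hb := cut_sandwich h.2.1 h'.2.1 he.2 hc
  have h1 := h.2.2 e he hb
  have h2 := h'.2.2 e ⟨he.1, hb⟩ hc
  exact ⟨h1.1.trans h2.1, h1.2.trans h2.2⟩

/-- one step: add a unit at an accessible vertex -/
lemma St.step [Nonempty ι] {y : V} (S : St G σ A I T y) {j : ι} (hjI : j ∉ I) (hjU : j ∉ S.U)
    (hjW : σ j ∉ S.W) (hacc : ∃ F, Acc G σ A I T y S.W (σ j) F) :
    ∃ S' : St G σ A I T y, S.le S' ∧ j ∈ S'.U := by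
  classical
  obtain ⟨U, W, u, P, hU, unh, gr, lk, acc1, acc2⟩ := S
  simp only [St.le] at *
  have hcoe : I ∪ ((insert j U : Finset ι) : Set ι) = insert j (I ∪ U) := by
    ext i; simp
  have hjIU : j ∉ I ∪ (U : Set ι) := by simp [hjI, hjU]
  have unh' : ¬ Hind G σ A (I ∪ (insert j U : Finset ι)) T := by
    rw [hcoe]; exact gr.unhind_add unh hjW
  have hqun : ¬ Hind G (Qs G σ W) (A \ Tch G W) (QI G σ A (I ∪ (insert j U : Finset ι)) W) (T ∪ W) := by
    rw [hcoe]; exact gr.quot_add j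
  obtain ⟨W', gr'⟩ := exists_greatest G σ A (I ∪ (insert j U : Finset ι)) T
  have hIU : I ∪ (U : Set ι) ⊆ I ∪ (insert j U : Finset ι) := by
    rw [hcoe]; exact subset_insert _ _
  have lk0 : Lk G σ A (I ∪ (insert j U : Finset ι)) W u P :=
    lk.mono_units (fun e he => hIU (lk.mem e he))
  have hWW' : W ⊆ W' := gr'.2 W ⟨gr.1.1, u, P, lk0⟩
  obtain ⟨u1, P1, lk1⟩ := gr'.1.2
  obtain ⟨v, lkq, -⟩ := Q2 lk1 W
  set Q : E → Set E := fun e => P1 e \ Tch G W with hQ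
  obtain ⟨u2, P2, lk2, hT, hnT⟩ := Q1 lk0 lkq disjoint_sdiff_left
  have hunion : W ∪ W' \ W = W' := union_sdiff_cancel hWW'
  have hYT : Disjoint (W' \ W) (T ∪ W) :=
    disjoint_union_right.2 ⟨gr'.1.1.mono_left sdiff_subset, disjoint_sdiff_left⟩
  have grY : Greatest G (Qs G σ W) (A \ Tch G W) (QI G σ A (I ∪ (insert j U : Finset ι)) W) (T ∪ W)
      (W' \ W) := by
    refine ⟨⟨hYT, v, Q, lkq⟩, ?_⟩
    rintro Z ⟨hZ, vz, Qz, hLz⟩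
    rw [disjoint_union_right] at hZ
    obtain ⟨u3, P3, lk3, -⟩ := Q1 lk0 hLz hZ.2
    have := gr'.2 (W ∪ Z) ⟨disjoint_union_left.2 ⟨gr.1.1, hZ.1⟩, u3, P3, lk3⟩
    intro z hz
    exact ⟨this (Or.inr hz), fun h => Set.disjoint_left.1 hZ.2 hz h⟩
  rw [hunion] at lk2
  refine ⟨⟨insert j U, W', u2, P2, ?_, unh', gr', lk2, ?_, ?_⟩, ⟨Finset.subset_insert _ _, hWW', ?_⟩,
    Finset.mem_insert_self _ _⟩
  · intro i hi
    rcases Finset.mem_insert.1 hi with rfl | hi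
    · exact hjI
    · exact hU i hi
  · intro i hi hiW
    rcases Finset.mem_insert.1 hi with rfl | hi
    · obtain ⟨F, hF⟩ := hacc
      exact ⟨F, hF.mono hWW'⟩
    · obtain ⟨F, hF⟩ := acc1 i hi (fun h => hiW (hWW' h))
      exact ⟨F, hF.mono hWW'⟩
  · intro e he heU
    have he' := he.2
    rw [← hunion] at he'
    rcases cut_union_cases he' with ⟨k1, k2, k3⟩ | ⟨k1, k2, k3⟩
    · rw [(hT e k1).1] at heU
      have hm := lk.mem e ⟨he.1, k2⟩
      have : u e ∈ U := by
        rcases Finset.mem_insert.1 heU with h | h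
        · rw [h] at hm; exact absurd hm hjIU
        · exact h
      obtain ⟨F, hF, hF'⟩ := acc2 e ⟨he.1, k2⟩ this
      refine ⟨F, hF, ?_⟩
      rw [hunion] at k3
      have hout : out G W' e = out G W e := by
        obtain ⟨g1, g2, g3⟩ := inc_eq k2
        obtain ⟨g4, g5, g6⟩ := inc_eq he.2
        rw [k3, g1] at g4
        rcases Sym2.eq_iff.1 g4 with h | h
        · exact h.2.symm
        · exact (h.2.trans h.1).symm
      rw [hout]
      exact hF'.mono hWW'
    · have hm : e ∈ (A \ Tch G W) ∩ G.cut (W' \ W) := ⟨⟨he.1, k1⟩, k2⟩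
      rw [(hnT e k1).1] at heU
      -- access to the starting point
      have hst : ∃ F, Acc G σ A I T y W (Qs G σ W (v e)) F ∧
          ∀ A', A' ∩ F = ∅ → v e ∉ QI G σ A' I W := by
        have hq := lkq.mem e hm
        rcases hve : v e with i | c
        · rw [hve] at heU hq
          change i ∈ insert j U at heU
          rw [inl_mem_QI] at hq
          have hiI : i ∉ I := by
            rcases Finset.mem_insert.1 heU with rfl | hi
            · exact hjI
            · exact hU i hi
          have : ∃ F, Acc G σ A I T y W (σ i) F := by
            rcases Finset.mem_insert.1 heU with rfl | hi
            · exact hacc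
            · exact acc1 i hi hq.2
          obtain ⟨F, hF⟩ := this
          refine ⟨F, hF, fun A' _ h => ?_⟩
          rw [inl_mem_QI] at h
          exact hiI h.1
        · rw [hve] at heU hq
          change u c ∈ insert j U at heU
          have hc := inr_mem_QI.1 hq
          have hmc := lk.mem c hc
          have : u c ∈ U := by
            rcases Finset.mem_insert.1 heU with h | h
            · rw [h] at hmc; exact absurd hmc hjIU
            · exact h
          obtain ⟨F, hF, hF'⟩ := acc2 c hc this
          refine ⟨F, hF', fun A' hA' h => ?_⟩
          rw [inr_mem_QI] at h
          have : c ∈ A' ∩ F := ⟨h.1, hF⟩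
          rw [hA'] at this
          exact this
      obtain ⟨F, ⟨f1, f2, f3, f4, f5⟩, hFn⟩ := hst
      have hQA := lkq.sub e hm
      have hinc := inc_eq k2
      refine ⟨F ∪ (Q e ∪ {e}), Or.inr (Or.inr rfl), ?_, ?_, ?_, ?_, ?_⟩
      · exact f1.union ((lkq.fin e hm).union (finite_singleton e))
      · refine union_subset f2 (union_subset (hQA.trans sdiff_subset) ?_)
        simpa using he.1
      · refine (f3.mono subset_union_left).trans (((lkq.conn e hm).mono ?_).trans ?_)
        · exact fun g hg => Or.inr (Or.inl hg)
        · have h1 := inc_eq he.2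
          have h2 : inn G W' e = inn G (W' \ W) e := by rw [← k3, hunion]
          rw [← h2]
          exact Conn.single (Or.inr (Or.inr rfl)) h1.1
      · -- safety
        have ht := tight hqun lkq hYT grY.quot hm
        have hnt : ∀ g ∈ Q e ∪ {e}, g ∉ Tch G W := by
          rintro g (hg | hg)
          · exact (hQA hg).2
          · rw [hg]; exact k1
        refine peel (W := W) (A' := A \ F) (I' := I) ?_ ?_ (fun i hi _ => hi) f4
        · have hE : (A \ (F ∪ (Q e ∪ {e}))) \ Tch G W = (A \ Tch G W) \ (Q e ∪ {e}) := by
            ext g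
            constructor
            · rintro ⟨⟨h1, h2⟩, h3⟩
              exact ⟨⟨h1, h3⟩, fun h => h2 (Or.inr h)⟩
            · rintro ⟨⟨h1, h3⟩, h2⟩
              refine ⟨⟨h1, ?_⟩, h3⟩
              rintro (h | h)
              · exact h3 (f5 h)
              · exact h2 h
          rw [hE]
          refine fun hh => ht (hh.mono ?_ subset_rfl)
          intro q hq
          refine ⟨?_, ?_⟩
          · rcases q with i | c
            · rw [inl_mem_QI] at hq ⊢; exact ⟨Or.inl hq.1, hq.2⟩
            · rw [inr_mem_QI] at hq ⊢; exact ⟨hq.1.1, hq.2⟩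
          · rintro rfl
            refine hFn _ ?_ hq
            ext g
            simp only [mem_inter_iff, mem_sdiff, mem_empty_iff_false, iff_false]
            rintro ⟨⟨_, h1⟩, h2⟩
            exact h1 (Or.inl h2)
        · ext g
          constructor
          · rintro ⟨⟨h1, h2⟩, h3⟩
            exact ⟨⟨h1, fun h => h2 (Or.inl h)⟩, h3⟩
          · rintro ⟨⟨h1, h2⟩, h3⟩
            refine ⟨⟨h1, ?_⟩, h3⟩
            rintro (h | h)
            · exact h2 h
            · exact hnt g h h3
      · refine union_subset (f5.trans (tch_mono hWW')) (union_subset ?_ ?_)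
        · intro g hg
          exact tch_mono sdiff_subset (ins_tch (lkq.ins e hm hg))
        · rintro g rfl
          exact cut_tch he.2
  · intro e he _
    have := hT e (cut_tch he.2)
    exact ⟨this.1.symm, this.2.symm⟩

variable (G σ A I T) in
/-- `z` lies in a set of finite deficiency -/
def FD (z : V) : Prop := ∃ X, z ∈ X ∧ Disjoint X T ∧ ∃ (C : Finset E) (u : E → ι) (P : E → Set E),
  Lk G σ (A \ C) I X u P

lemma St.absorb [Nonempty ι] {y : V} (S : St G σ A I T y) {z : V}
    (spare : ∀ U : Finset ι, ∃ j, j ∉ I ∧ j ∉ U ∧ σ j = z) (hz : FD G σ A I T z)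
    (hacc : ∃ F, Acc G σ A I T y S.W z F) : ∃ S' : St G σ A I T y, S.le S' ∧ z ∈ S'.W := by
  classical
  by_contra hcon
  push Not at hcon
  have key : ∀ n : ℕ, ∃ S' : St G σ A I T y, S.le S' ∧ ∃ J : Finset ι, J ⊆ S'.U ∧ J.card = n ∧
      ∀ j ∈ J, σ j = z := by
    intro n
    induction n with
    | zero => exact ⟨S, S.le_refl, ∅, by simp, by simp, by simp⟩
    | succ n ih =>
      obtain ⟨S', hS', J, h1, h2, h3⟩ := ih
      obtain ⟨j, hj1, hj2, hj3⟩ := spare S'.U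
      obtain ⟨F, hF⟩ := hacc
      obtain ⟨S'', k1, k2⟩ := S'.step hj1 hj2 (by rw [hj3]; exact hcon S' hS')
        ⟨F, by rw [hj3]; exact hF.mono hS'.2.1⟩
      refine ⟨S'', St.le_trans hS' k1, insert j J, ?_, ?_, ?_⟩
      · exact Finset.insert_subset k2 (h1.trans k1.1)
      · rw [Finset.card_insert_of_notMem (fun h => hj2 (h1 h)), h2]
      · intro i hi
        rcases Finset.mem_insert.1 hi with rfl | hi
        · exact hj3
        · exact h3 i hi
  obtain ⟨X, hzX, hXT, C, u, P, hL⟩ := hz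
  obtain ⟨S', hS', J, h1, h2, h3⟩ := key (C.card + 1)
  obtain ⟨X', hX', hH⟩ := HD (A := A) (I := I ∪ S'.U) C X u P J
    (hL.mono_units (fun e he => Or.inl (hL.mem e he))) (by
      intro j hj
      refine ⟨Or.inr (h1 hj), by rw [h3 j hj]; exact hzX, ?_⟩
      intro e he hue
      exact S'.hU j (h1 hj) (hue ▸ hL.mem e he)) (by omega)
  exact S'.unh ⟨X', hXT.mono_left hX', hH⟩

lemma St.absorb_finite [Nonempty ι] {y : V} (D : Finset V) : ∀ (S : St G σ A I T y),
    (∀ z, ∀ U : Finset ι, ∃ j, j ∉ I ∧ j ∉ U ∧ σ j = z) → (∀ z ∈ D, FD G σ A I T z) →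
    (∀ z ∈ D, ∃ F, Acc G σ A I T y S.W z F) →
    ∃ S' : St G σ A I T y, S.le S' ∧ ∀ z ∈ D, z ∈ S'.W := by
  classical
  induction D using Finset.induction_on with
  | empty => intro S _ _ _; exact ⟨S, S.le_refl, by simp⟩
  | insert z D hz ih =>
    intro S hsp hFD hacc
    obtain ⟨S1, h1, h2⟩ := ih S hsp (fun x hx => hFD x (by simp [hx])) (fun x hx => hacc x (by simp [hx]))
    obtain ⟨F, hF⟩ := hacc z (by simp)
    obtain ⟨S2, k1, k2⟩ := S1.absorb (hsp z) (hFD z (by simp)) ⟨F, hF.mono h1.2.1⟩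
    refine ⟨S2, St.le_trans h1 k1, ?_⟩
    intro x hx
    rcases Finset.mem_insert.1 hx with rfl | hx
    · exact k2
    · exact k1.2.1 (h2 x hx)

lemma PF0 [Nonempty ι] (hwf : WaveFree G σ A I T)
    (spare : ∀ z, ∀ U : Finset ι, ∃ j, j ∉ I ∧ j ∉ U ∧ σ j = z)
    (hFD : ∀ z, z ∉ T → FD G σ A I T z) (y : V) :
    ∃ F : Set E, F.Finite ∧ F ⊆ A ∧ (∃ z ∈ T, Conn G F y z) ∧ ¬ Hind G σ (A \ F) I T := by
  classical
  by_contra hcon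
  have hnacc : ∀ W z F, Acc G σ A I T y W z F → z ∉ T := by
    rintro W z F ⟨h1, h2, h3, h4, h5⟩ hz
    exact hcon ⟨F, h1, h2, ⟨z, hz, h3⟩, h4⟩
  have hyacc : ∀ W, Acc G σ A I T y W y ∅ := fun W => ⟨finite_empty, empty_subset _, Conn.refl _,
    by simpa using hwf.unhind, empty_subset _⟩
  -- next stage
  have next : ∀ S : St G σ A I T y, ∃ S' : St G σ A I T y, S.le S' ∧ y ∈ S'.W ∧
      ∀ e ∈ A ∩ G.cut S.W, S.u e ∈ S.U → out G S.W e ∈ S'.W := by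
    intro S
    have hfin : {e | e ∈ A ∩ G.cut S.W ∧ S.u e ∈ S.U}.Finite := by
      refine Set.Finite.of_finite_image (f := S.u) (S.U.finite_toSet.subset ?_) ?_
      · rintro _ ⟨e, he, rfl⟩; exact he.2
      · intro e he f hf hef; exact S.lk.inj e he.1 f hf.1 hef
    have hacc : ∀ z ∈ insert y ((hfin.image (out G S.W)).toFinset),
        ∃ F, Acc G σ A I T y S.W z F := by
      intro z hz
      rcases Finset.mem_insert.1 hz with rfl | hz
      · exact ⟨∅, hyacc _⟩
      · rw [Set.Finite.mem_toFinset] at hz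
        obtain ⟨e, he, rfl⟩ := hz
        obtain ⟨F, _, hF⟩ := S.acc2 e he.1 he.2
        exact ⟨F, hF⟩
    obtain ⟨S', h1, h2⟩ := St.absorb_finite (insert y ((hfin.image (out G S.W)).toFinset)) S spare
      (fun z hz => by obtain ⟨F, hF⟩ := hacc z hz; exact hFD z (hnacc _ _ _ hF)) hacc
    refine ⟨S', h1, h2 y (by simp), ?_⟩
    intro e he heU
    refine h2 _ (Finset.mem_insert_of_mem ?_)
    rw [Set.Finite.mem_toFinset]
    exact ⟨e, ⟨he, heU⟩, rfl⟩
  -- initial stage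
  obtain ⟨W0, hW0⟩ := exists_greatest G σ A I T
  have hW0e : W0 = ∅ := hwf W0 hW0.1
  obtain ⟨u0, P0, hL0⟩ := hW0.1.2
  have S0 : St G σ A I T y := by
    refine ⟨∅, W0, u0, P0, by simp, ?_, ?_, ?_, by simp, by simp⟩
    · simpa using hwf.unhind
    · simpa using hW0
    · simpa using hL0
  choose nx hnx using next
  let S : ℕ → St G σ A I T y := fun n => Nat.rec S0 (fun _ s => nx s) n
  have hS : ∀ n, S (n + 1) = nx (S n) := fun n => rfl
  have hmono : ∀ n m, n ≤ m → (S n).le (S m) := by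
    intro n m h
    induction h with
    | refl => exact St.le_refl _
    | step _ ih => exact St.le_trans ih (by rw [Nat.succ_eq_add_one, hS]; exact (hnx _).1)
  let b : ℕ → BL G σ A univ T := fun n => ⟨(S n).W, (S n).u, (S n).P, (S n).gr.1.1,
    (S n).lk.mono_units (fun _ _ => mem_univ _)⟩
  have hb : ∀ n m, n ≤ m → (b n).le (b m) := fun n m h => (hmono n m h).2
  obtain ⟨ub, hubX, hub⟩ := BL.chain_ub (range b) (by
    rintro _ ⟨n, rfl⟩ _ ⟨m, rfl⟩ _
    rcases le_total n m with h | h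
    · exact Or.inl (hb n m h)
    · exact Or.inr (hb m n h))
  have hsub : ∀ n, (S n).W ⊆ ub.X := fun n => (hub (b n) ⟨n, rfl⟩).1
  have hy : y ∈ ub.X := hsub 1 (by rw [show (1 : ℕ) = 0 + 1 from rfl, hS]; exact (hnx _).2.1)
  have : ub.X = ∅ := by
    refine hwf _ ⟨ub.dis, ub.u, ub.P, ub.lk.mono_units ?_⟩
    intro e he
    have h1 := inc_eq he.2
    have h2 : ∀ x ∈ ub.X, ∃ n, x ∈ (S n).W := by
      intro x hx
      rw [hubX] at hx
      simp only [mem_iUnion, mem_range, exists_prop, exists_exists_eq_and] at hx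
      exact hx
    obtain ⟨n, hn⟩ := h2 _ h1.2.1
    have h3 := cut_sub_inn (hsub n) he.2 hn
    have h4 := (hub (b n) ⟨n, rfl⟩).2 e ⟨he.1, h3.1⟩ he.2
    change (S n).u e = _ ∧ _ at h4
    rw [← h4.1]
    rcases (S n).lk.mem e ⟨he.1, h3.1⟩ with h5 | h5
    · exact h5
    · exfalso
      have h6 := (hnx (S n)).2.2 e ⟨he.1, h3.1⟩ h5
      rw [← hS] at h6
      have h7 := inc_eq h3.1
      have : out G (S n).W e = out G ub.X e := by
        rw [h3.2, h1.1] at h7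
        rcases Sym2.eq_iff.1 h7.1 with h | h
        · exact h.2.symm
        · exact (h.2.trans h.1).symm
      rw [this] at h6
      exact h1.2.2 (hsub (n + 1) h6)
  rw [this] at hy
  exact hy

end EM



namespace EM
open Set Relation

universe w w'
variable {V : Type u} {E : Type v} {G : Multigraph V E}
variable {ι : Type w} {σ : ι → V} {A : Set E} {I : Set ι} {T : Set V}

lemma Lk.map {ι' : Type w'} {σ' : ι' → V} {φ : ι → ι'} (hφ : Function.Injective φ)
    (hσ : ∀ i, σ' (φ i) = σ i) {X : Set V} {u : E → ι} {P : E → Set E} (h : Lk G σ A I X u P) :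
    Lk G σ' A (φ '' I) X (fun e => φ (u e)) P where
  mem e he := ⟨_, h.mem e he, rfl⟩
  fin := h.fin
  sub := h.sub
  ins := h.ins
  conn e he := by rw [hσ]; exact h.conn e he
  inj e he f hf hef := h.inj e he f hf (hφ hef)
  disj := h.disj

lemma Lk.unmap [Nonempty ι] {ι' : Type w'} {σ' : ι' → V} {φ : ι → ι'}
    (hσ : ∀ i, σ' (φ i) = σ i) {X : Set V} {u : E → ι'} {P : E → Set E}
    (h : Lk G σ' A (φ '' I) X u P) :
    ∃ u' : E → ι, Lk G σ A I X u' P ∧ ∀ e ∈ A ∩ G.cut X, φ (u' e) = u e := by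
  have : ∀ e, ∃ i, e ∈ A ∩ G.cut X → i ∈ I ∧ φ i = u e := by
    intro e
    by_cases he : e ∈ A ∩ G.cut X
    · obtain ⟨i, hi⟩ := h.mem e he
      exact ⟨i, fun _ => hi⟩
    · exact ⟨Classical.arbitrary ι, fun h => absurd h he⟩
  choose u' hu' using this
  refine ⟨u', ⟨fun e he => (hu' e he).1, h.fin, h.sub, h.ins, ?_, ?_, h.disj⟩,
    fun e he => (hu' e he).2⟩
  · intro e he
    rw [← hσ, (hu' e he).2]; exact h.conn e he
  · intro e he f hf hef
    apply h.inj e he f hf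
    rw [← (hu' e he).2, ← (hu' f hf).2, hef]

lemma Hind.map {ι' : Type w'} {σ' : ι' → V} {φ : ι → ι'} (hφ : Function.Injective φ)
    (hσ : ∀ i, σ' (φ i) = σ i) (h : Hind G σ A I T) : Hind G σ' A (φ '' I) T := by
  obtain ⟨X, hX, u, P, i, hL, hi, hiX, hs⟩ := h
  exact ⟨X, hX, _, P, φ i, hL.map hφ hσ, ⟨i, hi, rfl⟩, by rw [hσ]; exact hiX,
    fun e he hh => hs e he (hφ hh)⟩

lemma WaveFree.map [Nonempty ι] {ι' : Type w'} {σ' : ι' → V} {φ : ι → ι'}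
    (hσ : ∀ i, σ' (φ i) = σ i) (h : WaveFree G σ A I T) : WaveFree G σ' A (φ '' I) T := by
  rintro X ⟨hX, u, P, hL⟩
  obtain ⟨u', hL', -⟩ := hL.unmap hσ
  exact h X ⟨hX, u', P, hL'⟩

lemma PF [Nonempty ι] (hwf : WaveFree G σ A I T)
    (hFD : ∀ z, z ∉ T → FD G σ A I T z) (y : V) :
    ∃ F : Set E, F.Finite ∧ F ⊆ A ∧ (∃ z ∈ T, Conn G F y z) ∧ ¬ Hind G σ (A \ F) I T := by
  classical
  let σ' : ι ⊕ (V × ℕ) → V := Sum.elim σ Prod.fst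
  have hσ : ∀ i, σ' (Sum.inl i) = σ i := fun i => rfl
  obtain ⟨F, h1, h2, h3, h4⟩ := PF0 (σ := σ') (I := Sum.inl '' I) (hwf.map hσ) (by
    intro z U
    obtain ⟨n, hn⟩ := Infinite.exists_notMem_finset (U.preimage (fun n : ℕ => (Sum.inr (z, n) : ι ⊕ (V × ℕ)))
      (by intro a _ b _ h; simpa using h))
    refine ⟨Sum.inr (z, n), by simp, fun h => hn (Finset.mem_preimage.2 h), rfl⟩) (by
    intro z hz
    obtain ⟨X, h1, h2, C, u, P, hL⟩ := hFD z hz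
    exact ⟨X, h1, h2, C, _, P, hL.map Sum.inl_injective hσ⟩) y
  exact ⟨F, h1, h2, h3, fun h => h4 (h.map Sum.inl_injective hσ)⟩

end EM



namespace EM
open Set Relation

universe w
variable {V : Type u} {E : Type v} {G : Multigraph V E}
variable {ι : Type w} {σ : ι → V} {A : Set E} {I : Set ι} {T : Set V}

lemma exists_seq (B : Set V) (Op : Set V → Set V) : ∃ R : Ordinal.{u} → Set V,
    ∀ ξ, R ξ = {v | v ∈ B ∧ ∀ η < ξ, v ∈ Op (R η)} := by
  refine ⟨WellFounded.fix (Ordinal.lt_wf) (fun ξ f => {v | v ∈ B ∧ ∀ η (h : η < ξ), v ∈ Op (f η h)}), ?_⟩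
  intro ξ
  rw [WellFounded.fix_eq]

lemma FD_of_Lk {C : Set E} (hC : C.Finite) {X : Set V} (hX : Disjoint X T) {u : E → ι} {P : E → Set E}
    (hL : Lk G σ (A \ C) I X u P) {z : V} (hz : z ∈ X) : FD G σ A I T z := by
  refine ⟨X, hz, hX, hC.toFinset, u, P, ?_⟩
  simpa using hL

/-- peeling relative to vertices of infinite deficiency -/
lemma peelR {B R Ω : Set V} {F0 F1 : Set E} (hB : ∀ z, z ∉ T → FD G σ A I T z → z ∉ B)
    (hR : R ⊆ B) (hΩ : Disjoint Ω B) (hF1 : F1.Finite) (h01 : F0 ⊆ F1)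
    (hd : ∀ f ∈ F1, f ∉ F0 → f ∉ Tch G Ω) (hun : ¬ Hind G σ (A \ F0) I T)
    (hq : ¬ Hind G (Qs G σ Ω) (((A \ Tch G R) \ Tch G Ω) \ F1) (QI G σ ((A \ Tch G R) \ F0) I Ω)
      (T ∪ B ∪ Ω)) : ¬ Hind G σ (A \ F1) I T := by
  rintro ⟨X, hX, hH⟩
  have hXB : ∀ z ∈ X, z ∉ B := by
    intro z hz
    obtain ⟨u, P, i, hL, -⟩ := hH
    exact hB z (Set.disjoint_left.1 hX hz) (FD_of_Lk hF1 hX hL hz)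
  have hcore : HindAt G σ (A \ F1) I (X ∩ Ω) := by
    refine Q2h hH ?_
    rintro ⟨u, P, j, hL, hj, hjX, hs⟩
    have hun' : ∀ j ∈ QI G σ (A \ F1) I Ω, Qs G σ Ω j ∈ X \ Ω → j ∈ QI G σ ((A \ Tch G R) \ F0) I Ω := by
      rintro (i | c) hj hjX
      · rw [inl_mem_QI] at hj ⊢; exact hj
      · rw [inr_mem_QI] at hj ⊢
        obtain ⟨h1, h2, h3⟩ := inc_eq hj.2
        refine ⟨⟨⟨hj.1.1, ?_⟩, fun h => hj.1.2 (h01 h)⟩, hj.2⟩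
        rw [tch_iff h1]
        rintro (h | h)
        · exact Set.disjoint_left.1 hΩ h2 (hR h)
        · exact hXB _ hjX.1 (hR h)
    have hAA : ((A \ Tch G R) \ Tch G Ω) \ F1 ⊆ (A \ F1) \ Tch G Ω := by
      rintro e ⟨⟨⟨h1, h2⟩, h3⟩, h4⟩
      exact ⟨⟨h1, h4⟩, h3⟩
    refine hq ⟨X \ Ω, ?_, u, P, j, hL.restrict ?_, hun' j hj hjX, hjX, ?_⟩
    · rw [disjoint_union_right, disjoint_union_right]
      exact ⟨⟨hX.mono_left sdiff_subset, Set.disjoint_left.2 fun z hz => hXB z hz.1⟩, disjoint_sdiff_left⟩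
    · intro e he
      have he' : e ∈ ((A \ F1) \ Tch G Ω) ∩ G.cut (X \ Ω) := ⟨hAA he.1, he.2⟩
      refine ⟨he'.1, ?_, hun' _ (hL.mem e he') (hL.start he')⟩
      intro g hg
      have h1 := hL.sub e he' hg
      have h2 := hL.ins e he' hg
      refine ⟨⟨⟨h1.1.1, ?_⟩, h1.2⟩, h1.1.2⟩
      rintro ⟨x, hx, hxR⟩
      exact hXB x (h2 x hx).1 (hR hxR)
    · intro e he
      exact hs e ⟨hAA he.1, he.2⟩
  obtain ⟨u, P, i, hL, hi, hiX, hs⟩ := hcore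
  have hAA : ∀ e, e ∈ A \ F0 → e ∈ Tch G Ω → e ∈ A \ F1 := fun e h1 h2 =>
    ⟨h1.1, fun h => hd e h h1.2 h2⟩
  refine hun ⟨X ∩ Ω, hX.mono_left inter_subset_left, u, P, i, hL.restrict ?_, hi, hiX, ?_⟩
  · intro e he
    have he' : e ∈ (A \ F1) ∩ G.cut (X ∩ Ω) :=
      ⟨hAA e he.1 (tch_mono inter_subset_right (cut_tch he.2)), he.2⟩
    exact ⟨he'.1, fun g hg => ⟨(hL.sub e he' hg).1, fun h => (hL.sub e he' hg).2 (h01 h)⟩, hL.mem e he'⟩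
  · intro e he
    exact hs e ⟨hAA e he.1 (tch_mono inter_subset_right (cut_tch he.2)), he.2⟩

/-- transfer of finite deficiency to the quotient -/
lemma FD_quot {B R Ω : Set V} {F0 : Set E} (hB : ∀ z, z ∉ T → FD G σ A I T z → z ∉ B)
    (hR : R ⊆ B) (hΩ : Disjoint Ω B) (hF0 : F0.Finite) {z : V} (hz : FD G σ A I T z) (hzΩ : z ∉ Ω) :
    FD G (Qs G σ Ω) ((A \ Tch G R) \ Tch G Ω) (QI G σ ((A \ Tch G R) \ F0) I Ω) (T ∪ B ∪ Ω) z := by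
  obtain ⟨X, hzX, hX, C, u, P, hL⟩ := hz
  have hXB : ∀ z ∈ X, z ∉ B := by
    intro z hz
    exact hB z (Set.disjoint_left.1 hX hz) (FD_of_Lk C.finite_toSet hX hL hz)
  obtain ⟨v, hv, -⟩ := Q2 hL Ω
  set Q := fun e => P e \ Tch G Ω
  set D : Set E := {e | e ∈ ((A \ C) \ Tch G Ω) ∩ G.cut (X \ Ω) ∧ v e ∈ Sum.inr '' F0} with hD
  have hDf : D.Finite := by
    refine Set.Finite.of_finite_image (f := v) ((hF0.image Sum.inr).subset ?_) ?_
    · rintro _ ⟨e, he, rfl⟩; exact he.2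
    · intro e he f hf hef; exact hv.inj e he.1 f hf.1 hef
  refine FD_of_Lk (C := C ∪ D) (C.finite_toSet.union hDf) (X := X \ Ω) ?_ (u := v) (P := Q)
    (hv.restrict ?_) ⟨hzX, hzΩ⟩
  · rw [disjoint_union_right, disjoint_union_right]
    exact ⟨⟨hX.mono_left sdiff_subset, Set.disjoint_left.2 fun z hz => hXB z hz.1⟩, disjoint_sdiff_left⟩
  · rintro e ⟨⟨⟨⟨h1, h2⟩, h3⟩, h4⟩, h5⟩
    have he' : e ∈ ((A \ C) \ Tch G Ω) ∩ G.cut (X \ Ω) := ⟨⟨⟨h1, fun h => h4 (Or.inl h)⟩, h3⟩, h5⟩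
    refine ⟨he'.1, ?_, ?_⟩
    · intro g hg
      have k1 := hv.sub e he' hg
      have k2 := hv.ins e he' hg
      refine ⟨⟨⟨k1.1.1, ?_⟩, k1.2⟩, ?_⟩
      · rintro ⟨x, hx, hxR⟩
        exact hXB x (k2 x hx).1 (hR hxR)
      · rintro (h | h)
        · exact k1.1.2 h
        · exact ins_not_cut k2 h.1.2
    · have hj := hv.mem e he'
      have hjX := hv.start he'
      have hnD : v e ∉ Sum.inr '' F0 := fun h => h4 (Or.inr ⟨he', h⟩)
      rcases hve : v e with i | c
      · rw [hve, inl_mem_QI] at hj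
        rw [inl_mem_QI]; exact hj
      · rw [hve] at hj hjX hnD
        rw [inr_mem_QI] at hj ⊢
        obtain ⟨h1, h2, h3⟩ := inc_eq hj.2
        refine ⟨⟨⟨hj.1.1, ?_⟩, fun h => hnD ⟨c, h, rfl⟩⟩, hj.2⟩
        rw [tch_iff h1]
        rintro (h | h)
        · exact Set.disjoint_left.1 hΩ h2 (hR h)
        · exact hXB _ hjX.1 (hR h)

lemma conn_not_tch {F : Set E} {W : Set V} {a b : V} (h : Conn G F a b) (hF : ∀ f ∈ F, f ∉ Tch G W)
    (ha : a ∉ W) : b ∉ W := by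
  induction h with
  | refl => exact ha
  | tail _ h2 ih =>
    obtain ⟨e, he, hh⟩ := h2
    intro hb
    exact hF e he ((tch_iff hh).2 (Or.inr hb))

/-- safe paths in wave free webs -/
theorem RA [Nonempty ι] (hwf : WaveFree G σ A I T) (y : V) :
    ∃ F : Set E, F.Finite ∧ F ⊆ A ∧ (∃ z ∈ T, Conn G F y z) ∧ ¬ Hind G σ (A \ F) I T := by
  classical
  set B : Set V := {z | z ∉ T ∧ ¬ FD G σ A I T z} with hBdef
  have hB : ∀ z, z ∉ T → FD G σ A I T z → z ∉ B := fun z _ h1 h2 => h2.2 h1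
  have hBT : ∀ z ∈ B, z ∉ T := fun z h => h.1
  have hex : ∀ R : Set V, ∃ W, Greatest G σ (A \ Tch G R) I (T ∪ B) W := fun R => exists_greatest _ _ _ _ _
  choose Om hOm using hex
  have hOmB : ∀ R, Disjoint (Om R) B := fun R => (hOm R).1.1.mono_right subset_union_right
  have hOmT : ∀ R, Disjoint (Om R) T := fun R => (hOm R).1.1.mono_right subset_union_left
  obtain ⟨R, hR⟩ := exists_seq B
    (fun R => {v | v ∈ R ∧ ∀ e ∈ A, ∀ w, G.inc e = s(v, w) → w ∈ R ∪ Om R})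
  have hRB : ∀ ξ, R ξ ⊆ B := by
    intro ξ v hv; rw [hR] at hv; exact hv.1
  have hanti : ∀ η ξ, η ≤ ξ → R ξ ⊆ R η := by
    intro η ξ h v hv
    rw [hR] at hv ⊢
    exact ⟨hv.1, fun ζ hζ => hv.2 ζ (hζ.trans_le h)⟩
  have hOanti : ∀ η ξ, η ≤ ξ → Om (R ξ) ⊆ Om (R η) := by
    intro η ξ h
    obtain ⟨h1, u, P, h2⟩ := (hOm (R ξ)).1
    refine (hOm (R η)).2 _ ⟨h1, u, P, h2.restrict ?_⟩
    rintro e ⟨he1, he2⟩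
    have he' : e ∈ (A \ Tch G (R ξ)) ∩ G.cut (Om (R ξ)) := by
      refine ⟨⟨he1.1, fun hh => he1.2 (tch_mono (hanti η ξ h) hh)⟩, he2⟩
    refine ⟨he'.1, ?_, h2.mem e he'⟩
    intro g hg
    refine ⟨(h2.sub e he' hg).1, ?_⟩
    rintro ⟨x, hx, hxR⟩
    exact Set.disjoint_left.1 (hOmB (R ξ)) (h2.ins e he' hg x hx) (hRB _ hxR)
  -- stability
  have hstab : ∀ ξ, (∀ v ∈ R ξ, ∀ e ∈ A, ∀ w, G.inc e = s(v, w) → w ∈ R ξ ∪ Om (R ξ)) →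
      R ξ = ∅ := by
    intro ξ h
    obtain ⟨h1, u, P, h2⟩ := (hOm (R ξ)).1
    have : R ξ ∪ Om (R ξ) = ∅ := by
      refine hwf _ ⟨?_, u, P, ?_⟩
      · rw [disjoint_union_left]
        exact ⟨Set.disjoint_left.2 fun z hz => hBT z (hRB _ hz), hOmT _⟩
      · have key : ∀ e ∈ A ∩ G.cut (R ξ ∪ Om (R ξ)), e ∈ (A \ Tch G (R ξ)) ∩ G.cut (Om (R ξ)) ∧
            inn G (R ξ ∪ Om (R ξ)) e = inn G (Om (R ξ)) e := by
          rintro e ⟨he1, he2⟩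
          rcases cut_union_cases he2 with ⟨k1, k2, k3⟩ | ⟨k1, k2, k3⟩
          · exfalso
            obtain ⟨g1, g2, g3⟩ := inc_eq k2
            obtain ⟨x, y, hxy, hx, hy⟩ := he2
            rw [tch_iff hxy] at k1
            rcases k1 with k1 | k1
            · exact hy (h x k1 e he1 y hxy)
            · exact hy (Or.inl k1)
          · exact ⟨⟨⟨he1, k1⟩, k2⟩, k3⟩
        refine ⟨fun e he => h2.mem e (key e he).1, fun e he => h2.fin e (key e he).1,
          fun e he => (h2.sub e (key e he).1).trans sdiff_subset,
          fun e he => (h2.ins e (key e he).1).trans (ins_mono subset_union_right),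
          fun e he => by rw [(key e he).2]; exact h2.conn e (key e he).1,
          fun e he f hf => h2.inj e (key e he).1 f (key f hf).1,
          fun e he f hf => h2.disj e (key e he).1 f (key f hf).1⟩
    exact (union_empty_iff.1 this).1
  have hend : ∃ ξ, R ξ = ∅ := by
    by_contra hcon
    push Not at hcon
    have : ∀ ξ, ∃ v ∈ R ξ, v ∉ R (Order.succ ξ) := by
      intro ξ
      by_contra hc
      push Not at hc
      refine (hcon ξ).ne_empty (hstab ξ ?_)
      intro v hv
      have := hc v hv
      rw [hR] at this
      exact (this.2 ξ (Order.lt_succ ξ)).2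
    choose f hf1 hf2 using this
    refine not_injective_of_ordinal f ?_
    intro a b hab
    by_contra hne
    rcases lt_or_gt_of_ne hne with h | h
    · exact hf2 a (by rw [hab]; exact hanti _ _ (Order.succ_le_of_lt h) (hf1 b))
    · exact hf2 b (by rw [← hab]; exact hanti _ _ (Order.succ_le_of_lt h) (hf1 a))
  -- conclusion predicate
  let Con : Set E → V → Prop := fun F0 p => ∃ F : Set E, F.Finite ∧ F ⊆ A ∧ Disjoint F F0 ∧
    (∃ z ∈ T, Conn G F p z) ∧ ¬ Hind G σ (A \ (F0 ∪ F)) I T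
  have hstmt : ∀ η : Ordinal.{u}, ∀ p, p ∉ Om (R η) ∪ R η → ∀ F0 : Set E, F0.Finite →
      F0 ⊆ Tch G (Om (R η) ∪ R η) → ¬ Hind G σ (A \ F0) I T → Con F0 p := by
    intro η
    induction η using WellFoundedLT.induction with
    | ind η ih =>
    set Y : Set V := {q | q ∉ T ∪ B ∧ ∀ η' < η, q ∈ Om (R η')} with hY
    set Z : Set V := Om (R η) ∪ R η ∪ Y with hZ
    have hZsub : ∀ η' < η, Z ⊆ Om (R η') ∪ R η' := by
      rintro η' h z ((hz | hz) | hz)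
      · exact Or.inl (hOanti _ _ h.le hz)
      · exact Or.inr (hanti _ _ h.le hz)
      · exact Or.inl (hz.2 _ h)
    have descend : ∀ q, q ∉ Z → ∀ F0 : Set E, F0.Finite → F0 ⊆ Tch G Z → ¬ Hind G σ (A \ F0) I T →
        Con F0 q := by
      intro q hq F0 hF0 hF0Z hun
      by_cases hqT : q ∈ T
      · exact ⟨∅, finite_empty, empty_subset _, empty_disjoint _, ⟨q, hqT, Conn.refl _⟩, by simpa using hun⟩
      by_cases hqB : q ∈ B
      · have hqR : q ∉ R η := fun h => hq (Or.inl (Or.inr h))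
        rw [hR] at hqR
        have hex : ∃ η', η' < η ∧ ¬ (q ∈ R η' ∧ ∀ e ∈ A, ∀ w, G.inc e = s(q, w) → w ∈ R η' ∪ Om (R η')) := by
          by_contra hc
          push Not at hc
          exact hqR ⟨hqB, fun η' h => hc η' h⟩
        obtain ⟨η', ⟨h1, h2⟩, hmin⟩ := WellFounded.has_min (Ordinal.lt_wf)
          {η' | η' < η ∧ ¬ (q ∈ R η' ∧ ∀ e ∈ A, ∀ w, G.inc e = s(q, w) → w ∈ R η' ∪ Om (R η'))} hex
        have hqR' : q ∈ R η' := by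
          rw [hR]
          refine ⟨hqB, fun ζ hζ => ?_⟩
          by_contra hc
          exact hmin ζ ⟨hζ.trans h1, hc⟩ hζ
        have : ∃ e ∈ A, ∃ w, G.inc e = s(q, w) ∧ w ∉ R η' ∪ Om (R η') := by
          by_contra hc
          push Not at hc
          exact h2 ⟨hqR', hc⟩
        obtain ⟨e, heA, w, hew, hw⟩ := this
        have heF0 : e ∉ F0 := by
          intro h
          have := hF0Z h
          rw [tch_iff hew] at this
          rcases this with h | h
          · exact hq h
          · rcases hZsub η' h1 h with h | h
            · exact hw (Or.inr h)
            · exact hw (Or.inl h)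
        have heΩ : e ∉ Tch G (Om (R η')) := by
          rw [tch_iff hew]
          rintro (h | h)
          · exact Set.disjoint_left.1 (hOmB _) h hqB
          · exact hw (Or.inr h)
        have hF0' : F0 ∪ {e} ⊆ Tch G (Om (R η') ∪ R η') := by
          rintro f (hf | hf)
          · exact tch_mono (hZsub η' h1) (hF0Z hf)
          · rw [hf]; exact (tch_iff hew).2 (Or.inl (Or.inr hqR'))
        have hun' : ¬ Hind G σ (A \ (F0 ∪ {e})) I T := by
          refine peelR (B := B) (R := R η') (Ω := Om (R η')) hB (hRB _) (hOmB _)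
            (hF0.union (finite_singleton e)) subset_union_left ?_ hun ?_
          · rintro f (hf | hf) hf'
            · exact absurd hf hf'
            · rw [hf]; exact heΩ
          · have hw := (hOm (R η')).quot
            have hEq : ((A \ Tch G (R η')) \ Tch G (Om (R η'))) \ (F0 ∪ {e}) =
                (A \ Tch G (R η')) \ Tch G (Om (R η')) := by
              refine sdiff_eq_left.2 (Set.disjoint_left.2 ?_)
              rintro g ⟨⟨_, g1⟩, g2⟩ g3
              obtain ⟨x, hx, hx' | hx'⟩ := hF0' g3
              · exact g2 ⟨x, hx, hx'⟩
              · exact g1 ⟨x, hx, hx'⟩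
            rw [hEq]
            refine (hw.sub ?_).unhind
            rintro (i | c) hj
            · rw [inl_mem_QI] at hj ⊢; exact hj
            · rw [inr_mem_QI] at hj ⊢; exact ⟨hj.1.1, hj.2⟩
        obtain ⟨F, f1, f2, f3, ⟨z, hz, f4⟩, f5⟩ := ih η' h1 w (fun h => hw h.symm) (F0 ∪ {e})
          (hF0.union (finite_singleton e)) hF0' hun'
        rw [disjoint_union_right] at f3
        refine ⟨F ∪ {e}, f1.union (finite_singleton e), union_subset f2 (by simpa using heA), ?_,
          ⟨z, hz, Conn.trans (Conn.single (F := F ∪ {e}) (Or.inr rfl) hew) (f4.mono subset_union_left)⟩, ?_⟩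
        · rw [disjoint_union_left]; exact ⟨f3.1, by simpa using heF0⟩
        · have : F0 ∪ {e} ∪ F = F0 ∪ (F ∪ {e}) := by rw [union_assoc, union_comm {e}]
          rw [← this]; exact f5
      · have hqY : q ∉ Y := fun h => hq (Or.inr h)
        have : ∃ η' < η, q ∉ Om (R η') := by
          by_contra hc
          push Not at hc
          exact hqY ⟨fun h => h.elim hqT hqB, hc⟩
        obtain ⟨η', h1, h2⟩ := this
        exact ih η' h1 q (fun h => h.elim h2 (fun h => hqB (hRB _ h))) F0 hF0
          (hF0Z.trans (tch_mono (hZsub η' h1))) hun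
    intro p hp F0 hF0 hF0s hun
    by_cases hpY : p ∉ Y
    · exact descend p (fun h => h.elim hp hpY) F0 hF0 (hF0s.trans (tch_mono subset_union_left)) hun
    push Not at hpY
    have hwfq := (hOm (R η)).quot
    have hsubQ : QI G σ ((A \ Tch G (R η)) \ F0) I (Om (R η)) ⊆ QI G σ (A \ Tch G (R η)) I (Om (R η)) := by
      rintro (i | c) hj
      · rw [inl_mem_QI] at hj ⊢; exact hj
      · rw [inr_mem_QI] at hj ⊢; exact ⟨hj.1.1, hj.2⟩
    obtain ⟨Fp, g1, g2, ⟨z, hz, g3⟩, g4⟩ := PF (hwfq.sub hsubQ) (by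
      intro z hz
      have hzT : z ∉ T := fun h => hz (Or.inl (Or.inl h))
      have hzB : z ∉ B := fun h => hz (Or.inl (Or.inr h))
      have hzO : z ∉ Om (R η) := fun h => hz (Or.inr h)
      refine FD_quot hB (hRB _) (hOmB _) hF0 ?_ hzO
      by_contra hc
      exact hzB ⟨hzT, hc⟩) p
    have hzO : z ∉ Om (R η) := conn_not_tch g3 (fun f hf => (g2 hf).2) (fun h => hp (Or.inl h))
    have hzY : z ∉ Y := by
      intro h
      rcases hz with hz | hz
      · exact h.1 hz
      · exact hzO hz
    obtain ⟨c, hc, g5⟩ := firstexit g3 hpY hzY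
    obtain ⟨c1, c2, c3⟩ := inc_eq hc.2
    set F : Set E := (Fp ∩ Ins G Y) ∪ {c} with hFdef
    have hFFp : F ⊆ Fp := union_subset inter_subset_left (by simpa using hc.1)
    have hFY : F ⊆ Tch G Y := union_subset (fun f hf => ins_tch hf.2) (by simpa using cut_tch hc.2)
    have hFn : ∀ f ∈ F, f ∉ Tch G (Om (R η) ∪ R η) := by
      rintro f hf ⟨x, hx, hx' | hx'⟩
      · exact (g2 (hFFp hf)).2 ⟨x, hx, hx'⟩
      · exact (g2 (hFFp hf)).1.2 ⟨x, hx, hx'⟩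
    have hFc : Conn G F p (out G Y c) :=
      (g5.mono subset_union_left).trans (Conn.single (Or.inr rfl) c1)
    have hFf : F.Finite := g1.subset hFFp
    have hun' : ¬ Hind G σ (A \ (F0 ∪ F)) I T := by
      refine peelR (B := B) (R := R η) (Ω := Om (R η)) hB (hRB _) (hOmB _)
            (hF0.union hFf) subset_union_left ?_ hun ?_
      · rintro f (hf | hf) hf'
        · exact absurd hf hf'
        · exact fun h => hFn f hf (tch_mono subset_union_left h)
      · have hEq : ((A \ Tch G (R η)) \ Tch G (Om (R η))) \ (F0 ∪ F) =
            ((A \ Tch G (R η)) \ Tch G (Om (R η))) \ F := by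
          ext g
          constructor
          · rintro ⟨k1, k2⟩; exact ⟨k1, fun h => k2 (Or.inr h)⟩
          · rintro ⟨k1, k2⟩
            refine ⟨k1, ?_⟩
            rintro (h | h)
            · obtain ⟨x, hx, hx' | hx'⟩ := hF0s h
              · exact k1.2 ⟨x, hx, hx'⟩
              · exact k1.1.2 ⟨x, hx, hx'⟩
            · exact k2 h
        rw [hEq]
        refine unhind_add_finite (F := Fp) g1 ?_
        have : (((A \ Tch G (R η)) \ Tch G (Om (R η))) \ F) \ Fp =
            ((A \ Tch G (R η)) \ Tch G (Om (R η))) \ Fp := by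
          rw [Set.sdiff_sdiff, union_eq_right.2 hFFp]
        rw [this]
        exact g4
    have hqn : out G Y c ∉ Z := by
      intro h
      rcases h with h | h
      · exact hFn c (Or.inr rfl) ((tch_iff c1).2 (Or.inr h))
      · exact c3 h
    obtain ⟨F', f1, f2, f3, ⟨t, ht, f4⟩, f5⟩ := descend _ hqn (F0 ∪ F) (hF0.union hFf)
      (union_subset (hF0s.trans (tch_mono subset_union_left)) (hFY.trans (tch_mono subset_union_right))) hun'
    rw [disjoint_union_right] at f3
    refine ⟨F ∪ F', hFf.union f1, union_subset (fun f hf => (g2 (hFFp hf)).1.1) f2, ?_,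
      ⟨t, ht, (hFc.mono subset_union_left).trans (f4.mono subset_union_right)⟩, ?_⟩
    · rw [disjoint_union_left]
      exact ⟨Set.disjoint_left.2 fun f hf hf0 => hFn f hf (hF0s hf0), f3.1⟩
    · rw [← union_assoc]; exact f5
  obtain ⟨ξ, hξ⟩ := hend
  have hO : Om (R ξ) = ∅ := by
    obtain ⟨h1, u, P, h2⟩ := (hOm (R ξ)).1
    refine hwf _ ⟨hOmT _, u, P, ?_⟩
    have : A \ Tch G (R ξ) = A := by
      rw [hξ]
      refine sdiff_eq_left.2 (Set.disjoint_left.2 ?_)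
      rintro e _ ⟨x, _, hx⟩
      exact hx
    rw [this] at h2
    exact h2
  obtain ⟨F, h1, h2, _, h3, h4⟩ := hstmt ξ y (by rw [hO, hξ]; simp) ∅ finite_empty (empty_subset _)
    (by simpa using hwf.unhind)
  exact ⟨F, h1, h2, h3, by simpa using h4⟩

/-- Safe path lemma -/
theorem SPL [Nonempty ι] (hun : ¬ Hind G σ A I T) {i0 : ι} (hi0 : i0 ∈ I) :
    ∃ F : Set E, F.Finite ∧ F ⊆ A ∧ (∃ z ∈ T, Conn G F (σ i0) z) ∧ ¬ Hind G σ (A \ F) (I \ {i0}) T := by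
  obtain ⟨W, hW⟩ := exists_greatest G σ A (I \ {i0}) T
  have hiW : σ i0 ∉ W := by
    intro h
    obtain ⟨h1, u, P, hL⟩ := hW.1
    exact hun ⟨W, h1, u, P, i0, hL.mono_units (fun e he => (hL.mem e he).1), hi0, h,
      fun e he => (hL.mem e he).2⟩
  obtain ⟨F, h1, h2, ⟨z, hz, h3⟩, h4⟩ := RA hW.quot (σ i0)
  have hzW : z ∉ W := conn_not_tch h3 (fun f hf => (h2 hf).2) hiW
  refine ⟨F, h1, h2.trans sdiff_subset, ⟨z, hz.resolve_right hzW, h3⟩, ?_⟩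
  refine peel (W := W) (A' := A) (I' := I) ?_ ?_ (fun i hi _ => hi.1) hun
  · have hA : (A \ F) \ Tch G W = (A \ Tch G W) \ F := by
      rw [Set.sdiff_sdiff, Set.sdiff_sdiff, union_comm]
    rw [hA]
    refine fun hh => h4 (hh.mono ?_ subset_rfl)
    rintro (i | c) hj
    · rw [inl_mem_QI] at hj ⊢; exact hj
    · rw [inr_mem_QI] at hj ⊢; exact ⟨hj.1.1, hj.2⟩
  · ext e
    constructor
    · rintro ⟨k1, k2⟩; exact ⟨k1.1, k2⟩
    · rintro ⟨k1, k2⟩; exact ⟨⟨k1, fun h => (h2 h).2 k2⟩, k2⟩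

end EM



namespace EM
open Set Relation

/-- closed under the list operation `f` -/
def FCl {α : Type v} (f : List α → Set α) (M : Set α) : Prop :=
  ∀ l : List α, (∀ x ∈ l, x ∈ M) → f l ⊆ M

section card
variable {α : Type v} {κ : Cardinal.{v}}

lemma mk_union_lt (hκ : κ.IsRegular) {S S' : Set α} (h : Cardinal.mk S < κ)
    (h' : Cardinal.mk S' < κ) : Cardinal.mk (S ∪ S' : Set α) < κ :=
  (Cardinal.mk_union_le _ _).trans_lt (Cardinal.add_lt_of_lt hκ.aleph0_le h h')

lemma mk_iUnion_nat_lt (hκ : κ.IsRegular) (hu : Cardinal.aleph0 < κ) {S : ℕ → Set α}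
    (h : ∀ n, Cardinal.mk (S n) < κ) : Cardinal.mk (⋃ n, S n : Set α) < κ := by
  have e : (⋃ n, S n) = ⋃ n : ULift.{v} ℕ, S n.down := by
    ext x; simp
  rw [e]
  refine (Cardinal.card_iUnion_lt_iff_forall_of_isRegular hκ (by simpa using hu)).2 ?_
  exact fun n => h _

lemma mk_fin_lt (hκ : κ.IsRegular) {S : Set α} (h : S.Finite) : Cardinal.mk S < κ :=
  (Cardinal.lt_aleph0_iff_set_finite.2 h).trans_le hκ.aleph0_le

/-- values of `f` on lists from `M` -/
def lval (f : List α → Set α) (M : Set α) : Set α :=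
  ⋃ l : List M, f (l.map Subtype.val)

lemma lval_sub {f : List α → Set α} {M : Set α} {l : List α} (h : ∀ x ∈ l, x ∈ M) :
    f l ⊆ lval f M := by
  have : l = (l.attach.map fun x => (⟨x.1, h x.1 x.2⟩ : M)).map Subtype.val := by
    simp
  rw [lval]
  rw [this]
  exact subset_iUnion (fun l : List M => f (l.map Subtype.val)) _

lemma mk_lval_lt (hκ : κ.IsRegular) (hu : Cardinal.aleph0 < κ) {f : List α → Set α} {M : Set α}
    (hM : Cardinal.mk M < κ) (hf : ∀ l, Cardinal.mk (f l) < κ) : Cardinal.mk (lval f M) < κ := by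
  refine (Cardinal.card_iUnion_lt_iff_forall_of_isRegular hκ ?_).2 fun l => hf _
  exact (Cardinal.mk_list_le_max _).trans_lt (max_lt hu hM)

lemma list_stage {S : ℕ → Set α} (hm : Monotone S) {l : List α} (h : ∀ x ∈ l, x ∈ ⋃ n, S n) :
    ∃ n, ∀ x ∈ l, x ∈ S n := by
  induction l with
  | nil => exact ⟨0, by simp⟩
  | cons a l ih =>
    obtain ⟨n, hn⟩ := ih fun x hx => h x (by simp [hx])
    obtain ⟨m, hm'⟩ := mem_iUnion.1 (h a (by simp))
    refine ⟨max n m, ?_⟩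
    intro x hx
    rcases List.mem_cons.1 hx with rfl | hx
    · exact hm (le_max_right _ _) hm'
    · exact hm (le_max_left _ _) (hn x hx)

/-- iteration of the closure -/
def clIter (f : List α → Set α) (C : Set α) : ℕ → Set α
  | 0 => C
  | n + 1 => clIter f C n ∪ lval f (clIter f C n)

lemma exists_FCl (hκ : κ.IsRegular) (hu : Cardinal.aleph0 < κ) {f : List α → Set α} {C : Set α}
    (hC : Cardinal.mk C < κ) (hf : ∀ l, Cardinal.mk (f l) < κ) :
    ∃ M, C ⊆ M ∧ FCl f M ∧ Cardinal.mk M < κ := by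
  have hm : Monotone (clIter f C) := monotone_nat_of_le_succ fun n => subset_union_left
  refine ⟨⋃ n, clIter f C n, subset_iUnion (clIter f C) 0, ?_, ?_⟩
  · intro l hl
    obtain ⟨n, hn⟩ := list_stage hm hl
    exact (lval_sub hn).trans (subset_union_right.trans (subset_iUnion (clIter f C) (n + 1)))
  · refine mk_iUnion_nat_lt hκ hu fun n => ?_
    induction n with
    | zero => exact hC
    | succ n ih => exact mk_union_lt hκ ih (mk_lval_lt hκ hu ih hf)

lemma FCl.iUnion_mono {f : List α → Set α} {S : ℕ → Set α} (hm : Monotone S)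
    (h : ∀ n, lval f (S n) ⊆ ⋃ k, S k) : FCl f (⋃ n, S n) := by
  intro l hl
  obtain ⟨n, hn⟩ := list_stage hm hl
  exact (lval_sub hn).trans (h n)

lemma FCl.left {f g : List α → Set α} {M : Set α} (h : FCl (fun l => f l ∪ g l) M) : FCl f M :=
  fun l hl => subset_union_left.trans (h l hl)

lemma FCl.right {f g : List α → Set α} {M : Set α} (h : FCl (fun l => f l ∪ g l) M) : FCl g M :=
  fun l hl => subset_union_right.trans (h l hl)

lemma FCl.of_iUnion {β : Sort*} {f : β → List α → Set α} {M : Set α}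
    (h : FCl (fun l => ⋃ b, f b l) M) (b : β) : FCl (f b) M :=
  fun l hl => (subset_iUnion (fun b => f b l) b).trans (h l hl)

lemma FCl.const {S : Set α} {M : Set α} (h : FCl (fun _ => S) M) : S ⊆ M := h [] (by simp)

end card

section wf

theorem wf_construct {Θ D : Type*} [LinearOrder Θ] [WellFoundedLT Θ] [Nonempty D]
    (Good : Θ → (Θ → D) → D → Prop)
    (hcongr : ∀ β s s' d, (∀ γ < β, s γ = s' γ) → Good β s d → Good β s' d)
    (hstep : ∀ β s, (∀ γ < β, Good γ s (s γ)) → ∃ d, Good β s d) :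
    ∃ s : Θ → D, ∀ β, Good β s (s β) := by
  classical
  let d0 : D := Classical.arbitrary D
  let s : Θ → D := (wellFounded_lt (α := Θ)).fix fun β rec =>
    Classical.epsilon (Good β (fun γ => if h : γ < β then rec γ h else d0))
  have hs : ∀ β, s β = Classical.epsilon (Good β (fun γ => if γ < β then s γ else d0)) := by
    intro β
    have := (wellFounded_lt (α := Θ)).fix_eq (fun β rec =>
      Classical.epsilon (Good β (fun γ => if h : γ < β then rec γ h else d0))) β
    simpa [s] using this
  refine ⟨s, fun β => ?_⟩
  induction β using (wellFounded_lt (α := Θ)).induction with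
  | _ β ih =>
    obtain ⟨d, hd⟩ := hstep β s ih
    have h1 : ∃ d, Good β (fun γ => if γ < β then s γ else d0) d :=
      ⟨d, hcongr β s _ d (fun γ hγ => by simp [hγ]) hd⟩
    have h2 := Classical.epsilon_spec h1
    rw [← hs] at h2
    exact hcongr β _ _ _ (fun γ hγ => by simp [hγ]) h2

end wf

section sat
universe w
variable {V : Type u} {E : Type v} {G : Multigraph V E} {ι : Type w} {σ : ι → V}
  {A : Set E} {I : Set ι} {T : Set V}

/-- edges outside of `M` -/
def Ad (A : Set E) (M : Set (E ⊕ ι)) : Set E := {e | e ∈ A ∧ Sum.inl e ∉ M}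
/-- units outside of `M` -/
def Id (I : Set ι) (M : Set (E ⊕ ι)) : Set ι := {i | i ∈ I ∧ Sum.inr i ∉ M}

/-- the bundle of a linking at `e` -/
def bd (u : E → ι) (P : E → Set E) (e : E) : Set (E ⊕ ι) :=
  insert (Sum.inr (u e)) (insert (Sum.inl e) (Sum.inl '' P e))

def Sat (Y : Set E) (b : E → Set (E ⊕ ι)) (M : Set (E ⊕ ι)) : Prop :=
  ∀ e ∈ Y, ∀ x ∈ b e, x ∈ M → b e ⊆ M

/-- saturation as closure operation -/
def satf (Y : Set E) (b : E → Set (E ⊕ ι)) (l : List (E ⊕ ι)) : Set (E ⊕ ι) :=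
  ⋃ e ∈ {e | e ∈ Y ∧ ∃ x ∈ l, x ∈ b e}, b e

lemma sat_of_FCl {E : Type v} {ι : Type v} {Y : Set E} {b : E → Set (E ⊕ ι)} {M : Set (E ⊕ ι)}
    (h : FCl (satf Y b) M) : Sat Y b M := by
  intro e he x hx hxM
  refine Subset.trans ?_ (h [x] (by simpa using hxM))
  intro y hy
  exact mem_biUnion (show e ∈ {e | e ∈ Y ∧ ∃ z ∈ [x], z ∈ b e} from ⟨he, x, by simp, hx⟩) hy

lemma satf_finite {Y : Set E} {b : E → Set (E ⊕ ι)} (hf : ∀ e ∈ Y, (b e).Finite)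
    (hd : ∀ e ∈ Y, ∀ f ∈ Y, ∀ x, x ∈ b e → x ∈ b f → e = f) (l : List (E ⊕ ι)) :
    (satf Y b l).Finite := by
  refine Finite.biUnion ?_ fun e he => hf e he.1
  induction l with
  | nil => simp
  | cons a l ih =>
    refine ((Set.Subsingleton.finite (s := {e | e ∈ Y ∧ a ∈ b e}) ?_).union ih).subset ?_
    · intro e he f hf
      exact hd e he.1 f hf.1 a he.2 hf.2
    · rintro e ⟨he, x, hx, hxe⟩
      rcases List.mem_cons.1 hx with rfl | hx
      · exact Or.inl ⟨he, hxe⟩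
      · exact Or.inr ⟨he, x, hx, hxe⟩

lemma Lk.bd_finite {X : Set V} {u : E → ι} {P : E → Set E} (h : Lk G σ A I X u P) :
    ∀ e ∈ A ∩ G.cut X, (bd u P e).Finite :=
  fun e he => (((h.fin e he).image _).insert _).insert _

lemma Lk.bd_disj {X : Set V} {u : E → ι} {P : E → Set E} (h : Lk G σ A I X u P) :
    ∀ e ∈ A ∩ G.cut X, ∀ f ∈ A ∩ G.cut X, ∀ x, x ∈ bd u P e → x ∈ bd u P f → e = f := by
  intro e he f hf x hx hx'
  rcases x with g | i
  · simp only [bd, mem_insert_iff, reduceCtorEq, Sum.inl.injEq, mem_image, exists_eq_right,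
      false_or] at hx hx'
    rcases hx with rfl | hx <;> rcases hx' with rfl | hx'
    · rfl
    · exact absurd he.2 (ins_not_cut (h.ins f hf hx'))
    · exact absurd hf.2 (ins_not_cut (h.ins e he hx))
    · exact h.disj e he f hf g hx hx'
  · simp only [bd, mem_insert_iff, Sum.inr.injEq, reduceCtorEq, mem_image, and_false, exists_false,
      or_false] at hx hx'
    exact h.inj e he f hf (hx.symm.trans hx')

lemma Lk.satf_finite {X : Set V} {u : E → ι} {P : E → Set E} (h : Lk G σ A I X u P)
    (l : List (E ⊕ ι)) : (satf (A ∩ G.cut X) (bd u P) l).Finite :=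
  EM.satf_finite h.bd_finite h.bd_disj l

lemma bd_u {u : E → ι} {P : E → Set E} {e : E} : Sum.inr (u e) ∈ bd u P e := by simp [bd]
lemma bd_e {u : E → ι} {P : E → Set E} {e : E} : Sum.inl e ∈ bd u P e := by simp [bd]
lemma bd_P {u : E → ι} {P : E → Set E} {e g : E} (h : g ∈ P e) : Sum.inl g ∈ bd u P e := by
  simp [bd, h]

lemma Lk.bd_compl {X : Set V} {u : E → ι} {P : E → Set E} {S : Set (E ⊕ ι)}
    (h : Lk G σ (Ad A S) (Id I S) X u P) :
    ∀ e ∈ Ad A S ∩ G.cut X, ∀ x ∈ bd u P e, x ∉ S := by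
  intro e he x hx
  simp only [bd, mem_insert_iff, mem_image] at hx
  rcases hx with rfl | rfl | ⟨g, hg, rfl⟩
  · exact (h.mem e he).2
  · exact he.1.2
  · exact (h.sub e he hg).2

lemma Lk.restrictSat {X : Set V} {u : E → ι} {P : E → Set E} {S S' : Set (E ⊕ ι)}
    (h : Lk G σ (Ad A S) (Id I S) X u P) (hS : S ⊆ S') (hs : Sat (Ad A S ∩ G.cut X) (bd u P) S') :
    Lk G σ (Ad A S') (Id I S') X u P := by
  refine h.restrict ?_
  intro e he
  have he1 : e ∈ Ad A S := ⟨he.1.1, fun hh => he.1.2 (hS hh)⟩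
  have hn : ∀ x ∈ bd u P e, x ∉ S' := fun x hx hx' => he.1.2 (hs e ⟨he1, he.2⟩ x hx hx' bd_e)
  refine ⟨he1, ?_, ?_⟩
  · intro g hg
    exact ⟨(h.sub e ⟨he1, he.2⟩ hg).1, hn _ (bd_P hg)⟩
  · exact ⟨(h.mem e ⟨he1, he.2⟩).1, hn _ bd_u⟩

/-- strong hindrance: every vertex can be reached -/
def SWall (G : Multigraph V E) (σ : ι → V) (A : Set E) (I : Set ι) (T : Set V) (X : Set V) : Prop :=
  X.Nonempty ∧ Disjoint X T ∧ ∀ x ∈ X, SWat G σ A I X x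

lemma Hind.sWall (h : Hind G σ A I T) : ∃ X, SWall G σ A I T X := by
  obtain ⟨X, hX, u, P, i, hL, hi, hiX, hs⟩ := h
  obtain ⟨R, hR, hiR, -, hv⟩ := reach hL {i} (by simpa using hiX) (by simpa using hs)
  refine ⟨R, ⟨σ i, hiR i rfl⟩, hX.mono_left hR, fun x hx => ?_⟩
  obtain ⟨j, hj, hh⟩ := hv x hx
  rw [mem_singleton_iff.1 hj] at hh
  refine hh.mono_units ?_
  intro k hk
  rcases hk with rfl | ⟨e, he, rfl⟩
  · exact hi
  · exact hL.mem e he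

lemma SWat.mem_unit {X : Set V} {v : V} {j : ι} {Q : Set E} (hQ : Q ⊆ Ins G X)
    (h : Conn G Q (σ j) v) (hv : v ∈ X) : σ j ∈ X := stay_ins h hv hQ

lemma SWat.union {W X : Set V} {v : V} {u : E → ι} {P : E → Set E}
    (hW : Lk G σ A I W u P) (h : SWat G σ A I X v) (hv : v ∈ X) : SWat G σ A I (W ∪ X) v := by
  obtain ⟨u1, P1, j, Q, hL, hj, hju, hQf, hQA, hQX, hQd, hQc⟩ := h
  obtain ⟨u2, h2, h2'⟩ := Q2 hW X
  obtain ⟨u3, P3, h3, h3a, h3b⟩ := Q1 hL h2 disjoint_sdiff_left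
  have e1 : X ∪ (W \ X) = W ∪ X := by rw [union_sdiff_self, union_comm]
  rw [e1] at h3
  have hjX : σ j ∈ X := stay_ins hQc hv hQX
  have key : ∀ e ∈ A ∩ G.cut (W ∪ X), u3 e ≠ j ∧ ∀ g, g ∈ P3 e → g ∉ Q := by
    intro e he
    by_cases ht : e ∈ Tch G X
    · have hc : e ∈ A ∩ G.cut X := by
        rw [← e1] at he
        rcases cut_union_cases he.2 with h | h
        · exact ⟨he.1, h.2.1⟩
        · exact absurd ht h.1
      rw [(h3a e ht).1, (h3a e ht).2]
      exact ⟨hju e hc, hQd e hc⟩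
    · have hc : e ∈ (A \ Tch G X) ∩ G.cut (W \ X) := by
        rw [← e1] at he
        rcases cut_union_cases he.2 with h | h
        · exact absurd h.1 ht
        · exact ⟨⟨he.1, ht⟩, h.2.1⟩
      have hq : ∀ g, g ∈ P e \ Tch G X → g ∉ Q := fun g hg hg' => hg.2 (ins_tch (hQX hg'))
      rw [(h3b e ht).1, (h3b e ht).2]
      rcases (h2' e hc).2 with ⟨h4, h5⟩ | ⟨c, hc', h4⟩
      · rw [h4]
        refine ⟨?_, ?_⟩
        · simp only [q1u, Sum.elim_inl, id]
          rintro rfl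
          exact h5 hjX
        · simpa only [q1P, Sum.elim_inl] using hq
      · have hcm := h2.mem e hc
        rw [h4] at hcm
        have hcX : c ∈ A ∩ G.cut X := inr_mem_QI.1 hcm
        rw [h4]
        refine ⟨?_, ?_⟩
        · simpa only [q1u, Sum.elim_inr] using hju c hcX
        · simp only [q1P, Sum.elim_inr]
          rintro g ((hg | hg) | hg)
          · exact hQd c hcX g hg
          · rw [mem_singleton_iff.1 hg]
            exact fun hh => ins_not_cut (hQX hh) hcX.2
          · exact hq g hg
  refine ⟨u3, P3, j, Q, h3, hj, fun e he => (key e he).1, hQf, hQA,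
    hQX.trans (ins_mono subset_union_right), fun e he => (key e he).2, hQc⟩

end sat

end EM



namespace EM
open Set Relation

lemma exists_cofinal_pi {κ : Cardinal.{v}} (hκ : κ.IsRegular) :
    ∃ π : κ.ord.ToType → (κ.ord.ToType × κ.ord.ToType) × Bool,
      ∀ p γ, ∃ β, γ < β ∧ π β = p := by
  have hk := Cardinal.mk_ord_toType κ
  have h0 := hκ.aleph0_le
  have hcard : Cardinal.mk κ.ord.ToType =
      Cardinal.mk (((κ.ord.ToType × κ.ord.ToType) × Bool) × κ.ord.ToType) := by
    simp only [Cardinal.mk_prod, hk, Cardinal.lift_id, Cardinal.lift_uzero, Cardinal.mul_eq_self h0,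
      Cardinal.mk_fintype, Fintype.card_bool]
    simp only [Nat.cast_ofNat, Cardinal.lift_ofNat]
    have h2 : (2 : Cardinal.{v}) ≤ κ := le_trans (by exact_mod_cast (Cardinal.natCast_lt_aleph0 (n := 2)).le) h0
    rw [Cardinal.mul_eq_left h0 h2 (by simp)]
    rw [Cardinal.mul_eq_self h0]
  obtain ⟨e⟩ := Cardinal.eq.1 hcard
  refine ⟨fun β => (e β).1, fun p γ => ?_⟩
  by_contra hcon
  push Not at hcon
  have h1 : ∀ ξ, e.symm (p, ξ) ∈ Iio γ ∪ {γ} := by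
    intro ξ
    by_contra h
    simp only [mem_union, mem_Iio, mem_singleton_iff, not_or, not_lt] at h
    exact hcon _ (lt_of_le_of_ne h.1 (Ne.symm h.2)) (by simp)
  have h2 : Cardinal.mk κ.ord.ToType ≤ Cardinal.mk (Iio γ ∪ {γ} : Set κ.ord.ToType) := by
    refine Cardinal.mk_le_of_injective (f := fun ξ => (⟨e.symm (p, ξ), h1 ξ⟩ : (Iio γ ∪ {γ} : Set κ.ord.ToType))) ?_
    intro a b hab
    simpa using hab
  rw [hk] at h2
  exact absurd (mk_union_lt hκ (Cardinal.mk_Iio_toType_ord_lt γ) (mk_fin_lt hκ (finite_singleton γ)))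
    (not_lt.2 h2)

variable {V : Type u} {E : Type v} {G : Multigraph V E} {ι : Type v} {σ : ι → V}
  {A : Set E} {I : Set ι} {T : Set V} {Θ : Type v}

/-- data of one stage -/
structure GD (V : Type u) (E : Type v) (ι : Type v) (Θ : Type v) where
  M : Set (E ⊕ ι)
  N : Set (E ⊕ ι)
  X : Set V
  u1 : E → ι
  P1 : E → Set E
  u2 : E → ι
  P2 : E → Set E
  j : ι
  Q : Set E
  en : Θ → E ⊕ ι
  v : V

/-- union of the sets N -/
def NB (s : Θ → GD V E ι Θ) (B : Set Θ) : Set (E ⊕ ι) := ⋃ γ ∈ B, (s γ).N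
/-- union of the sets X -/
def VB (s : Θ → GD V E ι Θ) (B : Set Θ) : Set V := ⋃ γ ∈ B, (s γ).X

/-- ends -/
noncomputable def endv (G : Multigraph V E) (σ : ι → V) : E ⊕ ι → Bool → V
  | Sum.inl e, true => (Quot.out (G.inc e)).1
  | Sum.inl e, false => (Quot.out (G.inc e)).2
  | Sum.inr i, _ => σ i

lemma exists_endv {e : E} {x : V} (h : x ∈ G.inc e) : ∃ b, endv G σ (Sum.inl e) b = x := by
  have h1 : G.inc e = s((Quot.out (G.inc e)).1, (Quot.out (G.inc e)).2) := by
    conv_lhs => rw [← Quot.out_eq (G.inc e)]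
  rw [h1, Sym2.mem_iff] at h
  rcases h with h | h
  · exact ⟨true, h.symm⟩
  · exact ⟨false, h.symm⟩

set_option linter.unusedSectionVars false
section
variable [LinearOrder Θ]
variable (G σ A I T) (κ : Cardinal.{v}) (F : List (E ⊕ ι) → Set (E ⊕ ι))
  (vsel : Θ → (Θ → GD V E ι Θ) → V)

/-- validity of a stage -/
structure Stp (β : Θ) (s : Θ → GD V E ι Θ) (d : GD V E ι Θ) : Prop where
  hNM : NB s (Iio β) ⊆ d.M
  hMN : d.M ⊆ d.N
  hNk : Cardinal.mk d.N < κ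
  hMF : FCl F d.M
  hv : d.v ∈ d.X
  hvs : d.v = vsel β s
  hX : SWall G σ (Ad A d.M) (Id I d.M) T d.X
  h1 : Lk G σ (Ad A (NB s (Iio β))) (Id I (NB s (Iio β))) (VB s (Iio β)) d.u1 d.P1
  hs1 : Sat (Ad A (NB s (Iio β)) ∩ G.cut (VB s (Iio β))) (bd d.u1 d.P1) d.M
  h2 : Lk G σ (Ad A d.M) (Id I d.M) (VB s (Iio β) ∪ d.X) d.u2 d.P2
  hj : d.j ∈ Id I d.M
  hju : ∀ e ∈ Ad A d.M ∩ G.cut (VB s (Iio β) ∪ d.X), d.u2 e ≠ d.j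
  hQf : d.Q.Finite
  hQA : d.Q ⊆ Ad A d.M
  hQX : d.Q ⊆ Ins G (VB s (Iio β) ∪ d.X)
  hQd : ∀ e ∈ Ad A d.M ∩ G.cut (VB s (Iio β) ∪ d.X), ∀ g, g ∈ d.P2 e → g ∉ d.Q
  hQc : Conn G d.Q (σ d.j) d.v
  hjN : Sum.inr d.j ∈ d.N
  hQN : ∀ g ∈ d.Q, Sum.inl g ∈ d.N
  hs2 : Sat (Ad A d.M ∩ G.cut (VB s (Iio β) ∪ d.X)) (bd d.u2 d.P2) d.N
  hs3 : ∀ γ < β, Sat (Ad A (s γ).M ∩ G.cut (VB s (Iio γ) ∪ (s γ).X)) (bd (s γ).u2 (s γ).P2) d.N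
  hen : d.N ⊆ range d.en

variable {G σ A I T κ F vsel}

lemma NB_congr {s s' : Θ → GD V E ι Θ} {B : Set Θ} (h : ∀ γ ∈ B, s γ = s' γ) : NB s B = NB s' B := by
  unfold NB
  exact iUnion₂_congr fun γ hγ => by rw [h γ hγ]

lemma VB_congr {s s' : Θ → GD V E ι Θ} {B : Set Θ} (h : ∀ γ ∈ B, s γ = s' γ) : VB s B = VB s' B := by
  unfold VB
  exact iUnion₂_congr fun γ hγ => by rw [h γ hγ]

lemma Stp.congr (hvsel : ∀ β s s', (∀ γ < β, s γ = s' γ) → vsel β s = vsel β s')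
    {β : Θ} {s s' : Θ → GD V E ι Θ} {d : GD V E ι Θ} (h : ∀ γ < β, s γ = s' γ)
    (hs : Stp G σ A I T κ F vsel β s d) : Stp G σ A I T κ F vsel β s' d := by
  have e1 : NB s (Iio β) = NB s' (Iio β) := NB_congr h
  have e2 : VB s (Iio β) = VB s' (Iio β) := VB_congr h
  have e3 := hvsel β s s' h
  obtain ⟨a1, a2, a3, a4, a5, a6, a7, a8, a9, a10, a11, a12, a13, a14, a15, a16, a17, a18, a19, a20,
    a21, a22⟩ := hs
  rw [e1] at a1 a8 a9
  rw [e2] at a8 a9 a10 a12 a15 a16 a20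
  rw [e3] at a6
  refine ⟨a1, a2, a3, a4, a5, a6, a7, a8, a9, a10, a11, a12, a13, a14, a15, a16, a17, a18, a19, a20,
    ?_, a22⟩
  intro γ hγ
  have := a21 γ hγ
  rw [h γ hγ, VB_congr (s' := s') (B := Iio γ) (fun δ hδ => h δ (lt_trans hδ hγ))] at this
  exact this

lemma N_sub_NB {s : Θ → GD V E ι Θ} {B : Set Θ} {γ : Θ} (h : γ ∈ B) : (s γ).N ⊆ NB s B :=
  subset_biUnion_of_mem (u := fun γ => (s γ).N) h

lemma X_sub_VB {s : Θ → GD V E ι Θ} {B : Set Θ} {γ : Θ} (h : γ ∈ B) : (s γ).X ⊆ VB s B :=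
  subset_biUnion_of_mem (u := fun γ => (s γ).X) h

lemma VB_mono {s : Θ → GD V E ι Θ} {B B' : Set Θ} (h : B ⊆ B') : VB s B ⊆ VB s B' :=
  biUnion_subset_biUnion_left h

lemma Stp.N_mono {s : Θ → GD V E ι Θ} {γ β : Θ} (hs : Stp G σ A I T κ F vsel β s (s β))
    (h : γ ≤ β) : (s γ).N ⊆ (s β).N := by
  rcases h.lt_or_eq with h | rfl
  · exact (N_sub_NB (s := s) (B := Iio β) h).trans (hs.hNM.trans hs.hMN)
  · exact Subset.rfl

lemma Stp.sat_NB {s : Θ → GD V E ι Θ} {B : Set Θ}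
    (hs : ∀ γ ∈ B, Stp G σ A I T κ F vsel γ s (s γ)) {γ : Θ} (hγ : γ ∈ B) :
    Sat (Ad A (s γ).M ∩ G.cut (VB s (Iio γ) ∪ (s γ).X)) (bd (s γ).u2 (s γ).P2) (NB s B) := by
  intro e he x hx hxN
  obtain ⟨δ, hδ, hxδ⟩ := mem_iUnion₂.1 hxN
  rcases le_or_gt δ γ with h | h
  · exact ((hs γ hγ).hs2 e he x hx ((hs γ hγ).N_mono h hxδ)).trans (N_sub_NB hγ)
  · exact ((hs δ hδ).hs3 γ h e he x hx hxδ).trans (N_sub_NB hδ)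

lemma Stp.wave_NB [Nonempty ι] {s : Θ → GD V E ι Θ} {B : Set Θ}
    (hs : ∀ γ ∈ B, Stp G σ A I T κ F vsel γ s (s γ)) (hB : ∀ γ ∈ B, Iio γ ⊆ B) :
    Wave G σ (Ad A (NB s B)) (Id I (NB s B)) T (VB s B) := by
  have e1 : VB s B = ⋃ γ : B, (VB s (Iio γ.1) ∪ (s γ.1).X) := by
    apply Subset.antisymm
    · intro x hx
      obtain ⟨δ, hδ, hxδ⟩ := mem_iUnion₂.1 hx
      exact mem_iUnion.2 ⟨⟨δ, hδ⟩, Or.inr hxδ⟩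
    · refine iUnion_subset fun γ => union_subset (VB_mono (hB γ.1 γ.2)) (X_sub_VB γ.2)
  have hdis : Disjoint (VB s B) T := by
    unfold VB
    rw [disjoint_iUnion₂_left]
    exact fun γ hγ => (hs γ hγ).hX.2.1
  rw [e1] at hdis ⊢
  refine Wave.iUnion fun γ => ⟨hdis.mono_left (subset_iUnion (fun γ : B => (VB s (Iio γ.1) ∪ (s γ.1).X)) γ), ?_⟩
  refine ⟨(s γ.1).u2, (s γ.1).P2, ?_⟩
  exact (hs γ.1 γ.2).h2.restrictSat ((hs γ.1 γ.2).hMN.trans (N_sub_NB γ.2)) (Stp.sat_NB hs γ.2)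

/-- the set of bad vertices -/
def KS (G : Multigraph V E) (σ : ι → V) (A : Set E) (I : Set ι) (T : Set V) (κ : Cardinal.{v}) :
    Set V := {v | ∀ f : List (E ⊕ ι) → Set (E ⊕ ι), (∀ l, Cardinal.mk (f l) < κ) →
      ∃ M, FCl f M ∧ Cardinal.mk M < κ ∧ ∃ X, v ∈ X ∧ SWall G σ (Ad A M) (Id I M) T X}

lemma Stp.step [Nonempty ι] (hκ : κ.IsRegular) (hu : Cardinal.aleph0 < κ)
    (hΘ : Cardinal.mk Θ = κ) (hΘ' : ∀ β : Θ, Cardinal.mk (Iio β) < κ)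
    (hF : ∀ l, Cardinal.mk (F l) < κ)
    (hvK : ∀ β s, vsel β s ∈ KS G σ A I T κ) {β : Θ} {s : Θ → GD V E ι Θ}
    (hs : ∀ γ < β, Stp G σ A I T κ F vsel γ s (s γ)) : ∃ d, Stp G σ A I T κ F vsel β s d := by
  have hNLk : Cardinal.mk (NB s (Iio β)) < κ :=
    (Cardinal.card_biUnion_lt_iff_forall_of_isRegular hκ (hΘ' β)).2 fun γ hγ => (hs γ hγ).hNk
  obtain ⟨hdis, u1, P1, h1⟩ := Stp.wave_NB (B := Iio β) hs (fun γ hγ δ hδ => lt_trans hδ hγ)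
  obtain ⟨M, hM, hMk, X, hvX, hX⟩ := hvK β s (fun l => F l ∪ (NB s (Iio β) ∪
      satf (Ad A (NB s (Iio β)) ∩ G.cut (VB s (Iio β))) (bd u1 P1) l)) (fun l =>
    mk_union_lt hκ (hF l) (mk_union_lt hκ hNLk (mk_fin_lt hκ (h1.satf_finite l))))
  have hNM : NB s (Iio β) ⊆ M := FCl.const hM.right.left
  have hs1 := sat_of_FCl hM.right.right
  have h1' := h1.restrictSat hNM hs1
  obtain ⟨u2, P2, j, Q, h2, hj, hju, hQf, hQA, hQX, hQd, hQc⟩ := SWat.union h1' (hX.2.2 _ hvX) hvX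
  obtain ⟨N, hMN, hN, hNk⟩ := exists_FCl hκ hu
    (f := fun l => satf (Ad A M ∩ G.cut (VB s (Iio β) ∪ X)) (bd u2 P2) l ∪
      ⋃ γ ∈ Iio β, satf (Ad A (s γ).M ∩ G.cut (VB s (Iio γ) ∪ (s γ).X)) (bd (s γ).u2 (s γ).P2) l)
    (C := M ∪ (insert (Sum.inr j) (Sum.inl '' Q)))
    (mk_union_lt hκ hMk (mk_fin_lt hκ ((hQf.image _).insert _)))
    (fun l => mk_union_lt hκ (mk_fin_lt hκ (h2.satf_finite l))
      ((Cardinal.card_biUnion_lt_iff_forall_of_isRegular hκ (hΘ' β)).2 fun γ hγ =>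
        (mk_fin_lt hκ ((hs γ hγ).h2.satf_finite l))))
  have hjN : Sum.inr j ∈ N := hMN (Or.inr (by simp))
  have hle : Cardinal.mk N ≤ Cardinal.mk Θ := by rw [hΘ]; exact hNk.le
  obtain ⟨f⟩ := hle
  haveI : Nonempty N := ⟨⟨_, hjN⟩⟩
  refine ⟨⟨M, N, X, u1, P1, u2, P2, j, Q, fun ξ => (Function.invFun f ξ).1, vsel β s⟩,
    ⟨hNM, subset_union_left.trans hMN, hNk, hM.left, hvX, rfl, hX, h1, hs1, h2, hj, hju, hQf, hQA,
      hQX, hQd, hQc, hjN, ?_, sat_of_FCl hN.left, ?_, ?_⟩⟩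
  · exact fun g hg => hMN (Or.inr (Or.inr ⟨g, hg, rfl⟩))
  · intro γ hγ
    exact sat_of_FCl ((hN.right.of_iUnion γ).of_iUnion hγ)
  · intro x hx
    exact ⟨f ⟨x, hx⟩, by simp [Function.leftInverse_invFun f.injective _]⟩

end

end EM



namespace EM
open Set Relation

variable {V : Type u} {E : Type v} {G : Multigraph V E} {ι : Type v} {σ : ι → V}
  {A : Set E} {I : Set ι} {T : Set V} {Θ : Type v}
variable [LinearOrder Θ] [WellFoundedLT Θ] {κ : Cardinal.{v}} {F : List (E ⊕ ι) → Set (E ⊕ ι)}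
  {vsel : Θ → (Θ → GD V E ι Θ) → V}

set_option linter.unusedSectionVars false
/-- regions -/
def Rgn (s : Θ → GD V E ι Θ) : Option (Θ × Bool) → Set (E ⊕ ι)
  | none => (NB s univ)ᶜ
  | some (β, false) => (s β).M \ NB s (Iio β)
  | some (β, true) => (s β).N \ (s β).M

lemma Rgn_disj {s : Θ → GD V E ι Θ} (hs : ∀ β, Stp G σ A I T κ F vsel β s (s β))
    {τ τ' : Option (Θ × Bool)} {x : E ⊕ ι} (h : x ∈ Rgn s τ) (h' : x ∈ Rgn s τ') : τ = τ' := by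
  have key : ∀ β b, x ∈ Rgn s (some (β, b)) → x ∈ (s β).N ∧ x ∉ NB s (Iio β) := by
    intro β b hx
    cases b
    · exact ⟨(hs β).hMN hx.1, hx.2⟩
    · exact ⟨hx.1, fun h => hx.2 ((hs β).hNM h)⟩
  have hne : ∀ β b, x ∈ Rgn s (some (β, b)) → x ∉ Rgn s none := fun β b hx hn =>
    hn (N_sub_NB (mem_univ β) (key β b hx).1)
  rcases τ with _ | ⟨β, b⟩ <;> rcases τ' with _ | ⟨β', b'⟩
  · rfl
  · exact absurd h (hne _ _ h')
  · exact absurd h' (hne _ _ h)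
  · have k1 := key _ _ h
    have k2 := key _ _ h'
    have : β = β' := by
      rcases lt_trichotomy β β' with hl | hl | hl
      · exact absurd (N_sub_NB (B := Iio β') hl k1.1) k2.2
      · exact hl
      · exact absurd (N_sub_NB (B := Iio β) hl k2.1) k1.2
    subst this
    cases b <;> cases b'
    · rfl
    · exact absurd h.1 h'.2
    · exact absurd h'.1 h.2
    · rfl

lemma Stp.final [Nonempty ι] (π : Θ → (Θ × Θ) × Bool) (hπ : ∀ p γ, ∃ β, γ < β ∧ π β = p)
    {K : Set V} (β0 : Θ)
    (hvs : ∀ β s, (π β).1.1 < β → endv G σ ((s (π β).1.1).en (π β).1.2) (π β).2 ∈ K →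
      vsel β s = endv G σ ((s (π β).1.1).en (π β).1.2) (π β).2)
    (hFK : ∀ M X m b, FCl F M → Cardinal.mk M < κ → SWall G σ (Ad A M) (Id I M) T X → m ∈ M →
      endv G σ m b ∈ X → endv G σ m b ∈ K)
    {s : Θ → GD V E ι Θ} (hs : ∀ β, Stp G σ A I T κ F vsel β s (s β)) : Hind G σ A I T := by
  classical
  obtain ⟨hdis, u0, P0, h0⟩ := Stp.wave_NB (s := s) (B := univ) (fun γ _ => hs γ) (fun _ _ _ _ => mem_univ _)
  set VI := VB s univ with hVI
  have hVL : ∀ β, VB s (Iio β) ⊆ VI := fun β => VB_mono (subset_univ _)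
  have hWI : ∀ β, VB s (Iio β) ∪ (s β).X ⊆ VI := fun β => union_subset (hVL β) (X_sub_VB (mem_univ β))
  have hMk : ∀ β, Cardinal.mk (s β).M < κ := fun β =>
    (Cardinal.mk_le_mk_of_subset (hs β).hMN).trans_lt (hs β).hNk
  -- vertices outside of K
  have hout : ∀ e β x, Sum.inl e ∈ (s β).M → x ∈ G.inc e → x ∉ K → x ∉ (s β).X := by
    intro e β x he hx hxK hxX
    obtain ⟨b, rfl⟩ := exists_endv (σ := σ) hx
    exact hxK (hFK _ _ _ b (hs β).hMF (hMk β) (hs β).hX he hxX)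
  have hNM : ∀ β γ, β < γ → (s β).N ⊆ (s γ).M := fun β γ h =>
    (N_sub_NB (B := Iio γ) h).trans (hs γ).hNM
  -- assignment
  have has : ∀ e, ∃ β, (Sum.inl e : E ⊕ ι) ∈ NB s univ → e ∈ A ∩ G.cut VI → inn G VI e ∈ K →
      β ≠ β0 ∧ (s β).v = inn G VI e ∧ (s (π β).1.1).en (π β).1.2 = Sum.inl e := by
    intro e
    by_cases hc : (Sum.inl e : E ⊕ ι) ∈ NB s univ ∧ e ∈ A ∩ G.cut VI ∧ inn G VI e ∈ K
    · obtain ⟨h1, h2, h3⟩ := hc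
      obtain ⟨γ, -, hγ⟩ := mem_iUnion₂.1 h1
      obtain ⟨ξ, hξ⟩ := (hs γ).hen hγ
      have hin : inn G VI e ∈ G.inc e := by
        have := (inc_eq h2.2).1
        rw [this]
        simp
      obtain ⟨b, hb⟩ := exists_endv (σ := σ) hin
      obtain ⟨β, hβ, hp⟩ := hπ ((γ, ξ), b) (max γ β0)
      refine ⟨β, fun _ _ _ => ⟨?_, ?_, ?_⟩⟩
      · exact ne_of_gt (lt_of_le_of_lt (le_max_right _ _) hβ)
      · have hE : endv G σ ((s (π β).1.1).en (π β).1.2) (π β).2 = inn G VI e := by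
          rw [hp]; simp only; rw [hξ, hb]
        rw [(hs β).hvs, hvs β s ?_ (by rw [hE]; exact h3), hE]
        rw [hp]
        exact lt_of_le_of_lt (le_max_left _ _) hβ
      · rw [hp]; exact hξ
    · exact ⟨β0, fun h1 h2 h3 => absurd ⟨h1, h2, h3⟩ hc⟩
  choose as has using has
  -- the paths
  have main : ∀ e, ∃ (i : ι) (R : Set E) (τ : Option (Θ × Bool)), e ∈ A ∩ G.cut VI →
      (i ∈ I ∧ R.Finite ∧ R ⊆ A ∧ R ⊆ Ins G VI ∧ Conn G R (σ i) (inn G VI e)) ∧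
      (Sum.inr i ∈ Rgn s τ ∧ ∀ g ∈ R, Sum.inl g ∈ Rgn s τ) ∧
      ((τ = none ∧ e ∈ Ad A (NB s univ) ∩ G.cut VI ∧ i = u0 e ∧ R = P0 e) ∨
       (∃ β, τ = some (β, false) ∧ e ∈ Ad A (NB s (Iio β)) ∩ G.cut (VB s (Iio β)) ∧
          i = (s β).u1 e ∧ R = (s β).P1 e) ∨
       (∃ β, τ = some (β, true) ∧ e ∈ Ad A (s β).M ∩ G.cut (VB s (Iio β) ∪ (s β).X) ∧
          i = (s β).u2 e ∧ R = (s β).P2 e) ∨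
       (τ = some (as e, true) ∧ as e ≠ β0 ∧ (s (π (as e)).1.1).en (π (as e)).1.2 = Sum.inl e ∧
          i = (s (as e)).j ∧ R = (s (as e)).Q)) := by
    intro e
    by_cases hm : e ∈ A ∩ G.cut VI
    swap
    · exact ⟨Classical.arbitrary ι, ∅, none, fun h => absurd h hm⟩
    have hin : inn G VI e ∈ G.inc e := by
      have := (inc_eq hm.2).1
      rw [this]
      simp
    have hinV := (inc_eq hm.2).2.1
    by_cases hN : (Sum.inl e : E ⊕ ι) ∈ NB s univ
    swap
    · have he : e ∈ Ad A (NB s univ) ∩ G.cut VI := ⟨⟨hm.1, hN⟩, hm.2⟩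
      refine ⟨u0 e, P0 e, none, fun _ => ⟨⟨(h0.mem e he).1, h0.fin e he, fun g hg => (h0.sub e he hg).1,
        h0.ins e he, h0.conn e he⟩, ⟨(h0.mem e he).2, fun g hg => (h0.sub e he hg).2⟩, Or.inl ⟨rfl, he, rfl, rfl⟩⟩⟩
    by_cases hK : inn G VI e ∈ K
    · obtain ⟨a1, a2, a3⟩ := has e hN hm hK
      have hst := hs (as e)
      refine ⟨(s (as e)).j, (s (as e)).Q, some (as e, true), fun _ => ⟨⟨hst.hj.1, hst.hQf,
        fun g hg => (hst.hQA hg).1, hst.hQX.trans (ins_mono (hWI _)), ?_⟩,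
        ⟨⟨hst.hjN, hst.hj.2⟩, fun g hg => ⟨hst.hQN g hg, (hst.hQA hg).2⟩⟩, Or.inr (Or.inr (Or.inr ⟨rfl, a1, a3, rfl, rfl⟩))⟩⟩
      rw [← a2]; exact hst.hQc
    -- not in K
    obtain ⟨γ, -, hγ⟩ := mem_iUnion₂.1 hinV
    have hlev : ∃ β, (Sum.inl e : E ⊕ ι) ∈ Rgn s (some (β, false)) ∨
        (Sum.inl e : E ⊕ ι) ∈ Rgn s (some (β, true)) := by
      obtain ⟨δ, -, hδ⟩ := mem_iUnion₂.1 hN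
      obtain ⟨β, hβ, hmin⟩ := (wellFounded_lt (α := Θ)).has_min
        {β | (Sum.inl e : E ⊕ ι) ∈ (s β).N} ⟨δ, hδ⟩
      refine ⟨β, ?_⟩
      by_cases h5 : (Sum.inl e : E ⊕ ι) ∈ (s β).M
      · refine Or.inl ⟨h5, fun h6 => ?_⟩
        obtain ⟨η, hη, h7⟩ := mem_iUnion₂.1 h6
        exact hmin η h7 hη
      · exact Or.inr ⟨hβ, h5⟩
    obtain ⟨β, hβ | hβ⟩ := hlev
    · have hlt : γ < β := by
        by_contra hl
        have : (s β).M ⊆ (s γ).M := by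
          rcases (not_lt.1 hl).lt_or_eq with h | h
          · exact (hs β).hMN.trans (hNM β γ h)
          · rw [h]
        exact hout e γ _ (this hβ.1) hin hK hγ
      have hx : inn G VI e ∈ VB s (Iio β) := X_sub_VB (B := Iio β) hlt hγ
      have hc := cut_sub_inn (hVL β) hm.2 hx
      have he : e ∈ Ad A (NB s (Iio β)) ∩ G.cut (VB s (Iio β)) := ⟨⟨hm.1, hβ.2⟩, hc.1⟩
      have h1 := (hs β).h1
      have hb := (hs β).hs1 e he _ bd_e hβ.1
      refine ⟨(s β).u1 e, (s β).P1 e, some (β, false), fun _ => ⟨⟨(h1.mem e he).1, h1.fin e he,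
        fun g hg => (h1.sub e he hg).1, (h1.ins e he).trans (ins_mono (hVL β)), ?_⟩,
        ⟨⟨hb bd_u, (h1.mem e he).2⟩, fun g hg => ⟨hb (bd_P hg), (h1.sub e he hg).2⟩⟩,
        Or.inr (Or.inl ⟨β, rfl, he, rfl, rfl⟩)⟩⟩
      rw [← hc.2]; exact h1.conn e he
    · have hle : γ ≤ β := by
        by_contra hl
        exact hout e γ _ (hNM β γ (not_le.1 hl) hβ.1) hin hK hγ
      have hx : inn G VI e ∈ VB s (Iio β) ∪ (s β).X := by
        rcases hle.lt_or_eq with h | h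
        · exact Or.inl (X_sub_VB (B := Iio β) h hγ)
        · subst h; exact Or.inr hγ
      have hc := cut_sub_inn (hWI β) hm.2 hx
      have he : e ∈ Ad A (s β).M ∩ G.cut (VB s (Iio β) ∪ (s β).X) := ⟨⟨hm.1, hβ.2⟩, hc.1⟩
      have h1 := (hs β).h2
      have hb := (hs β).hs2 e he _ bd_e hβ.1
      refine ⟨(s β).u2 e, (s β).P2 e, some (β, true), fun _ => ⟨⟨(h1.mem e he).1, h1.fin e he,
        fun g hg => (h1.sub e he hg).1, (h1.ins e he).trans (ins_mono (hWI β)), ?_⟩,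
        ⟨⟨hb bd_u, (h1.mem e he).2⟩, fun g hg => ⟨hb (bd_P hg), (h1.sub e he hg).2⟩⟩,
        Or.inr (Or.inr (Or.inl ⟨β, rfl, he, rfl, rfl⟩))⟩⟩
      rw [← hc.2]; exact h1.conn e he
  choose u R τ hm using main
  have asinj : ∀ e f, (s (π (as e)).1.1).en (π (as e)).1.2 = Sum.inl e →
      (s (π (as f)).1.1).en (π (as f)).1.2 = Sum.inl f → as e = as f → e = f := by
    intro e f h1 h2 h3
    rw [h3, h2] at h1
    exact (Sum.inl.inj h1).symm
  have hst0 := hs β0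
  refine ⟨VI, hdis, u, R, (s β0).j, ⟨fun e he => (hm e he).1.1, fun e he => (hm e he).1.2.1,
    fun e he => (hm e he).1.2.2.1, fun e he => (hm e he).1.2.2.2.1, fun e he => (hm e he).1.2.2.2.2,
    ?_, ?_⟩, hst0.hj.1, ?_, ?_⟩
  · intro e he f hf huv
    obtain ⟨-, ⟨r1, -⟩, c1⟩ := hm e he
    obtain ⟨-, ⟨r2, -⟩, c2⟩ := hm f hf
    have ht : τ e = τ f := Rgn_disj hs r1 (by rw [huv]; exact r2)
    rcases c1 with ⟨t1, m1, a1, -⟩ | ⟨β, t1, m1, a1, -⟩ | ⟨β, t1, m1, a1, -⟩ | ⟨t1, b1, m1, a1, -⟩ <;>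
    rcases c2 with ⟨t2, m2, a2, -⟩ | ⟨β', t2, m2, a2, -⟩ | ⟨β', t2, m2, a2, -⟩ | ⟨t2, b2, m2, a2, -⟩ <;>
    rw [t1, t2] at ht <;> simp only [reduceCtorEq, Option.some.injEq, Prod.mk.injEq, and_true, and_false] at ht
    · exact h0.inj e m1 f m2 (by rw [← a1, ← a2, huv])
    · subst ht; exact (hs β).h1.inj e m1 f m2 (by rw [← a1, ← a2, huv])
    · subst ht; exact (hs β).h2.inj e m1 f m2 (by rw [← a1, ← a2, huv])
    · subst ht; exact absurd (by rw [← a1, ← a2, huv]) ((hs (as f)).hju e m1)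
    · subst ht; exact absurd (by rw [← a1, ← a2, huv]) ((hs (as e)).hju f m2)
    · exact asinj e f m1 m2 ht
  · intro e he f hf g hg1 hg2
    obtain ⟨-, ⟨-, r1⟩, c1⟩ := hm e he
    obtain ⟨-, ⟨-, r2⟩, c2⟩ := hm f hf
    have ht : τ e = τ f := Rgn_disj hs (r1 g hg1) (r2 g hg2)
    rcases c1 with ⟨t1, m1, -, a1⟩ | ⟨β, t1, m1, -, a1⟩ | ⟨β, t1, m1, -, a1⟩ | ⟨t1, b1, m1, -, a1⟩ <;>
    rcases c2 with ⟨t2, m2, -, a2⟩ | ⟨β', t2, m2, -, a2⟩ | ⟨β', t2, m2, -, a2⟩ | ⟨t2, b2, m2, -, a2⟩ <;>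
    rw [t1, t2] at ht <;> simp only [reduceCtorEq, Option.some.injEq, Prod.mk.injEq, and_true, and_false] at ht <;>
    rw [a1] at hg1 <;> rw [a2] at hg2
    · exact h0.disj e m1 f m2 g hg1 hg2
    · subst ht; exact (hs β).h1.disj e m1 f m2 g hg1 hg2
    · subst ht; exact (hs β).h2.disj e m1 f m2 g hg1 hg2
    · subst ht; exact absurd hg2 ((hs (as f)).hQd e m1 g hg1)
    · subst ht; exact absurd hg1 ((hs (as e)).hQd f m2 g hg2)
    · exact asinj e f m1 m2 ht
  · exact hWI β0 (stay_ins hst0.hQc (Or.inr hst0.hv) hst0.hQX)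
  · intro e he huv
    obtain ⟨-, ⟨r1, -⟩, c1⟩ := hm e he
    have ht : τ e = some (β0, true) := Rgn_disj hs r1 (by rw [huv]; exact ⟨hst0.hjN, hst0.hj.2⟩)
    rcases c1 with ⟨t1, m1, a1, -⟩ | ⟨β, t1, m1, a1, -⟩ | ⟨β, t1, m1, a1, -⟩ | ⟨t1, b1, m1, a1, -⟩ <;>
    rw [t1] at ht <;> simp only [reduceCtorEq, Option.some.injEq, Prod.mk.injEq, and_true, and_false] at ht
    · subst ht; exact hst0.hju e m1 (by rw [← a1, huv])
    · exact b1 ht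

end EM



namespace EM
open Set Relation

variable {V : Type u} {E : Type v} {G : Multigraph V E} {ι : Type v} {σ : ι → V}
  {A : Set E} {I : Set ι} {T : Set V}

theorem GOOD [Nonempty ι] {κ : Cardinal.{v}} (hκ : κ.IsRegular) (hu : Cardinal.aleph0 < κ)
    (hun : ¬ Hind G σ A I T) :
    ∃ F : List (E ⊕ ι) → Set (E ⊕ ι), (∀ l, Cardinal.mk (F l) < κ) ∧
      ∀ M, FCl F M → Cardinal.mk M < κ → ¬ Hind G σ (Ad A M) (Id I M) T := by
  classical
  set K := KS G σ A I T κ with hK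
  have hfv : ∀ v : V, ∃ f : List (E ⊕ ι) → Set (E ⊕ ι), (∀ l, Cardinal.mk (f l) < κ) ∧
      (v ∉ K → ∀ M, FCl f M → Cardinal.mk M < κ → ∀ X, v ∈ X →
        ¬ SWall G σ (Ad A M) (Id I M) T X) := by
    intro v
    by_cases hv : v ∈ K
    · exact ⟨fun _ => ∅, fun l => mk_fin_lt hκ finite_empty, fun h => absurd hv h⟩
    · have hv' := hv
      simp only [hK, KS, mem_setOf_eq, not_forall] at hv'
      obtain ⟨f, hf, h⟩ := hv'
      refine ⟨f, hf, fun _ M hM hMk X hvX hX => h ⟨M, hM, hMk, X, hvX, hX⟩⟩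
  choose fv hfv hfv' using hfv
  let F : List (E ⊕ ι) → Set (E ⊕ ι) := fun l => match l with
    | [] => ∅
    | m :: l => fv (endv G σ m true) l ∪ fv (endv G σ m false) l
  have hF : ∀ l, Cardinal.mk (F l) < κ := by
    intro l
    cases l with
    | nil => exact mk_fin_lt hκ finite_empty
    | cons m l => exact mk_union_lt hκ (hfv _ _) (hfv _ _)
  have hFK : ∀ M X m b, FCl F M → Cardinal.mk M < κ → SWall G σ (Ad A M) (Id I M) T X → m ∈ M →
      endv G σ m b ∈ X → endv G σ m b ∈ K := by
    intro M X m b hM hMk hX hm hb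
    by_contra hn
    refine hfv' _ hn M ?_ hMk X hb hX
    intro l hl
    have := hM (m :: l) (by
      intro x hx
      rcases List.mem_cons.1 hx with rfl | hx
      · exact hm
      · exact hl x hx)
    cases b
    · exact subset_union_right.trans this
    · exact subset_union_left.trans this
  refine ⟨F, hF, fun M hM hMk hH => ?_⟩
  by_cases hKe : K = ∅
  · obtain ⟨X, hX⟩ := hH.sWall
    have hno : ∀ e x, (Sum.inl e : E ⊕ ι) ∈ M → x ∈ G.inc e → x ∉ X := by
      intro e x he hx hxX
      obtain ⟨b, rfl⟩ := exists_endv (σ := σ) hx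
      have := hFK M X _ b hM hMk hX he hxX
      rw [hKe] at this
      exact this
    obtain ⟨x, hx⟩ := hX.1
    obtain ⟨u, P, j, Q, hL, hj, hju, hQf, hQA, hQX, hQd, hQc⟩ := hX.2.2 x hx
    have hA : Ad A M ∩ G.cut X = A ∩ G.cut X := by
      ext e
      constructor
      · exact fun h => ⟨h.1.1, h.2⟩
      · refine fun h => ⟨⟨h.1, fun h' => ?_⟩, h.2⟩
        have h3 := inc_eq h.2
        exact hno e (inn G X e) h' (by rw [h3.1]; simp) h3.2.1
    apply hun
    refine ⟨X, hX.2.1, u, P, j, ?_, hj.1, stay_ins hQc hx hQX, by rw [← hA]; exact hju⟩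
    obtain ⟨a1, a2, a3, a4, a5, a6, a7⟩ := hL
    rw [hA] at a1 a2 a3 a4 a5 a6 a7
    exact ⟨fun e he => (a1 e he).1, a2, fun e he g hg => (a3 e he hg).1, a4, a5, a6, a7⟩
  · obtain ⟨v0, hv0⟩ := nonempty_iff_ne_empty.2 hKe
    obtain ⟨π, hπ⟩ := exists_cofinal_pi hκ
    let vsel : κ.ord.ToType → (κ.ord.ToType → GD V E ι κ.ord.ToType) → V := fun β s =>
      if (π β).1.1 < β ∧ endv G σ ((s (π β).1.1).en (π β).1.2) (π β).2 ∈ K then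
        endv G σ ((s (π β).1.1).en (π β).1.2) (π β).2 else v0
    have hvK : ∀ β s, vsel β s ∈ K := by
      intro β s
      simp only [vsel]
      split_ifs with h
      · exact h.2
      · exact hv0
    have hvc : ∀ β s s', (∀ γ < β, s γ = s' γ) → vsel β s = vsel β s' := by
      intro β s s' h
      simp only [vsel]
      by_cases h1 : (π β).1.1 < β
      · rw [h _ h1]
      · simp [h1]
    have hκ0 : Nonempty κ.ord.ToType := by
      rw [← Cardinal.mk_ne_zero_iff, Cardinal.mk_ord_toType]
      exact (lt_trans Cardinal.aleph0_pos hu).ne'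
    obtain ⟨β0⟩ := hκ0
    haveI : Nonempty (GD V E ι κ.ord.ToType) := ⟨⟨∅, ∅, ∅, fun _ => Classical.arbitrary ι, fun _ => ∅,
      fun _ => Classical.arbitrary ι, fun _ => ∅, Classical.arbitrary ι, ∅,
      fun _ => Sum.inr (Classical.arbitrary ι), v0⟩⟩
    obtain ⟨s, hs⟩ := wf_construct (fun β s d => Stp G σ A I T κ F vsel β s d)
      (fun β s s' d h hd => Stp.congr hvc h hd)
      (fun β s h => Stp.step hκ hu (Cardinal.mk_ord_toType κ)
        (fun β => Cardinal.mk_Iio_toType_ord_lt β) hF hvK h)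
    refine hun (Stp.final π hπ (K := K) β0 ?_ hFK hs)
    intro β s h1 h2
    simp only [vsel]
    rw [if_pos ⟨h1, h2⟩]

end EM



namespace EM
open Set Relation

variable {V : Type u} {E : Type v} {G : Multigraph V E} {ι : Type v} {σ : ι → V}
  {A : Set E} {I : Set ι} {T : Set V}

/-- edges in `M` -/
def Ai (A : Set E) (M : Set (E ⊕ ι)) : Set E := {e | e ∈ A ∧ Sum.inl e ∈ M}
/-- units in `M` -/
def Ii (I : Set ι) (M : Set (E ⊕ ι)) : Set ι := {i | i ∈ I ∧ Sum.inr i ∈ M}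

/-- all units can be linked to `T` by disjoint paths -/
def Linkable (G : Multigraph V E) (σ : ι → V) (A : Set E) (I : Set ι) (T : Set V) : Prop :=
  ∃ P : ι → Set E, (∀ i ∈ I, P i ⊆ A ∧ ∃ z ∈ T, Conn G (P i) (σ i) z) ∧
    ∀ i ∈ I, ∀ j ∈ I, ∀ g, g ∈ P i → g ∈ P j → i = j

lemma Linkable.mono {A' : Set E} {I' : Set ι} (h : Linkable G σ A I T) (hA : A ⊆ A') (hI : I' ⊆ I) :
    Linkable G σ A' I' T := by
  obtain ⟨P, h1, h2⟩ := h
  exact ⟨P, fun i hi => ⟨(h1 i (hI hi)).1.trans hA, (h1 i (hI hi)).2⟩,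
    fun i hi j hj => h2 i (hI hi) j (hI hj)⟩

lemma Linkable.iUnion {Θ : Type*} {B : Θ → Set (E ⊕ ι)}
    (hd : ∀ a b x, x ∈ B a → x ∈ B b → a = b)
    (h : ∀ a, Linkable G σ (Ai A (B a)) (Ii I (B a)) T) :
    Linkable G σ (Ai A (⋃ a, B a)) (Ii I (⋃ a, B a)) T := by
  classical
  choose P h1 h2 using h
  have hx : ∀ i : ι, ∃ Q : Set E, ∀ a, Sum.inr i ∈ B a → Q = P a i := by
    intro i
    by_cases hh : ∃ a, Sum.inr i ∈ B a
    · obtain ⟨a, ha⟩ := hh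
      exact ⟨P a i, fun b hb => by rw [hd a b _ ha hb]⟩
    · exact ⟨∅, fun a ha => absurd ⟨a, ha⟩ hh⟩
  choose Q hQ using hx
  refine ⟨Q, ?_, ?_⟩
  · rintro i ⟨hi, hi'⟩
    obtain ⟨a, ha⟩ := mem_iUnion.1 hi'
    rw [hQ i a ha]
    obtain ⟨k1, k2⟩ := h1 a i ⟨hi, ha⟩
    exact ⟨fun g hg => ⟨(k1 hg).1, mem_iUnion.2 ⟨a, (k1 hg).2⟩⟩, k2⟩
  · rintro i ⟨hi, hi'⟩ j ⟨hj, hj'⟩ g hgi hgj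
    obtain ⟨a, ha⟩ := mem_iUnion.1 hi'
    obtain ⟨b, hb⟩ := mem_iUnion.1 hj'
    rw [hQ i a ha] at hgi
    rw [hQ j b hb] at hgj
    have : a = b := hd a b _ ((h1 a i ⟨hi, ha⟩).1 hgi).2 ((h1 b j ⟨hj, hb⟩).1 hgj).2
    subst this
    exact h2 a i ⟨hi, ha⟩ j ⟨hj, hb⟩ g hgi hgj

lemma Linkable.chain {Θ : Type*} [LinearOrder Θ] [WellFoundedLT Θ] {M : Θ → Set (E ⊕ ι)}
    (h : ∀ a, Linkable G σ (Ai A (M a \ ⋃ b ∈ Iio a, M b)) (Ii I (M a \ ⋃ b ∈ Iio a, M b)) T) :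
    Linkable G σ (Ai A (⋃ a, M a)) (Ii I (⋃ a, M a)) T := by
  have e : (⋃ a, M a) = ⋃ a, (M a \ ⋃ b ∈ Iio a, M b) := by
    apply Subset.antisymm
    · intro x hx
      obtain ⟨a, ha⟩ := mem_iUnion.1 hx
      obtain ⟨b, hb, hmin⟩ := (wellFounded_lt (α := Θ)).has_min {b | x ∈ M b} ⟨a, ha⟩
      refine mem_iUnion.2 ⟨b, hb, fun h' => ?_⟩
      obtain ⟨c, hc, hxc⟩ := mem_iUnion₂.1 h'
      exact hmin c hxc hc
    · exact iUnion_mono fun a => sdiff_subset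
  rw [e]
  refine Linkable.iUnion ?_ h
  intro a b x hx hx'
  rcases lt_trichotomy a b with hl | hl | hl
  · exact absurd (mem_biUnion (show a ∈ Iio b from hl) hx.1) hx'.2
  · exact hl
  · exact absurd (mem_biUnion (show b ∈ Iio a from hl) hx'.1) hx.2

lemma Ad_empty : Ad A (∅ : Set (E ⊕ ι)) = A := by ext; simp [Ad]
lemma Id_empty : Id I (∅ : Set (E ⊕ ι)) = I := by ext; simp [Id]
lemma Ai_Ad {M S : Set (E ⊕ ι)} : Ai (Ad A S) M = Ai A (M \ S) := by
  ext x; simp only [Ai, Ad, mem_setOf_eq, mem_sdiff]; tauto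
lemma Ii_Id {M S : Set (E ⊕ ι)} : Ii (Id I S) M = Ii I (M \ S) := by
  ext x; simp only [Ii, Id, mem_setOf_eq, mem_sdiff]; tauto

lemma list_stage' {α Θ : Type*} [LinearOrder Θ] {S : Θ → Set α} {B : Set Θ} (hB : B.Nonempty)
    (hm : ∀ a ∈ B, ∀ b ∈ B, a ≤ b → S a ⊆ S b)
    {l : List α} (h : ∀ x ∈ l, x ∈ ⋃ a ∈ B, S a) : ∃ a ∈ B, ∀ x ∈ l, x ∈ S a := by
  induction l with
  | nil => exact ⟨hB.some, hB.some_mem, by simp⟩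
  | cons x l ih =>
    obtain ⟨n, hnB, hn⟩ := ih fun x hx => h x (by simp [hx])
    obtain ⟨m, hmB, hm'⟩ := mem_iUnion₂.1 (h x (by simp))
    have hmax : max n m ∈ B := by rcases max_choice n m with h | h <;> rw [h] <;> assumption
    refine ⟨max n m, hmax, ?_⟩
    intro y hy
    rcases List.mem_cons.1 hy with rfl | hy
    · exact hm _ hmB _ hmax (le_max_right _ _) hm'
    · exact hm _ hnB _ hmax (le_max_left _ _) (hn y hy)

lemma list_closed {α : Type v} {Θ : Type*} [LinearOrder Θ] {S : Θ → Set α} {B : Set Θ}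
    {f : Θ → List α → Set α} (hf : ∀ a b, a ≤ b → ∀ l, f a l ⊆ f b l)
    (hm : ∀ a ∈ B, ∀ b ∈ B, a ≤ b → S a ⊆ S b)
    (hc : ∀ a ∈ B, FCl (f a) (S a)) : ∀ a ∈ B, FCl (f a) (⋃ a ∈ B, S a) := by
  intro a ha l hl
  obtain ⟨b, hb, hlb⟩ := list_stage' ⟨a, ha⟩ hm hl
  have hmax : max a b ∈ B := by rcases max_choice a b with h | h <;> rw [h] <;> assumption
  refine (hf a _ (le_max_left a b) l).trans ?_
  refine (hc _ hmax l fun x hx => hm b hb _ hmax (le_max_right _ _) (hlb x hx)).trans ?_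
  exact subset_biUnion_of_mem (u := S) hmax

theorem chain_build {Θ : Type v} [LinearOrder Θ] [WellFoundedLT Θ] (Sm : Θ → Set (E ⊕ ι) → Prop)
    (f : Θ → List (E ⊕ ι) → Set (E ⊕ ι)) (Cc : Θ → Set (E ⊕ ι))
    (hf : ∀ a b, a ≤ b → ∀ l, f a l ⊆ f b l)
    (hSC : ∀ j (M : Θ → Set (E ⊕ ι)), (∀ k < j, Sm k (M k)) → Sm j (Cc j ∪ ⋃ k ∈ Iio j, M k))
    (h0 : ¬ Hind G σ A I T)
    (hun : ∀ i (M : Θ → Set (E ⊕ ι)), (∀ k < i, Sm k (M k)) →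
      (∀ k < i, FCl (f k) (⋃ k ∈ Iio i, M k)) → (Iio i).Nonempty →
      ¬ Hind G σ (Ad A (⋃ k ∈ Iio i, M k)) (Id I (⋃ k ∈ Iio i, M k)) T)
    (hstep : ∀ j S, ¬ Hind G σ (Ad A S) (Id I S) T → ∀ C, Sm j C → ∃ M, C ⊆ M ∧ FCl (f j) M ∧
      Sm j M ∧ Linkable G σ (Ai A (M \ S)) (Ii I (M \ S)) T) :
    ∃ M : Θ → Set (E ⊕ ι), (∀ j, Sm j (M j)) ∧ (∀ j, Cc j ⊆ M j) ∧
      (∀ j, FCl (f j) (⋃ j, M j)) ∧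
      Linkable G σ (Ai A (⋃ j, M j)) (Ii I (⋃ j, M j)) T := by
  have key : ∃ M : Θ → Set (E ⊕ ι), ∀ j, Sm j (M j) ∧ Cc j ⊆ M j ∧
      FCl (f j) (M j) ∧ (⋃ k ∈ Iio j, M k) ⊆ M j ∧ Linkable G σ (Ai A (M j \ ⋃ k ∈ Iio j, M k))
      (Ii I (M j \ ⋃ k ∈ Iio j, M k)) T := by
    refine wf_construct (Θ := Θ) (D := Set (E ⊕ ι)) (fun j s d => Sm j d ∧ Cc j ⊆ d ∧
      FCl (f j) d ∧ (⋃ k ∈ Iio j, s k) ⊆ d ∧ Linkable G σ (Ai A (d \ ⋃ k ∈ Iio j, s k))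
      (Ii I (d \ ⋃ k ∈ Iio j, s k)) T) ?_ ?_
    · intro β s s' d h
      have e : (⋃ k ∈ Iio β, s k) = ⋃ k ∈ Iio β, s' k := iUnion₂_congr fun k hk => h k hk
      rw [e]
      exact fun h => h
    · intro β s hs
      have hmono : ∀ a ∈ Iio β, ∀ b ∈ Iio β, a ≤ b → s a ⊆ s b := by
        intro a _ b hb hab
        rcases hab.lt_or_eq with h | h
        · exact (subset_biUnion_of_mem (u := s) (show a ∈ Iio b from h)).trans (hs b hb).2.2.2.1
        · rw [h]
      have hunh : ¬ Hind G σ (Ad A (⋃ k ∈ Iio β, s k)) (Id I (⋃ k ∈ Iio β, s k)) T := by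
        by_cases hne : (Iio β).Nonempty
        · exact hun β s (fun k hk => (hs k hk).1)
            (list_closed hf hmono fun a ha => (hs a ha).2.2.1) hne
        · rw [not_nonempty_iff_eq_empty.1 hne]
          simpa only [mem_empty_iff_false, iUnion_of_empty, iUnion_empty, Ad_empty, Id_empty] using h0
      obtain ⟨M, h1, h2, h3, h4⟩ := hstep β _ hunh _ (hSC β s fun k hk => (hs k hk).1)
      exact ⟨M, h3, subset_union_left.trans h1, h2, subset_union_right.trans h1, h4⟩
  obtain ⟨M, hM⟩ := key
  have hmono : ∀ a b, a ≤ b → M a ⊆ M b := by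
    intro a b hab
    rcases hab.lt_or_eq with h | h
    · exact (subset_biUnion_of_mem (u := M) (show a ∈ Iio b from h)).trans (hM b).2.2.2.1
    · rw [h]
  refine ⟨M, fun j => (hM j).1, fun j => (hM j).2.1, fun j => ?_,
    Linkable.chain fun a => (hM a).2.2.2.2⟩
  have := list_closed (B := univ) hf (fun a _ b _ h => hmono a b h) (fun a _ => (hM a).2.2.1) j (mem_univ _)
  simpa using this

lemma nat_construct {D : Type*} (p : D → Prop) (d0 : D) (h0 : p d0) (r : ℕ → D → D → Prop)
    (h : ∀ n d, p d → ∃ d', p d' ∧ r n d d') :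
    ∃ s : ℕ → D, s 0 = d0 ∧ (∀ n, p (s n)) ∧ ∀ n, r n (s n) (s (n + 1)) := by
  choose g hg hr using h
  let s : ℕ → {d // p d} := fun n => Nat.rec ⟨d0, h0⟩ (fun n d => ⟨g n d.1 d.2, hg n d.1 d.2⟩) n
  exact ⟨fun n => (s n).1, rfl, fun n => (s n).2, fun n => hr n (s n).1 (s n).2⟩

lemma Linkable.nat {M : ℕ → Set (E ⊕ ι)} (h0 : M 0 = ∅) (hm : Monotone M)
    (h : ∀ n, Linkable G σ (Ai A (M (n + 1) \ M n)) (Ii I (M (n + 1) \ M n)) T) :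
    Linkable G σ (Ai A (⋃ a, M a)) (Ii I (⋃ a, M a)) T := by
  refine Linkable.chain fun n => ?_
  cases n with
  | zero =>
    rw [h0]
    exact ⟨fun _ => ∅, by simp [Ii], by simp [Ii]⟩
  | succ n =>
    have : (⋃ b ∈ Iio (n + 1), M b) = M n := by
      apply Subset.antisymm
      · exact iUnion₂_subset fun b hb => hm (Nat.lt_succ_iff.1 hb)
      · exact subset_biUnion_of_mem (u := M) (show n ∈ Iio (n + 1) from Nat.lt_succ_self n)
    rw [this]
    exact h n

/-- the statement L* -/
def LS (G : Multigraph V E) (σ : ι → V) (T : Set V) (ν : Cardinal.{v}) : Prop :=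
  ∀ (A : Set E) (I : Set ι), ¬ Hind G σ A I T → ∀ (C : Set (E ⊕ ι))
    (F : List (E ⊕ ι) → Set (E ⊕ ι)), Cardinal.mk C ≤ ν → (∀ l, Cardinal.mk (F l) ≤ ν) →
    ∃ M, C ⊆ M ∧ FCl F M ∧ Cardinal.mk M ≤ ν ∧ Linkable G σ (Ai A M) (Ii I M) T

/-- strict version -/
def LSS (G : Multigraph V E) (σ : ι → V) (T : Set V) (ν : Cardinal.{v}) : Prop :=
  ∀ (A : Set E) (I : Set ι), ¬ Hind G σ A I T → ∀ (C : Set (E ⊕ ι))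
    (F : List (E ⊕ ι) → Set (E ⊕ ι)), Cardinal.mk C < ν → (∀ l, Cardinal.mk (F l) < ν) →
    ∃ M, C ⊆ M ∧ FCl F M ∧ Cardinal.mk M < ν ∧ Linkable G σ (Ai A M) (Ii I M) T

end EM



namespace EM
open Set Relation

variable {V : Type u} {E : Type v} {G : Multigraph V E} {ι : Type v} {σ : ι → V}
  {A : Set E} {I : Set ι} {T : Set V}

/-- set of members of a list -/
def ls {α : Type*} (l : List α) : Set α := {x | x ∈ l}

lemma SPL_step [Nonempty ι] (l : List (E ⊕ ι)) (i : ι)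
    (h : ¬ Hind G σ (Ad A (ls l)) (Id I (ls l)) T) (hi : i ∈ Id I (ls l)) :
    ∃ p : List E, (∀ e ∈ p, e ∈ Ad A (ls l)) ∧ (∃ z ∈ T, Conn G (ls p) (σ i) z) ∧
      ¬ Hind G σ (Ad A (ls (Sum.inr i :: (p.map Sum.inl ++ l))))
        (Id I (ls (Sum.inr i :: (p.map Sum.inl ++ l)))) T := by
  obtain ⟨F, hF, h1, h2, h3⟩ := SPL h hi
  obtain ⟨p, hp⟩ : ∃ p : List E, ls p = F := ⟨hF.toFinset.toList, by ext; simp [ls]⟩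
  subst hp
  refine ⟨p, fun e he => h1 he, h2, ?_⟩
  convert h3 using 3
  · ext e
    simp only [Ad, ls, mem_setOf_eq, mem_sdiff, List.mem_cons, List.mem_append, List.mem_map]
    simp; tauto
  · ext e
    simp only [Id, ls, mem_setOf_eq, mem_sdiff, List.mem_cons, List.mem_append, List.mem_map]
    simp; tauto

theorem LS_aleph0 [Nonempty ι] : LS G σ T Cardinal.aleph0.{v} := by
  classical
  intro A I hun C F hC hF
  have hp : ∀ (l : List (E ⊕ ι)) (i : ι), ∃ p : List E,
    ¬ Hind G σ (Ad A (ls l)) (Id I (ls l)) T → i ∈ Id I (ls l) →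
    (∀ e ∈ p, e ∈ Ad A (ls l)) ∧ (∃ z ∈ T, Conn G (ls p) (σ i) z) ∧
      ¬ Hind G σ (Ad A (ls (Sum.inr i :: (p.map Sum.inl ++ l))))
        (Id I (ls (Sum.inr i :: (p.map Sum.inl ++ l)))) T := by
    intro l i
    by_cases h : ¬ Hind G σ (Ad A (ls l)) (Id I (ls l)) T ∧ i ∈ Id I (ls l)
    · obtain ⟨p, hp⟩ := SPL_step l i h.1 h.2
      exact ⟨p, fun _ _ => hp⟩
    · exact ⟨[], fun h1 h2 => absurd ⟨h1, h2⟩ h⟩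
  choose p hp using hp
  let g : List (E ⊕ ι) → Set (E ⊕ ι) := fun l => {x | ∃ i r, l = Sum.inr i :: r ∧
    x ∈ (p r i).map Sum.inl}
  have hreg := Cardinal.isRegular_succ (le_refl Cardinal.aleph0.{v})
  have hg : ∀ l, (g l).Finite := by
    intro l
    by_cases hl : ∃ i r, l = Sum.inr i :: r
    · obtain ⟨i, r, rfl⟩ := hl
      refine (List.finite_toSet ((p r i).map (Sum.inl : E → E ⊕ ι))).subset ?_
      rintro x ⟨i', r', e, hx⟩
      injection e with e1 e2
      injection e1 with e1
      subst e1 e2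
      exact hx
    · convert finite_empty
      ext x
      simp only [g, mem_setOf_eq, mem_empty_iff_false, iff_false]
      rintro ⟨i, r, e, _⟩
      exact hl ⟨i, r, e⟩
  have key : ∃ M, insert (Sum.inr (Classical.arbitrary ι)) C ⊆ M ∧ FCl (fun l => F l ∪ g l) M ∧
      Cardinal.mk M < Order.succ Cardinal.aleph0.{v} := by
    refine exists_FCl hreg (Order.lt_succ _) ?_ ?_
    · rw [insert_eq]
      exact mk_union_lt hreg (mk_fin_lt hreg (finite_singleton _)) (Order.lt_succ_of_le hC)
    · intro l
      exact mk_union_lt hreg (Order.lt_succ_of_le (hF l)) (mk_fin_lt hreg (hg l))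
  obtain ⟨M, hCM, hcl, hMc⟩ := key
  have hMc := Order.le_of_lt_succ hMc
  refine ⟨M, (subset_insert _ _).trans hCM, hcl.left, hMc, ?_⟩
  have hclg := hcl.right
  obtain ⟨en, hen⟩ := (Cardinal.le_aleph0_iff_set_countable.1 hMc).exists_eq_range
    ⟨_, hCM (mem_insert _ _)⟩
  have key : ∃ s : ℕ → List (E ⊕ ι), s 0 = [] ∧
      (∀ n, (∀ x ∈ s n, x ∈ M) ∧ ¬ Hind G σ (Ad A (ls (s n))) (Id I (ls (s n))) T) ∧
      ∀ n, (∀ i, en n = Sum.inr i → i ∈ I → Sum.inr i ∈ s (n + 1)) ∧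
        ls (s n) ⊆ ls (s (n + 1)) ∧ Linkable G σ (Ai A (ls (s (n + 1)) \ ls (s n)))
          (Ii I (ls (s (n + 1)) \ ls (s n))) T := by
    refine nat_construct (fun l : List (E ⊕ ι) => (∀ x ∈ l, x ∈ M) ∧
      ¬ Hind G σ (Ad A (ls l)) (Id I (ls l)) T) [] ?_ (fun n l l' =>
      (∀ i, en n = Sum.inr i → i ∈ I → Sum.inr i ∈ l') ∧
        ls l ⊆ ls l' ∧ Linkable G σ (Ai A (ls l' \ ls l)) (Ii I (ls l' \ ls l)) T) ?_
    · refine ⟨by simp, ?_⟩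
      have : ls ([] : List (E ⊕ ι)) = ∅ := by ext; simp [ls]
      rw [this, Ad_empty, Id_empty]
      exact hun
    · rintro n l ⟨hl, hl'⟩
      by_cases hi : ∃ i, en n = Sum.inr i ∧ i ∈ Id I (ls l)
      · obtain ⟨i, hei, hi⟩ := hi
        obtain ⟨h1, h2, h3⟩ := hp l i hl' hi
        have hiM : Sum.inr i ∈ M := by rw [hen, ← hei]; exact mem_range_self n
        refine ⟨Sum.inr i :: ((p l i).map Sum.inl ++ l), ⟨?_, h3⟩, ?_, ?_, ?_⟩
        · intro x hx
          rcases List.mem_cons.1 hx with rfl | hx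
          · exact hiM
          rcases List.mem_append.1 hx with hx | hx
          · refine hclg (Sum.inr i :: l) ?_ ⟨i, l, rfl, hx⟩
            intro y hy
            rcases List.mem_cons.1 hy with rfl | hy
            · exact hiM
            · exact hl y hy
          · exact hl x hx
        · intro j hj _
          rw [hei] at hj
          rw [hj]
          simp
        · intro x hx
          simp only [ls, mem_setOf_eq, List.mem_cons, List.mem_append] at hx ⊢
          exact Or.inr (Or.inr hx)
        · have hone : ∀ j ∈ Ii I (ls (Sum.inr i :: ((p l i).map Sum.inl ++ l)) \ ls l), j = i := by
            rintro j ⟨_, hj, hj'⟩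
            simp only [ls, mem_setOf_eq, List.mem_cons, List.mem_append, List.mem_map] at hj hj'
            rcases hj with hj | ⟨_, _, hj⟩ | hj
            · exact Sum.inr.inj hj
            · cases hj
            · exact absurd hj hj'
          refine ⟨fun _ => ls (p l i), ?_, ?_⟩
          · intro j hj
            rw [hone j hj]
            refine ⟨fun e he => ⟨(h1 e he).1, ?_, (h1 e he).2⟩, h2⟩
            simp only [ls, mem_setOf_eq, List.mem_cons, List.mem_append, List.mem_map]
            exact Or.inr (Or.inl ⟨e, he, rfl⟩)
          · intro j hj k hk _ _ _
            rw [hone j hj, hone k hk]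
      · refine ⟨l, ⟨hl, hl'⟩, ?_, Subset.rfl, ?_⟩
        · intro i hei hiI
          by_contra hh
          exact hi ⟨i, hei, hiI, hh⟩
        · exact ⟨fun _ => ∅, by simp [Ii], by simp [Ii]⟩
  obtain ⟨s, hs0, hs1, hs2⟩ := key
  have hL := Linkable.nat (G := G) (σ := σ) (A := A) (I := I) (T := T) (M := fun n => ls (s n))
    (by rw [hs0]; ext; simp [ls]) (monotone_nat_of_le_succ fun n => (hs2 n).2.1)
    (fun n => (hs2 n).2.2)
  refine hL.mono ?_ ?_
  · rintro e ⟨he, he'⟩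
    obtain ⟨n, hn⟩ := mem_iUnion.1 he'
    exact ⟨he, (hs1 n).1 _ hn⟩
  · rintro i ⟨hi, hi'⟩
    rw [hen] at hi'
    obtain ⟨n, hn⟩ := hi'
    exact ⟨hi, mem_iUnion.2 ⟨n + 1, (hs2 n).1 i hn hi⟩⟩

end EM



namespace EM
open Set Relation

variable {V : Type u} {E : Type v} {G : Multigraph V E} {ι : Type v} {σ : ι → V}
  {A : Set E} {I : Set ι} {T : Set V}

section card2
variable {α : Type v} {ν : Cardinal.{v}}

lemma mk_iUnion_le_of (h0 : Cardinal.aleph0 ≤ ν) {Θ : Type v} (hΘ : Cardinal.mk Θ ≤ ν)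
    {S : Θ → Set α} (h : ∀ i, Cardinal.mk (S i) ≤ ν) : Cardinal.mk (⋃ i, S i : Set α) ≤ ν := by
  refine (Cardinal.mk_iUnion_le_sum_mk).trans ?_
  refine (Cardinal.sum_le_sum _ (fun _ => ν) h).trans ?_
  rw [Cardinal.sum_const']
  exact (mul_le_mul_left hΘ ν).trans (Cardinal.mul_eq_self h0).le

lemma mk_biUnion_le_of (h0 : Cardinal.aleph0 ≤ ν) {Θ : Type v} {B : Set Θ} (hΘ : Cardinal.mk B ≤ ν)
    {S : Θ → Set α} (h : ∀ i ∈ B, Cardinal.mk (S i) ≤ ν) : Cardinal.mk (⋃ i ∈ B, S i : Set α) ≤ ν := by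
  rw [biUnion_eq_iUnion]
  exact mk_iUnion_le_of h0 hΘ fun i => h i.1 i.2

lemma mk_union_le_of (h0 : Cardinal.aleph0 ≤ ν) {S S' : Set α} (h : Cardinal.mk S ≤ ν)
    (h' : Cardinal.mk S' ≤ ν) : Cardinal.mk (S ∪ S' : Set α) ≤ ν :=
  (Cardinal.mk_union_le _ _).trans (Cardinal.add_le_of_le h0 h h')

lemma exists_rank (h0 : Cardinal.aleph0 ≤ ν) {S : Set α} (h : Cardinal.mk S ≤ ν) :
    ∃ r : α → ν.ord.ToType, InjOn r S := by
  classical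
  have : Cardinal.mk S ≤ Cardinal.mk ν.ord.ToType := by rwa [Cardinal.mk_ord_toType]
  obtain ⟨f⟩ := this
  have hne : Nonempty ν.ord.ToType := by
    rw [← Cardinal.mk_ne_zero_iff, Cardinal.mk_ord_toType]
    exact (Cardinal.aleph0_pos.trans_le h0).ne'
  refine ⟨fun x => if hx : x ∈ S then f ⟨x, hx⟩ else Classical.arbitrary _, ?_⟩
  intro x hx y hy hxy
  simp only [hx, hy, dif_pos] at hxy
  simpa using f.injective hxy

lemma mk_Iic_lt (h0 : Cardinal.aleph0 ≤ ν) (j : ν.ord.ToType) : Cardinal.mk (Iic j) < ν := by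
  have : Iic j = Iio j ∪ {j} := by ext x; simp [le_iff_lt_or_eq, or_comm]
  rw [this]
  refine (Cardinal.mk_union_le _ _).trans_lt (Cardinal.add_lt_of_lt h0 (Cardinal.mk_Iio_toType_ord_lt j) ?_)
  rw [Cardinal.mk_singleton]
  exact Cardinal.one_lt_aleph0.trans_le h0

lemma mk_rank_lt (h0 : Cardinal.aleph0 ≤ ν) {S : Set α} {r : α → ν.ord.ToType} (hr : InjOn r S)
    (j : ν.ord.ToType) : Cardinal.mk {x | x ∈ S ∧ r x ≤ j} < ν := by
  refine lt_of_le_of_lt ?_ (mk_Iic_lt h0 j)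
  refine Cardinal.mk_le_of_injective (f := fun x => ⟨r x.1, x.2.2⟩) ?_
  intro x y hxy
  have := congrArg Subtype.val hxy
  exact Subtype.ext (hr x.2.1 y.2.1 this)

end card2

theorem LSS_of [Nonempty ι] {ν : Cardinal.{v}} (hreg : ν.IsRegular) (hu : Cardinal.aleph0 < ν)
    (ih : ∀ μ < ν, Cardinal.aleph0 ≤ μ → LS G σ T μ) : LSS G σ T ν := by
  intro A I hun C F hC hF
  have key : ∃ s : ℕ → Set (E ⊕ ι), s 0 = ∅ ∧
      (∀ n, Cardinal.mk (s n) < ν ∧ ¬ Hind G σ (Ad A (s n)) (Id I (s n)) T) ∧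
      ∀ n, C ⊆ s (n + 1) ∧ s n ⊆ s (n + 1) ∧ lval F (s n) ⊆ s (n + 1) ∧
        Linkable G σ (Ai A (s (n + 1) \ s n)) (Ii I (s (n + 1) \ s n)) T := by
    refine nat_construct (fun S : Set (E ⊕ ι) => Cardinal.mk S < ν ∧
      ¬ Hind G σ (Ad A S) (Id I S) T) ∅ ?_ (fun n S S' => C ⊆ S' ∧ S ⊆ S' ∧ lval F S ⊆ S' ∧
        Linkable G σ (Ai A (S' \ S)) (Ii I (S' \ S)) T) ?_
    · refine ⟨mk_fin_lt hreg finite_empty, ?_⟩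
      rw [Ad_empty, Id_empty]
      exact hun
    · rintro n S ⟨hS, hS'⟩
      have hC' : Cardinal.mk (C ∪ (S ∪ lval F S) : Set (E ⊕ ι)) < ν :=
        mk_union_lt hreg hC (mk_union_lt hreg hS (mk_lval_lt hreg hu hS hF))
      obtain ⟨μ, hμ⟩ : ∃ μ, μ = max Cardinal.aleph0 (Cardinal.mk (C ∪ (S ∪ lval F S) : Set (E ⊕ ι))) :=
        ⟨_, rfl⟩
      have h1 : Cardinal.aleph0 ≤ μ := hμ ▸ le_max_left _ _
      have h2 : Cardinal.mk (C ∪ (S ∪ lval F S) : Set (E ⊕ ι)) ≤ μ := hμ ▸ le_max_right _ _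
      have h3 : μ < ν := hμ ▸ max_lt hu hC'
      obtain ⟨Gd, hG1, hG2⟩ := GOOD (Cardinal.isRegular_succ h1) (Order.lt_succ_of_le h1) hun
      obtain ⟨M, k1, k2, k3, k4⟩ := ih μ h3 h1 _ _ hS' _ Gd h2 fun l => Order.le_of_lt_succ (hG1 l)
      refine ⟨M, ⟨k3.trans_lt h3, hG2 M k2 (Order.lt_succ_of_le k3)⟩, ?_, ?_, ?_, ?_⟩
      · exact subset_union_left.trans k1
      · exact (subset_union_left.trans subset_union_right).trans k1
      · exact (subset_union_right.trans subset_union_right).trans k1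
      · rwa [Ai_Ad, Ii_Id] at k4
  obtain ⟨s, h0, h1, h2⟩ := key
  have hm : Monotone s := monotone_nat_of_le_succ fun n => (h2 n).2.1
  refine ⟨⋃ n, s n, (h2 0).1.trans (subset_iUnion s 1), ?_, ?_, ?_⟩
  · exact FCl.iUnion_mono hm fun n => (h2 n).2.2.1.trans (subset_iUnion s _)
  · exact mk_iUnion_nat_lt hreg hu fun n => (h1 n).1
  · exact Linkable.nat h0 hm fun n => (h2 n).2.2.2

theorem LS_regular [Nonempty ι] {ν : Cardinal.{v}} (hreg : ν.IsRegular) (hu : Cardinal.aleph0 < ν)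
    (ih : ∀ μ < ν, Cardinal.aleph0 ≤ μ → LS G σ T μ) : LS G σ T ν := by
  have hss := LSS_of hreg hu ih
  intro A I hun C F hC hF
  have h0 := hreg.aleph0_le
  obtain ⟨Gd, hG1, hG2⟩ := GOOD hreg hu hun
  obtain ⟨rC, hrC⟩ := exists_rank h0 hC
  have hrF : ∀ l, ∃ r : E ⊕ ι → ν.ord.ToType, InjOn r (F l) := fun l => exists_rank h0 (hF l)
  choose rF hrF using hrF
  have key : ∃ M : ν.ord.ToType → Set (E ⊕ ι), (∀ j, Cardinal.mk (M j) < ν) ∧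
      (∀ j, {x | x ∈ C ∧ rC x ≤ j} ⊆ M j) ∧
      (∀ j, FCl (fun l => Gd l ∪ {x | x ∈ F l ∧ rF l x ≤ j}) (⋃ j, M j)) ∧
      Linkable G σ (Ai A (⋃ j, M j)) (Ii I (⋃ j, M j)) T := by
    refine chain_build (fun _ S => Cardinal.mk S < ν) (fun j l => Gd l ∪ {x | x ∈ F l ∧ rF l x ≤ j})
      (fun j => {x | x ∈ C ∧ rC x ≤ j}) ?_ ?_ hun ?_ ?_
    · intro a b hab l
      exact union_subset_union_right _ fun x hx => ⟨hx.1, hx.2.trans hab⟩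
    · intro j M hM
      refine mk_union_lt hreg (mk_rank_lt h0 hrC j) ?_
      exact (Cardinal.card_biUnion_lt_iff_forall_of_isRegular hreg
        (Cardinal.mk_Iio_toType_ord_lt j)).2 fun k hk => hM k hk
    · intro i M hM hcl hne
      obtain ⟨k, hk⟩ := hne
      refine hG2 _ (hcl k hk).left ?_
      exact (Cardinal.card_biUnion_lt_iff_forall_of_isRegular hreg
        (Cardinal.mk_Iio_toType_ord_lt i)).2 fun k hk => hM k hk
    · intro j S hS C' hC'
      obtain ⟨M, k1, k2, k3, k4⟩ := hss _ _ hS C' (fun l => Gd l ∪ {x | x ∈ F l ∧ rF l x ≤ j}) hC'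
        fun l => mk_union_lt hreg (hG1 l) (mk_rank_lt h0 (hrF l) j)
      rw [Ai_Ad, Ii_Id] at k4
      exact ⟨M, k1, k2, k3, k4⟩
  obtain ⟨M, h1, h2, h3, h4⟩ := key
  refine ⟨⋃ j, M j, ?_, ?_, ?_, h4⟩
  · intro x hx
    exact mem_iUnion.2 ⟨rC x, h2 _ ⟨hx, le_rfl⟩⟩
  · intro l hl x hx
    exact (h3 (rF l x)).right l hl ⟨hx, le_rfl⟩
  · exact mk_iUnion_le_of h0 (Cardinal.mk_ord_toType _).le fun j => (h1 j).le

end EM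



namespace EM
open Set Relation

variable {V : Type u} {E : Type v} {G : Multigraph V E} {ι : Type v} {σ : ι → V}
  {A : Set E} {I : Set ι} {T : Set V}

section card3
variable {α : Type v} {ν : Cardinal.{v}}

lemma mk_Iio_card {Y : Type v} [LinearOrder Y] [WellFoundedLT Y] (y : Y) :
    Cardinal.mk (Iio y) = (Ordinal.typein (α := Y) (· < ·) y).card := by
  rfl

lemma mk_short_le {Y : Type v} [LinearOrder Y] [WellFoundedLT Y] (c : Cardinal.{v}) :
    Cardinal.mk {y : Y | Cardinal.mk (Iio y) < c} ≤ c := by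
  have : Cardinal.mk {y : Y | Cardinal.mk (Iio y) < c} ≤ Cardinal.mk c.ord.ToType := by
    refine Cardinal.mk_le_of_injective (f := fun y => Ordinal.ToType.mk
      ⟨Ordinal.typein (α := Y) (· < ·) y.1, Cardinal.lt_ord.2 ((mk_Iio_card y.1).symm.trans_lt y.2)⟩) ?_
    intro x y hxy
    have h1 := Ordinal.ToType.mk.injective hxy
    have h2 := congrArg Subtype.val h1
    exact Subtype.ext ((Ordinal.typein_inj (α := Y) (· < ·)).1 h2)
  rwa [Cardinal.mk_ord_toType] at this

lemma exists_dec {Θ : Type v} [LinearOrder Θ] [Nonempty Θ] {nu : Θ → Cardinal.{v}}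
    (hm : Monotone nu) {B : Set Θ} {S : Set α} (h : ∀ μ < Cardinal.mk S, ∃ j ∈ B, μ < nu j) :
    ∃ r : α → Θ, (∀ x ∈ S, r x ∈ B) ∧ ∀ j, Cardinal.mk {x | x ∈ S ∧ r x ≤ j} ≤ nu j := by
  classical
  have e : Cardinal.mk S = Cardinal.mk (Cardinal.mk S).ord.ToType := by rw [Cardinal.mk_ord_toType]
  obtain ⟨g⟩ := Cardinal.eq.1 e
  have hr : ∀ x : α, ∃ j : Θ, ∀ hx : x ∈ S, j ∈ B ∧ Cardinal.mk (Iio (g ⟨x, hx⟩)) < nu j := by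
    intro x
    by_cases hx : x ∈ S
    · obtain ⟨j, hj, hj'⟩ := h _ (Cardinal.mk_Iio_toType_ord_lt (g ⟨x, hx⟩))
      exact ⟨j, fun _ => ⟨hj, hj'⟩⟩
    · exact ⟨Classical.arbitrary _, fun h => absurd h hx⟩
  choose r hr using hr
  refine ⟨r, fun x hx => (hr x hx).1, fun j => ?_⟩
  refine le_trans ?_ (mk_short_le (Y := (Cardinal.mk S).ord.ToType) (nu j))
  refine Cardinal.mk_le_of_injective (f := fun x => ⟨g ⟨x.1, x.2.1⟩,
    (hr x.1 x.2.1).2.trans_le (hm x.2.2)⟩) ?_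
  intro x y hxy
  have h1 := congrArg Subtype.val hxy
  have h2 := g.injective h1
  exact Subtype.ext (congrArg (fun z : S => z.1) h2)

lemma exists_nuseq (h0 : Cardinal.aleph0 ≤ ν) (hs : ¬ ν.IsRegular) :
    ∃ (Θ : Type v) (_ : LinearOrder Θ) (_ : WellFoundedLT Θ) (_ : Nonempty Θ) (nu : Θ → Cardinal.{v}),
      Monotone nu ∧ (∀ i, nu i < ν) ∧ (∀ i, Cardinal.aleph0 ≤ nu i) ∧ (∀ i, Cardinal.mk Θ ≤ nu i) ∧
      (∀ μ < ν, ∃ i, μ < nu i) := by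
  have hu : Cardinal.aleph0 < ν := by
    refine lt_of_le_of_ne h0 ?_
    rintro rfl
    exact hs Cardinal.isRegular_aleph0
  obtain ⟨s, hs1, hs2⟩ := Order.exists_cof_eq ν.ord.ToType
  have hcf : Cardinal.mk s < ν := by
    rw [hs2, Ordinal.cof_toType]
    by_contra hh
    exact hs ⟨h0, not_lt.1 hh⟩
  have hlim : ∀ μ < ν, Order.succ μ < ν := by
    intro μ hμ
    refine lt_of_le_of_ne (Order.succ_le_of_lt hμ) ?_
    intro e
    have : Cardinal.aleph0 ≤ μ := by
      rw [← e] at hu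
      exact Order.le_of_lt_succ hu
    exact hs (e ▸ Cardinal.isRegular_succ this)
  have hunb : ∀ μ < ν, ∃ i : s, μ < Cardinal.mk (Iic i.1) := by
    intro μ hμ
    have h1 : (Order.succ μ).ord < ν.ord := Cardinal.ord_lt_ord.2 (hlim μ hμ)
    let x : ν.ord.ToType := Ordinal.ToType.mk ⟨(Order.succ μ).ord, h1⟩
    obtain ⟨i, hi, hxi⟩ := hs1 x
    refine ⟨⟨i, hi⟩, ?_⟩
    have h2 : Cardinal.mk (Iio x) = Order.succ μ := by
      rw [mk_Iio_card]
      have : Ordinal.typein (α := ν.ord.ToType) (· < ·) x = (Order.succ μ).ord :=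
        congrArg Subtype.val (Ordinal.ToType.mk.symm_apply_apply ⟨(Order.succ μ).ord, h1⟩)
      rw [this, Cardinal.card_ord]
    calc μ < Order.succ μ := Order.lt_succ μ
      _ = Cardinal.mk (Iio x) := h2.symm
      _ ≤ Cardinal.mk (Iic i) := Cardinal.mk_le_mk_of_subset fun y hy => (le_of_lt hy).trans hxi
  have hne : Nonempty s := by
    obtain ⟨i, _⟩ := hunb 0 (Cardinal.aleph0_pos.trans hu)
    exact ⟨i⟩
  refine ⟨s, inferInstance, inferInstance, hne, fun i => max (max Cardinal.aleph0 (Cardinal.mk s))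
    (Cardinal.mk (Iic i.1)), ?_, ?_, ?_, ?_, ?_⟩
  · intro i j hij
    exact max_le_max le_rfl (Cardinal.mk_le_mk_of_subset (Iic_subset_Iic.2 hij))
  · intro i
    exact max_lt (max_lt hu hcf) (mk_Iic_lt h0 i.1)
  · exact fun i => (le_max_left _ _).trans (le_max_left _ _)
  · exact fun i => (le_max_right _ _).trans (le_max_left _ _)
  · intro μ hμ
    obtain ⟨i, hi⟩ := hunb μ hμ
    exact ⟨i, hi.trans_le (le_max_right _ _)⟩

end card3

theorem LS_singular [Nonempty ι] {ν : Cardinal.{v}} (h0 : Cardinal.aleph0 ≤ ν) (hs : ¬ ν.IsRegular)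
    (ih : ∀ μ < ν, Cardinal.aleph0 ≤ μ → LS G σ T μ) : LS G σ T ν := by
  obtain ⟨Θ, _, _, _, nu, hmono, hlt, hinf, hΘ, hcof⟩ := exists_nuseq h0 hs
  intro A I hun C F hC hF
  let lam : Θ → Cardinal.{v} := fun i => max Cardinal.aleph0 (⨆ j : Iio i, nu j.1)
  have hlam0 : ∀ i, Cardinal.aleph0 ≤ lam i := fun i => le_max_left _ _
  have hlamle : ∀ i, ∀ j ∈ Iio i, nu j ≤ lam i := by
    intro i j hj
    exact (le_ciSup (Cardinal.bddAbove_range (fun j : Iio i => nu j.1)) ⟨j, hj⟩).trans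
      (le_max_right _ _)
  have hlamlt : ∀ i, (Iio i).Nonempty → ∀ μ < lam i, ∃ j ∈ Iio i, μ < nu j := by
    intro i ⟨k, hk⟩ μ hμ
    rcases lt_max_iff.1 hμ with h | h
    · exact ⟨k, hk, h.trans_le (hinf k)⟩
    · have : Nonempty (Iio i) := ⟨⟨k, hk⟩⟩
      obtain ⟨j, hj⟩ := exists_lt_of_lt_ciSup h
      exact ⟨j.1, j.2, hj⟩
  have hG : ∀ i, ∃ F, (∀ l, Cardinal.mk (F l) < Order.succ (lam i)) ∧ ∀ M, FCl F M →
      Cardinal.mk M < Order.succ (lam i) → ¬Hind G σ (Ad A M) (Id I M) T := fun i =>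
    GOOD (Cardinal.isRegular_succ (hlam0 i)) (Order.lt_succ_of_le (hlam0 i)) hun
  choose Gd hG1 hG2 using hG
  have hrG : ∀ i l, ∃ r : E ⊕ ι → Θ, (Iio i).Nonempty → (∀ x ∈ Gd i l, r x ∈ Iio i) ∧
      ∀ j, Cardinal.mk {x | x ∈ Gd i l ∧ r x ≤ j} ≤ nu j := by
    intro i l
    by_cases hne : (Iio i).Nonempty
    · obtain ⟨r, hr⟩ := exists_dec hmono (B := Iio i) (S := Gd i l) fun μ hμ =>
        hlamlt i hne μ (hμ.trans_le (Order.le_of_lt_succ (hG1 i l)))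
      exact ⟨r, fun _ => hr⟩
    · exact ⟨fun _ => Classical.arbitrary _, fun h => absurd h hne⟩
  choose rG hrG using hrG
  have hD : ∀ S : Set (E ⊕ ι), Cardinal.mk S ≤ ν → ∃ r : E ⊕ ι → Θ,
      ∀ j, Cardinal.mk {x | x ∈ S ∧ r x ≤ j} ≤ nu j := by
    intro S hS
    obtain ⟨r, _, hr⟩ := exists_dec hmono (B := univ) (S := S) fun μ hμ => by
      obtain ⟨i, hi⟩ := hcof μ (hμ.trans_le hS)
      exact ⟨i, mem_univ _, hi⟩
    exact ⟨r, hr⟩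
  obtain ⟨rC, hrC⟩ := hD C hC
  choose rF hrF using fun l => hD (F l) (hF l)
  let f : Θ → List (E ⊕ ι) → Set (E ⊕ ι) := fun j l => {x | x ∈ F l ∧ rF l x ≤ j} ∪
    ⋃ i ∈ {i : Θ | (Iio i).Nonempty}, {x | x ∈ Gd i l ∧ rG i l x ≤ j}
  have hfs : ∀ j l, Cardinal.mk (f j l) ≤ nu j := by
    intro j l
    refine mk_union_le_of (hinf j) (hrF l j) ?_
    refine mk_biUnion_le_of (hinf j) ((Cardinal.mk_set_le _).trans (hΘ j)) ?_
    intro i hi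
    exact (hrG i l hi).2 j
  have key : ∃ M : Θ → Set (E ⊕ ι), (∀ j, Cardinal.mk (M j) ≤ nu j) ∧
      (∀ j, {x | x ∈ C ∧ rC x ≤ j} ⊆ M j) ∧
      (∀ j, FCl (f j) (⋃ j, M j)) ∧
      Linkable G σ (Ai A (⋃ j, M j)) (Ii I (⋃ j, M j)) T := by
    refine chain_build (fun j S => Cardinal.mk S ≤ nu j) f
      (fun j => {x | x ∈ C ∧ rC x ≤ j}) ?_ ?_ hun ?_ ?_
    · intro a b hab l
      refine union_subset_union (fun x hx => ⟨hx.1, hx.2.trans hab⟩) ?_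
      exact biUnion_mono Subset.rfl fun i _ x hx => ⟨hx.1, hx.2.trans hab⟩
    · intro j M hM
      refine mk_union_le_of (hinf j) (hrC j) ?_
      refine mk_biUnion_le_of (hinf j) ((Cardinal.mk_set_le _).trans (hΘ j)) ?_
      exact fun k hk => (hM k hk).trans (hmono (le_of_lt hk))
    · intro i M hM hcl hne
      refine hG2 i _ ?_ ?_
      · intro l hl x hx
        have hk := (hrG i l hne).1 x hx
        exact hcl _ hk l hl (Or.inr (mem_biUnion (show i ∈ {i : Θ | (Iio i).Nonempty} from hne)
          ⟨hx, le_rfl⟩))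
      · refine Order.lt_succ_of_le ?_
        obtain ⟨k0, hk0⟩ := hne
        refine mk_biUnion_le_of (hlam0 i) ((Cardinal.mk_set_le _).trans
          ((hΘ k0).trans (hlamle i k0 hk0))) ?_
        exact fun k hk => (hM k hk).trans (hlamle i k hk)
    · intro j S hS C' hC'
      obtain ⟨M, k1, k2, k3, k4⟩ := ih (nu j) (hlt j) (hinf j) _ _ hS C' (f j) hC' (hfs j)
      rw [Ai_Ad, Ii_Id] at k4
      exact ⟨M, k1, k2, k3, k4⟩
  obtain ⟨M, h1, h2, h3, h4⟩ := key
  refine ⟨⋃ j, M j, ?_, ?_, ?_, h4⟩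
  · intro x hx
    exact mem_iUnion.2 ⟨rC x, h2 _ ⟨hx, le_rfl⟩⟩
  · intro l hl x hx
    exact (h3 (rF l x)).left l hl ⟨hx, le_rfl⟩
  · refine mk_iUnion_le_of h0 ?_ fun j => (h1 j).trans (hlt j).le
    exact (hΘ (Classical.arbitrary Θ)).trans (hlt _).le

theorem LS_all [Nonempty ι] (ν : Cardinal.{v}) (h0 : Cardinal.aleph0 ≤ ν) : LS G σ T ν := by
  induction ν using Cardinal.lt_wf.induction with
  | _ ν ih =>
    by_cases hr : ν.IsRegular
    · rcases h0.lt_or_eq with h | h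
      · exact LS_regular hr h ih
      · rw [← h]
        exact LS_aleph0
    · exact LS_singular h0 hr ih

/-- unhindered webs are linkable -/
theorem linkable_of_unhind [Nonempty ι] (hun : ¬ Hind G σ A I T) : Linkable G σ A I T := by
  obtain ⟨M, h1, -, -, h2⟩ := LS_all (G := G) (σ := σ) (T := T)
    (max Cardinal.aleph0 (Cardinal.mk (E ⊕ ι))) (le_max_left _ _) A I hun univ (fun _ => ∅)
    ((Cardinal.mk_set_le _).trans (le_max_right _ _))
    (fun l => (Cardinal.mk_set_le _).trans (le_max_right _ _))
  refine h2.mono (fun e he => he.1) fun i hi => ⟨hi, h1 (mem_univ _)⟩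

end EM



namespace EM
open Set Relation

variable {V : Type u} {E : Type v} {G : Multigraph V E}

lemma cut_compl (X : Set V) : G.cut Xᶜ = G.cut X := by
  ext e
  obtain ⟨x, y, h⟩ := exists_ends (G := G) e
  rw [cut_iff h, cut_iff h]
  simp only [mem_compl_iff, not_not]
  tauto

lemma inn_compl {X : Set V} {e : E} (h : e ∈ G.cut X) : inn G Xᶜ e = out G X e := by
  obtain ⟨h1, h2, h3⟩ := inc_eq h
  exact (inn_eq (W := Xᶜ) (by rw [h1, Sym2.eq_swap]) h3 (by simpa using h2)).1

lemma out_compl {X : Set V} {e : E} (h : e ∈ G.cut X) : out G Xᶜ e = inn G X e := by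
  obtain ⟨h1, h2, h3⟩ := inc_eq h
  exact (inn_eq (W := Xᶜ) (by rw [h1, Sym2.eq_swap]) h3 (by simpa using h2)).2

lemma ins_compl_tch {X : Set V} {e : E} (h : e ∉ Tch G X) : e ∈ Ins G Xᶜ :=
  fun x hx hx' => h ⟨x, hx, hx'⟩

def SL (G : Multigraph V E) (s : V) (X : Set V) : Prop :=
  ∃ P : E → Set E, (∀ e ∈ G.cut X, P e ⊆ Ins G X ∧ Conn G (P e) s (inn G X e)) ∧
    ∀ e ∈ G.cut X, ∀ f ∈ G.cut X, ∀ g, g ∈ P e → g ∈ P f → e = f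

lemma Conn.fin_sub {F : Set E} {a b : V} (h : Conn G F a b) :
    ∃ F', F' ⊆ F ∧ F'.Finite ∧ Conn G F' a b := by
  induction h with
  | refl => exact ⟨∅, empty_subset _, finite_empty, Conn.refl _⟩
  | tail _ h2 ih =>
    obtain ⟨e, he, hh⟩ := h2
    obtain ⟨F', h1, h2, h3⟩ := ih
    exact ⟨insert e F', insert_subset he h1, h2.insert e,
      (h3.mono (subset_insert _ _)).trans (Conn.single (mem_insert _ _) hh)⟩

lemma SL.wave {s : V} {X T : Set V} (h : SL G s X) (hd : Disjoint X T) :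
    Wave G (fun _ : E => s) univ univ T X := by
  classical
  obtain ⟨P, h1, h2⟩ := h
  have hx : ∀ e, ∃ F, e ∈ G.cut X → F ⊆ P e ∧ F.Finite ∧ Conn G F s (inn G X e) := by
    intro e
    by_cases he : e ∈ G.cut X
    · obtain ⟨F, hF⟩ := (h1 e he).2.fin_sub
      exact ⟨F, fun _ => hF⟩
    · exact ⟨∅, fun h => absurd h he⟩
  choose F hF using hx
  refine ⟨hd, id, F, fun _ _ => mem_univ _, fun e he => (hF e he.2).2.1, fun _ _ => subset_univ _,
    fun e he => (hF e he.2).1.trans (h1 e he.2).1, fun e he => (hF e he.2).2.2,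
    fun _ _ _ _ h => h, ?_⟩
  intro e he f hf g hg hg'
  exact h2 e he.2 f hf.2 g ((hF e he.2).1 hg) ((hF f hf.2).1 hg')

lemma Wave.sl {s : V} {X T : Set V} (h : Wave G (fun _ : E => s) univ univ T X) : SL G s X := by
  obtain ⟨_, u, P, hL⟩ := h
  refine ⟨P, fun e he => ⟨hL.ins e ⟨mem_univ _, he⟩, hL.conn e ⟨mem_univ _, he⟩⟩, ?_⟩
  intro e he f hf
  exact hL.disj e ⟨mem_univ _, he⟩ f ⟨mem_univ _, hf⟩

lemma SL.singleton (s : V) : SL G s {s} := by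
  refine ⟨fun _ => ∅, fun e he => ⟨empty_subset _, ?_⟩, by simp⟩
  have := (inc_eq he).2.1
  rw [mem_singleton_iff] at this
  rw [this]
  exact Conn.refl _

/-- `X` is the `s`-side of an Erdős–Menger cut -/
def EMs (G : Multigraph V E) (s t : V) (X : Set V) : Prop :=
  s ∈ X ∧ t ∉ X ∧ SL G s X ∧ SL G t Xᶜ

lemma EMs.compl {s t : V} {X : Set V} (h : EMs G s t X) : EMs G t s Xᶜ :=
  ⟨h.2.1, fun h' => h' h.1, h.2.2.2, by rw [compl_compl]; exact h.2.2.1⟩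

lemma extend_link {s t : V} {X0 Y : Set V} (hS : SL G s X0) (hd : Disjoint Y X0)
    (hY : ∀ c ∈ G.cut Y, t ∈ Y)
    (hL : Linkable G (Qs G (fun _ : E => t) Y) (univ \ Tch G Y)
      (QI G (fun _ : E => t) univ univ Y) (X0 ∪ Y)) : SL G s Yᶜ := by
  classical
  obtain ⟨R, hR1, hR2⟩ := hS
  obtain ⟨P, hP1, hP2⟩ := hL
  have hX0 : X0 ⊆ Yᶜ := fun x hx hx' => disjoint_left.1 hd hx' hx
  have hmem : ∀ c ∈ G.cut Y, (Sum.inr c : E ⊕ E) ∈ QI G (fun _ : E => t) univ univ Y := by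
    intro c hc
    rw [inr_mem_QI]
    exact ⟨mem_univ _, hc⟩
  have hx : ∀ c, ∃ d K, c ∈ G.cut Y → d ∈ G.cut X0 ∧ d ∈ insert c (P (Sum.inr c)) ∧
      K ⊆ P (Sum.inr c) ∧ Disjoint K (Ins G X0) ∧ Conn G (R d ∪ K) s (out G Y c) := by
    intro c
    by_cases hc : c ∈ G.cut Y
    swap
    · exact ⟨c, ∅, fun h => absurd h hc⟩
    obtain ⟨hsub, z, hz, hcon⟩ := hP1 _ (hmem c hc)
    rw [Qs_inr] at hcon
    obtain ⟨hc1, hc2, hc3⟩ := inc_eq hc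
    have hzX : z ∈ X0 := by
      rcases hz with hz | hz
      · exact hz
      · exact absurd (stay hcon hz fun e he he' => (hsub he).2 (cut_tch he')).1 hc3
    by_cases ho : out G Y c ∈ X0
    · have hi : inn G Y c ∉ X0 := disjoint_left.1 hd hc2
      have hinc : G.inc c = s(out G Y c, inn G Y c) := by rw [hc1, Sym2.eq_swap]
      have hcc : c ∈ G.cut X0 := ⟨_, _, hinc, ho, hi⟩
      refine ⟨c, ∅, fun _ => ⟨hcc, mem_insert _ _, empty_subset _, disjoint_bot_left, ?_⟩⟩
      rw [union_empty, ← (inn_eq hinc ho hi).1]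
      exact (hR1 c hcc).2
    · obtain ⟨d, hd1, hd2⟩ := firstexit (W := X0ᶜ) hcon ho (by simpa using hzX)
      have hdX : d ∈ G.cut X0 := by rw [← cut_compl]; exact hd1.2
      obtain ⟨k1, k2, k3⟩ := inc_eq hdX
      refine ⟨d, insert d (P (Sum.inr c) ∩ Ins G X0ᶜ), fun _ => ⟨hdX, mem_insert_of_mem _ hd1.1,
        insert_subset hd1.1 inter_subset_left, ?_, ?_⟩⟩
      · rw [disjoint_left]
        rintro e (rfl | he) he'
        · exact ins_not_cut he' hdX
        · obtain ⟨x, y, hxy⟩ := exists_ends (G := G) e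
          exact ((ins_iff hxy).1 he.2).1 ((ins_iff hxy).1 he').1
      · refine ((hR1 d hdX).2.mono subset_union_left).trans ?_
        refine (Conn.single (e := d) (show d ∈ R d ∪ insert d (P (Sum.inr c) ∩ Ins G X0ᶜ) from Or.inr (mem_insert _ _)) k1).trans ?_
        rw [← inn_compl hdX]
        exact hd2.symm.mono ((subset_insert _ _).trans subset_union_right)
  choose d K hdK using hx
  refine ⟨fun c => R (d c) ∪ K c, ?_, ?_⟩
  · intro c hc
    rw [cut_compl] at hc
    obtain ⟨h1, h2, h3, h4, h5⟩ := hdK c hc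
    refine ⟨union_subset ((hR1 _ h1).1.trans (ins_mono hX0)) ?_, ?_⟩
    · exact fun e he => ins_compl_tch ((hP1 _ (hmem c hc)).1 (h3 he)).2
    · rw [inn_compl hc]
      exact h5
  · intro c hc c' hc' g hg hg'
    rw [cut_compl] at hc hc'
    obtain ⟨h1, h2, h3, h4, -⟩ := hdK c hc
    obtain ⟨h1', h2', h3', h4', -⟩ := hdK c' hc'
    have hPP : ∀ a ∈ G.cut Y, ∀ b ∈ G.cut Y, ∀ g, g ∈ P (Sum.inr a) → g ∈ P (Sum.inr b) → a = b :=
      fun a ha b hb g hga hgb => Sum.inr.inj (hP2 _ (hmem a ha) _ (hmem b hb) g hga hgb)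
    rcases hg with hg | hg <;> rcases hg' with hg' | hg'
    · have e := hR2 _ h1 _ h1' g hg hg'
      rw [← e] at h2'
      rcases h2 with h2 | h2 <;> rcases h2' with h2' | h2'
      · exact h2.symm.trans h2'
      · rw [h2] at h2'
        exact absurd (cut_tch hc) ((hP1 _ (hmem c' hc')).1 h2').2
      · rw [h2'] at h2
        exact absurd (cut_tch hc') ((hP1 _ (hmem c hc)).1 h2).2
      · exact hPP c hc c' hc' _ h2 h2'
    · exact absurd ((hR1 _ h1).1 hg) (disjoint_left.1 h4' hg')
    · exact absurd ((hR1 _ h1').1 hg') (disjoint_left.1 h4 hg)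
    · exact hPP c hc c' hc' g (h3 hg) (h3' hg')

theorem EMs_lub [Nonempty E] {s t : V} (hst : s ≠ t) (𝒳 : Set (Set V))
    (h : ∀ X ∈ 𝒳, EMs G s t X) : ∃ X, EMs G s t X ∧ (∀ X' ∈ 𝒳, X' ⊆ X) ∧
      ∀ Z, EMs G s t Z → (∀ X' ∈ 𝒳, X' ⊆ Z) → X ⊆ Z := by
  have h0 : ∀ X : (insert {s} 𝒳 : Set (Set V)), Wave G (fun _ : E => s) univ univ {t} X.1 := by
    rintro ⟨X, rfl | hX⟩
    · exact (SL.singleton s).wave (by simpa using hst)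
    · exact (h X hX).2.2.1.wave (by simpa using (h X hX).2.1)
  have hW := Wave.iUnion h0
  obtain ⟨X0, hX0⟩ : ∃ X0, X0 = ⋃ X : (insert {s} 𝒳 : Set (Set V)), X.1 := ⟨_, rfl⟩
  rw [← hX0] at hW
  have hsX : s ∈ X0 := by rw [hX0]; exact mem_iUnion.2 ⟨⟨{s}, mem_insert _ _⟩, rfl⟩
  have hXX : ∀ X ∈ 𝒳, X ⊆ X0 := by
    intro X hX x hx
    rw [hX0]
    exact mem_iUnion.2 ⟨⟨X, mem_insert_of_mem _ hX⟩, hx⟩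
  have htX : t ∉ X0 := by simpa using hW.1
  obtain ⟨Y, hY⟩ := exists_greatest G (fun _ : E => t) univ univ X0
  have htY : t ∈ Y := hY.2 {t} ((SL.singleton t).wave (by simpa using htX)) rfl
  have hYX := hY.1.1
  have hlink := linkable_of_unhind hY.quot.unhind
  have hsl := extend_link hW.sl hYX (fun _ _ => htY) hlink
  refine ⟨Yᶜ, ⟨fun h => disjoint_left.1 hYX h hsX, fun h => h htY, hsl, ?_⟩, ?_, ?_⟩
  · rw [compl_compl]
    exact hY.1.sl
  · exact fun X hX x hx hx' => disjoint_left.1 hYX hx' (hXX X hX hx)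
  · intro Z hZ hZX
    have hX0Z : X0 ⊆ Z := by
      rw [hX0]
      refine iUnion_subset ?_
      rintro ⟨X, rfl | hX⟩
      · exact singleton_subset_iff.2 hZ.1
      · exact hZX X hX
    have := hY.2 Zᶜ (hZ.2.2.2.wave (disjoint_left.2 fun x hx hx' => hx (hX0Z hx')))
    intro x hx
    by_contra hh
    exact hx (this hh)

theorem EMs_glb [Nonempty E] {s t : V} (hst : s ≠ t) (𝒳 : Set (Set V))
    (h : ∀ X ∈ 𝒳, EMs G s t X) : ∃ X, EMs G s t X ∧ (∀ X' ∈ 𝒳, X ⊆ X') ∧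
      ∀ Z, EMs G s t Z → (∀ X' ∈ 𝒳, Z ⊆ X') → Z ⊆ X := by
  obtain ⟨X, h1, h2, h3⟩ := EMs_lub (G := G) hst.symm (compl '' 𝒳) (by
    rintro _ ⟨X, hX, rfl⟩
    exact (h X hX).compl)
  refine ⟨Xᶜ, h1.compl, ?_, ?_⟩
  · intro X' hX'
    exact compl_subset_comm.1 (h2 _ (mem_image_of_mem _ hX'))
  · intro Z hZ hZX
    refine subset_compl_comm.1 (h3 _ hZ.compl ?_)
    rintro _ ⟨X', hX', rfl⟩
    exact compl_subset_compl.2 (hZX X' hX')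

lemma walk_conn {a b : V} (p : G.Walk a b) : Conn G {e | e ∈ p.edges} a b := by
  induction p with
  | nil v => exact Conn.refl _
  | cons e he p ih =>
    refine (Conn.single (e := e) ?_ he).trans (ih.mono ?_)
    · simp [Multigraph.Walk.edges]
    · intro f hf
      simp only [mem_setOf_eq] at hf
      simp [Multigraph.Walk.edges, hf]

lemma walk_suffix {a b : V} (p : G.Walk a b) (hp : p.support.Nodup) (x : V) (hx : x ∈ p.support) :
    ∃ q : G.Walk x b, q.support.Nodup ∧ ∀ e ∈ q.edges, e ∈ p.edges := by
  induction p with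
  | nil v =>
    simp only [Multigraph.Walk.support, List.mem_singleton] at hx
    subst hx
    exact ⟨.nil _, by simp [Multigraph.Walk.support], by simp [Multigraph.Walk.edges]⟩
  | @cons a c b e he p ih =>
    by_cases hxa : x = a
    · subst hxa
      exact ⟨.cons e he p, hp, fun _ h => h⟩
    · simp only [Multigraph.Walk.support, List.mem_cons, List.nodup_cons] at hx hp
      obtain ⟨q, h1, h2⟩ := ih hp.2 (hx.resolve_left hxa)
      exact ⟨q, h1, fun f hf => by simp [Multigraph.Walk.edges, h2 f hf]⟩

lemma conn_walk {F : Set E} {a b : V} (h : Conn G F a b) :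
    ∃ q : G.Walk a b, q.support.Nodup ∧ ∀ e ∈ q.edges, e ∈ F := by
  induction h using ReflTransGen.head_induction_on with
  | refl => exact ⟨.nil _, by simp [Multigraph.Walk.support], by simp [Multigraph.Walk.edges]⟩
  | @head a c h1 h2 ih =>
    obtain ⟨e, he, hh⟩ := h1
    obtain ⟨q, hq1, hq2⟩ := ih
    by_cases ha : a ∈ q.support
    · obtain ⟨q', k1, k2⟩ := walk_suffix q hq1 a ha
      exact ⟨q', k1, fun f hf => hq2 f (k2 f hf)⟩
    · refine ⟨.cons e hh q, ?_, ?_⟩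
      · simp only [Multigraph.Walk.support, List.nodup_cons]
        exact ⟨ha, hq1⟩
      · intro f hf
        simp only [Multigraph.Walk.edges, List.mem_cons] at hf
        rcases hf with rfl | hf
        · exact he
        · exact hq2 f hf

lemma emcut_side {s t : V} {C : Set E} (h : G.IsEMCut s t C) : ∃ X, C = G.cut X ∧ EMs G s t X := by
  classical
  obtain ⟨⟨X, hs, ht, rfl⟩, P, hd, hu, hc⟩ := h
  refine ⟨X, rfl, hs, ht, ?_, ?_⟩
  · have hx : ∀ e, ∃ F : Set E, e ∈ G.cut X → ∃ p ∈ P, e ∈ p.walk.edges ∧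
        F ⊆ {g | g ∈ p.walk.edges} ∧ F ⊆ Ins G X ∧ Conn G F s (inn G X e) := by
      intro e
      by_cases he : e ∈ G.cut X
      · obtain ⟨p, hp, hep⟩ := hc e he
        obtain ⟨c, hc1, hc2⟩ := firstexit (walk_conn p.walk) hs ht
        have : c = e := (hu p hp).unique ⟨hc1.2, hc1.1⟩ ⟨he, hep⟩
        subst this
        exact ⟨_, fun _ => ⟨p, hp, hep, inter_subset_left, inter_subset_right, hc2⟩⟩
      · exact ⟨∅, fun h => absurd h he⟩
    choose F hF using hx
    refine ⟨F, fun e he => ?_, ?_⟩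
    · obtain ⟨p, _, _, _, h1, h2⟩ := hF e he
      exact ⟨h1, h2⟩
    · intro e he f hf g hg hg'
      obtain ⟨p, hp, h1, h2, _, _⟩ := hF e he
      obtain ⟨q, hq, k1, k2, _, _⟩ := hF f hf
      by_cases hpq : p = q
      · subst hpq
        exact (hu p hp).unique ⟨he, h1⟩ ⟨hf, k1⟩
      · exact absurd (k2 hg') (hd p hp q hq hpq g (h2 hg))
  · have hx : ∀ e, ∃ F : Set E, e ∈ G.cut Xᶜ → ∃ p ∈ P, e ∈ p.walk.edges ∧
        F ⊆ {g | g ∈ p.walk.edges} ∧ F ⊆ Ins G Xᶜ ∧ Conn G F t (inn G Xᶜ e) := by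
      intro e
      by_cases he : e ∈ G.cut Xᶜ
      · have he' := he
        rw [cut_compl] at he'
        obtain ⟨p, hp, hep⟩ := hc e he'
        obtain ⟨c, hc1, hc2⟩ := firstexit (W := Xᶜ) (walk_conn p.walk).symm ht (by simpa using hs)
        have : c = e := (hu p hp).unique ⟨by rw [← cut_compl]; exact hc1.2, hc1.1⟩ ⟨he', hep⟩
        subst this
        exact ⟨_, fun _ => ⟨p, hp, hep, inter_subset_left, inter_subset_right, hc2⟩⟩
      · exact ⟨∅, fun h => absurd h he⟩
    choose F hF using hx
    refine ⟨F, fun e he => ?_, ?_⟩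
    · obtain ⟨p, _, _, _, h1, h2⟩ := hF e he
      exact ⟨h1, h2⟩
    · intro e he f hf g hg hg'
      obtain ⟨p, hp, h1, h2, _, _⟩ := hF e he
      obtain ⟨q, hq, k1, k2, _, _⟩ := hF f hf
      rw [cut_compl] at he hf
      by_cases hpq : p = q
      · subst hpq
        exact (hu p hp).unique ⟨he, h1⟩ ⟨hf, k1⟩
      · exact absurd (k2 hg') (hd p hp q hq hpq g (h2 hg))

lemma EMs.emcut {s t : V} {X : Set V} (h : EMs G s t X) : G.IsEMCut s t (G.cut X) := by
  obtain ⟨hs, ht, ⟨P, hP1, hP2⟩, ⟨Q, hQ1, hQ2⟩⟩ := h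
  rw [cut_compl] at hQ1 hQ2
  have hex : ∀ e : G.cut X, ∃ p : G.STPath s t, ∀ g ∈ p.walk.edges, g ∈ P e ∪ {e.1} ∪ Q e := by
    rintro ⟨e, he⟩
    obtain ⟨h1, h2, h3⟩ := inc_eq he
    have hcon : Conn G (P e ∪ {e} ∪ Q e) s t := by
      refine ((hP1 e he).2.mono (fun g hg => Or.inl (Or.inl hg))).trans ?_
      refine (Conn.single (e := e) (show e ∈ P e ∪ {e} ∪ Q e from Or.inl (Or.inr rfl)) h1).trans ?_
      rw [← inn_compl he]
      exact (hQ1 e he).2.symm.mono subset_union_right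
    obtain ⟨q, hq1, hq2⟩ := conn_walk hcon
    exact ⟨⟨q, hq1⟩, hq2⟩
  choose p hp using hex
  have hPi : ∀ e ∈ G.cut X, ∀ g ∈ P e, g ∉ G.cut X := fun e he g hg => ins_not_cut ((hP1 e he).1 hg)
  have hQi : ∀ e ∈ G.cut X, ∀ g ∈ Q e, g ∉ G.cut X := fun e he g hg h =>
    ins_not_cut ((hQ1 e he).1 hg) (by rwa [cut_compl])
  have hPQ : ∀ e ∈ G.cut X, ∀ f ∈ G.cut X, ∀ g, g ∈ P e → g ∈ Q f → False := by
    intro e he f hf g hg hg'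
    obtain ⟨x, y, hxy⟩ := exists_ends (G := G) g
    exact ((ins_iff hxy).1 ((hQ1 f hf).1 hg')).1 ((ins_iff hxy).1 ((hP1 e he).1 hg)).1
  have huniq : ∀ (e : G.cut X), ∀ g ∈ (p e).walk.edges, g ∈ G.cut X → g = e.1 := by
    intro e g hg hgc
    rcases hp e g hg with (h | h) | h
    · exact absurd hgc (hPi e.1 e.2 g h)
    · exact h
    · exact absurd hgc (hQi e.1 e.2 g h)
  have hself : ∀ e : G.cut X, e.1 ∈ (p e).walk.edges := by
    intro e
    obtain ⟨c, hc1, _⟩ := firstexit (walk_conn (p e).walk) hs ht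
    have := huniq e c hc1.1 hc1.2
    rw [← this]
    exact hc1.1
  refine ⟨⟨X, hs, ht, rfl⟩, range p, ?_, ?_, ?_⟩
  · rintro _ ⟨e, rfl⟩ _ ⟨f, rfl⟩ hne g hg hg'
    apply hne
    have : e.1 = f.1 := by
      rcases hp e g hg with (h | h) | h <;> rcases hp f g hg' with (h' | h') | h'
      · exact hP2 e.1 e.2 f.1 f.2 g h h'
      · exact absurd (h' ▸ f.2) (hPi e.1 e.2 g h)
      · exact (hPQ e.1 e.2 f.1 f.2 g h h').elim
      · exact absurd (h ▸ e.2) (hPi f.1 f.2 g h')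
      · exact h.symm.trans h'
      · exact absurd (h ▸ e.2) (hQi f.1 f.2 g h')
      · exact (hPQ f.1 f.2 e.1 e.2 g h' h).elim
      · exact absurd (h' ▸ f.2) (hQi e.1 e.2 g h)
      · exact hQ2 e.1 e.2 f.1 f.2 g h h'
    rw [Subtype.ext this]
  · rintro _ ⟨e, rfl⟩
    exact ⟨e.1, ⟨e.2, hself e⟩, fun g hg => huniq e g hg.2 hg.1⟩
  · intro e he
    exact ⟨p ⟨e, he⟩, mem_range_self _, hself ⟨e, he⟩⟩

lemma side_unique (hconn : G.Connected) {s : V} {X X' : Set V} (hs : s ∈ X) (hs' : s ∈ X')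
    (h : G.cut X = G.cut X') : X = X' := by
  have key : ∀ v, v ∈ X ↔ v ∈ X' := by
    intro v
    have hc : Conn G (univ : Set E) s v := by
      obtain ⟨p⟩ := hconn s v
      exact (walk_conn p).mono (subset_univ _)
    induction hc with
    | refl => exact ⟨fun _ => hs', fun _ => hs⟩
    | tail _ h2 ih =>
      obtain ⟨e, _, hh⟩ := h2
      have := congrArg (fun C : Set E => e ∈ C) h
      simp only [eq_iff_iff] at this
      rw [cut_iff hh, cut_iff hh] at this
      tauto
  exact ext key

lemma CutLE.sub (hconn : G.Connected) {s t : V} {X Y : Set V} (hX : s ∈ X) (hY : s ∈ Y)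
    (h : G.CutLE s t (G.cut X) (G.cut Y)) : X ⊆ Y := by
  obtain ⟨X1, Y1, h1, _, h2, h3, _, h4, h5⟩ := h
  rw [side_unique hconn hX h1 h2, side_unique hconn hY h3 h4]
  exact h5

lemma EMs.cutLE {s t : V} {X Y : Set V} (hX : EMs G s t X) (hY : EMs G s t Y) (h : X ⊆ Y) :
    G.CutLE s t (G.cut X) (G.cut Y) :=
  ⟨X, Y, hX.1, hX.2.1, rfl, hY.1, hY.2.1, rfl, h⟩

theorem final (hconn : G.Connected) {s t : V} (hst : s ≠ t) :
    ∀ S : Set (Set E), (∀ C ∈ S, G.IsEMCut s t C) →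
      (∃ C, G.IsEMCut s t C ∧ (∀ D ∈ S, G.CutLE s t D C) ∧
        ∀ C', G.IsEMCut s t C' → (∀ D ∈ S, G.CutLE s t D C') → G.CutLE s t C C') ∧
      (∃ C, G.IsEMCut s t C ∧ (∀ D ∈ S, G.CutLE s t C D) ∧
        ∀ C', G.IsEMCut s t C' → (∀ D ∈ S, G.CutLE s t C' D) → G.CutLE s t C' C) := by
  intro S hS
  have hE : Nonempty E := by
    obtain ⟨p⟩ := hconn s t
    cases p with
    | nil => exact absurd rfl hst
    | cons e _ _ => exact ⟨e⟩
  constructor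
  · obtain ⟨X, h1, h2, h3⟩ := EMs_lub hst {X | EMs G s t X ∧ G.cut X ∈ S} fun X hX => hX.1
    refine ⟨G.cut X, h1.emcut, ?_, ?_⟩
    · intro D hD
      obtain ⟨Z, rfl, hZ⟩ := emcut_side (hS D hD)
      exact hZ.cutLE h1 (h2 Z ⟨hZ, hD⟩)
    · intro C' hC' hle
      obtain ⟨Z, rfl, hZ⟩ := emcut_side hC'
      exact h1.cutLE hZ (h3 Z hZ fun X' hX' => CutLE.sub hconn hX'.1.1 hZ.1 (hle _ hX'.2))
  · obtain ⟨X, h1, h2, h3⟩ := EMs_glb hst {X | EMs G s t X ∧ G.cut X ∈ S} fun X hX => hX.1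
    refine ⟨G.cut X, h1.emcut, ?_, ?_⟩
    · intro D hD
      obtain ⟨Z, rfl, hZ⟩ := emcut_side (hS D hD)
      exact h1.cutLE hZ (h2 Z ⟨hZ, hD⟩)
    · intro C' hC' hle
      obtain ⟨Z, rfl, hZ⟩ := emcut_side hC'
      exact hZ.cutLE h1 (h3 Z hZ fun X' hX' => CutLE.sub hconn hZ.1 hX'.1.1 (hle _ hX'.2))

end EM


/-- The Erdős–Menger `st`-cuts ordered by `≼` form a complete lattice:
every family of Erdős–Menger `st`-cuts has a least upper bound and a greatest
lower bound among the Erdős–Menger `st`-cuts with respect to `≼`. -/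
theorem emCuts_completeLattice {V : Type u} {E : Type v} (G : Multigraph V E)
    (s t : V) (hconn : G.Connected) (hst : s ≠ t) :
    ∀ S : Set (Set E), (∀ C ∈ S, G.IsEMCut s t C) →
      (∃ C, G.IsEMCut s t C ∧ (∀ D ∈ S, G.CutLE s t D C) ∧
        ∀ C', G.IsEMCut s t C' → (∀ D ∈ S, G.CutLE s t D C') → G.CutLE s t C C') ∧
      (∃ C, G.IsEMCut s t C ∧ (∀ D ∈ S, G.CutLE s t C D) ∧
        ∀ C', G.IsEMCut s t C' → (∀ D ∈ S, G.CutLE s t C' D) → G.CutLE s t C' C) := by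
  exact EM.final hconn hst
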